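/- Let F be a finite field with |F| = q, and let Q⁺ be the quadratic form on F⁸ defined by Q⁺(v) = v₁v₅ + v₂v₆ + v₃v₇ + v₄v₈. Let O(Q⁺) be the group of F-linear automorphisms g of F⁸ satisfying Q⁺(g(v)) = Q⁺(v) for all v, and let Ω₈⁺(q) be the derived (commutator) subgroup of O(Q⁺). Then Ω₈⁺(q) is (2,3)-generated if and only if q ≥ 4. -/

import Mathlib

open Matrix

/-- A group is `(2,3)`-generated if it is generated by an element of order 2
together with an element of order 3. -/
def IsTwoThreeGenerated (G : Type*) [Group G] : Prop :=
  ∃ x y : G, orderOf x = 2 ∧ orderOf y = 3 ∧ Subgroup.closure {x, y} = ⊤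

/-- The plus-type quadratic form `Q⁺(v) = v₁v₅ + v₂v₆ + v₃v₇ + v₄v₈` on `F⁸`. -/
def QPlus (F : Type*) [Field F] (v : Fin 8 → F) : F :=
  v 0 * v 4 + v 1 * v 5 + v 2 * v 6 + v 3 * v 7

/-- The group of linear automorphisms of `F⁸` preserving the form `Q`,
as a subgroup of `GL₈(F)`. -/
def orthogonalGroupOf (F : Type*) [Field F] (Q : (Fin 8 → F) → F) :
    Subgroup (GL (Fin 8) F) where
  carrier := {g | ∀ v, Q ((g : Matrix (Fin 8) (Fin 8) F).mulVec v) = Q v}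
  one_mem' := by
    intro v
    simp
  mul_mem' := by
    intro a b ha hb v
    have h : ((a * b : GL (Fin 8) F) : Matrix (Fin 8) (Fin 8) F).mulVec v
        = (a : Matrix (Fin 8) (Fin 8) F).mulVec
            ((b : Matrix (Fin 8) (Fin 8) F).mulVec v) := by
      simp [Matrix.mulVec_mulVec]
    rw [h, ha, hb]
  inv_mem' := by
    intro a ha v
    have h1 : (a : Matrix (Fin 8) (Fin 8) F).mulVec
        (((a⁻¹ : GL (Fin 8) F) : Matrix (Fin 8) (Fin 8) F).mulVec v) = v := by
      rw [Matrix.mulVec_mulVec, ← Units.val_mul, mul_inv_cancel]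
      simp
    calc Q (((a⁻¹ : GL (Fin 8) F) : Matrix (Fin 8) (Fin 8) F).mulVec v)
        = Q ((a : Matrix (Fin 8) (Fin 8) F).mulVec
            (((a⁻¹ : GL (Fin 8) F) : Matrix (Fin 8) (Fin 8) F).mulVec v)) := (ha _).symm
      _ = Q v := by rw [h1]


namespace OmegaEight

section

variable {F : Type*} [Field F]

/-- The polar form of `QPlus`. -/
def bil (u v : Fin 8 → F) : F :=
  u 0 * v 4 + u 4 * v 0 + u 1 * v 5 + u 5 * v 1 + u 2 * v 6 + u 6 * v 2 + u 3 * v 7 + u 7 * v 3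

theorem bil_comm (u v : Fin 8 → F) : bil u v = bil v u := by simp only [bil]; ring

@[simp] theorem bil_add_left (u u' v : Fin 8 → F) : bil (u + u') v = bil u v + bil u' v := by
  simp only [bil, Pi.add_apply]; ring

@[simp] theorem bil_add_right (u v v' : Fin 8 → F) : bil u (v + v') = bil u v + bil u v' := by
  simp only [bil, Pi.add_apply]; ring

@[simp] theorem bil_smul_left (a : F) (u v : Fin 8 → F) : bil (a • u) v = a * bil u v := by
  simp only [bil, Pi.smul_apply, smul_eq_mul]; ring

@[simp] theorem bil_smul_right (a : F) (u v : Fin 8 → F) : bil u (a • v) = a * bil u v := by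
  simp only [bil, Pi.smul_apply, smul_eq_mul]; ring

@[simp] theorem bil_neg_left (u v : Fin 8 → F) : bil (-u) v = -bil u v := by
  simp only [bil, Pi.neg_apply]; ring

@[simp] theorem bil_neg_right (u v : Fin 8 → F) : bil u (-v) = -bil u v := by
  simp only [bil, Pi.neg_apply]; ring

@[simp] theorem bil_sub_left (u u' v : Fin 8 → F) : bil (u - u') v = bil u v - bil u' v := by
  simp only [bil, Pi.sub_apply]; ring

@[simp] theorem bil_sub_right (u v v' : Fin 8 → F) : bil u (v - v') = bil u v - bil u v' := by
  simp only [bil, Pi.sub_apply]; ring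

@[simp] theorem bil_zero_left (v : Fin 8 → F) : bil 0 v = 0 := by simp [bil]

@[simp] theorem bil_zero_right (v : Fin 8 → F) : bil v 0 = 0 := by simp [bil]

theorem bil_self (u : Fin 8 → F) : bil u u = 2 * QPlus F u := by simp only [bil, QPlus]; ring

theorem QPlus_add (u v : Fin 8 → F) : QPlus F (u + v) = QPlus F u + QPlus F v + bil u v := by
  simp only [bil, QPlus, Pi.add_apply]; ring

theorem QPlus_sub (u v : Fin 8 → F) : QPlus F (u - v) = QPlus F u + QPlus F v - bil u v := by
  simp only [bil, QPlus, Pi.sub_apply]; ring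

theorem QPlus_smul (a : F) (u : Fin 8 → F) : QPlus F (a • u) = a ^ 2 * QPlus F u := by
  simp only [QPlus, Pi.smul_apply, smul_eq_mul]; ring

@[simp] theorem QPlus_neg (u : Fin 8 → F) : QPlus F (-u) = QPlus F u := by
  simp only [QPlus, Pi.neg_apply]; ring

@[simp] theorem QPlus_zero : QPlus F 0 = 0 := by simp [QPlus]

/-- The standard basis vectors; `ev i` and `ev (i + 4)` form a hyperbolic pair. -/
def ev (i : Fin 8) : Fin 8 → F := Pi.single i 1

theorem ev_apply (i j : Fin 8) : (ev i : Fin 8 → F) j = if j = i then 1 else 0 := by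
  simp [ev, Pi.single_apply]

theorem bil_ev_left (i : Fin 8) (v : Fin 8 → F) : bil (ev i) v = v (i + 4) := by
  fin_cases i <;> simp [bil, ev_apply]

theorem bil_ev_right (i : Fin 8) (v : Fin 8 → F) : bil v (ev i) = v (i + 4) := by
  rw [bil_comm, bil_ev_left]

@[simp] theorem QPlus_ev (i : Fin 8) : QPlus F (ev i) = 0 := by
  fin_cases i <;> simp [QPlus, ev_apply]

theorem bil_nondegenerate {u : Fin 8 → F} (h : ∀ v, bil u v = 0) : u = 0 := by
  funext i
  have := h (ev (i + 4))
  rw [bil_ev_right] at this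
  have h8 : i + 4 + 4 = i := by fin_cases i <;> rfl
  rwa [h8] at this

theorem eq_sum_ev (v : Fin 8 → F) : v = ∑ i, v i • ev i := by
  funext j
  simp [ev_apply, Finset.sum_apply]

/-- Isometries as linear endomorphisms. -/
def IsIso (f : Module.End F (Fin 8 → F)) : Prop := ∀ v, QPlus F (f v) = QPlus F v

theorem IsIso.bil {f : Module.End F (Fin 8 → F)} (hf : IsIso f) (u v : Fin 8 → F) :
    bil (f u) (f v) = bil u v := by
  have h := hf (u + v)
  rw [map_add, QPlus_add, QPlus_add, hf, hf] at h
  exact add_left_cancel h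

theorem IsIso.injective {f : Module.End F (Fin 8 → F)} (hf : IsIso f) :
    Function.Injective f := by
  rw [← LinearMap.ker_eq_bot, LinearMap.ker_eq_bot']
  intro u hu
  apply bil_nondegenerate
  intro v
  rw [← hf.bil, hu, bil_zero_left]

/-- The Siegel transformation attached to a singular vector `u` and `v ⟂ u`. -/
def siegel (u v : Fin 8 → F) : Module.End F (Fin 8 → F) where
  toFun x := x + bil x v • u - bil x u • v - (QPlus F v * bil x u) • u
  map_add' x y := by
    simp only [bil_add_left]; module
  map_smul' a x := by
    simp only [bil_smul_left, RingHom.id_apply]; module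

theorem siegel_apply (u v x : Fin 8 → F) :
    siegel u v x = x + bil x v • u - bil x u • v - (QPlus F v * bil x u) • u := rfl

theorem siegel_isIso {u v : Fin 8 → F} (hu : QPlus F u = 0) (huv : bil u v = 0) :
    IsIso (siegel u v) := by
  intro x
  have e : siegel u v x = x + ((bil x v - QPlus F v * bil x u) • u + (-bil x u) • v) := by
    rw [siegel_apply]; module
  rw [e, QPlus_add, QPlus_add, QPlus_smul, QPlus_smul]
  simp only [bil_add_right, bil_smul_right, bil_smul_left, hu, huv]
  ring

theorem siegel_mul {u v v' : Fin 8 → F} (hu : QPlus F u = 0) (huv : bil u v = 0)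
    (huv' : bil u v' = 0) : siegel u v * siegel u v' = siegel u (v + v') := by
  have h1 : bil v' u = 0 := by rw [bil_comm, huv']
  have h2 : bil u u = 0 := by rw [bil_self, hu, mul_zero]
  refine LinearMap.ext fun x => ?_
  simp only [Module.End.mul_apply, siegel_apply, bil_add_left, bil_sub_left, bil_smul_left,
    bil_add_right, QPlus_add, h1, h2, huv, bil_comm v' v]
  module

theorem siegel_zero (u : Fin 8 → F) : siegel u 0 = 1 := by
  refine LinearMap.ext fun x => ?_
  simp [siegel_apply]

theorem siegel_zero_left (v : Fin 8 → F) : siegel 0 v = 1 := by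
  refine LinearMap.ext fun x => ?_
  simp [siegel_apply]

theorem siegel_add_smul_self {u : Fin 8 → F} (hu : QPlus F u = 0) (v : Fin 8 → F)
    (huv : bil u v = 0) (a : F) : siegel u (v + a • u) = siegel u v := by
  have h2 : bil v u = 0 := by rw [bil_comm, huv]
  refine LinearMap.ext fun x => ?_
  simp only [siegel_apply, bil_add_right, bil_smul_right, QPlus_add, QPlus_smul, hu, h2]
  module

theorem siegel_smul (a : F) (u v : Fin 8 → F) : siegel (a • u) v = siegel u (a • v) := by
  refine LinearMap.ext fun x => ?_
  simp only [siegel_apply, bil_smul_right, QPlus_smul]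
  module

theorem siegel_swap {u v : Fin 8 → F} (hu : QPlus F u = 0) (hv : QPlus F v = 0) :
    siegel u v = siegel v (-u) := by
  refine LinearMap.ext fun x => ?_
  simp only [siegel_apply, bil_neg_right, QPlus_neg, hu, hv]
  module

theorem siegel_conj {f : Module.End F (Fin 8 → F)} (hf : IsIso f) (u v : Fin 8 → F) :
    f * siegel u v = siegel (f u) (f v) * f := by
  refine LinearMap.ext fun x => ?_
  simp only [Module.End.mul_apply, siegel_apply, map_add, map_sub, map_smul, hf.bil, hf v]

theorem siegel_apply_of_orthogonal {u v x : Fin 8 → F} (hu : bil x u = 0) (hv : bil x v = 0) :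
    siegel u v x = x := by
  simp [siegel_apply, hu, hv]

/-- `f` is the action of some element of `H`. -/
def Realizes (H : Subgroup (GL (Fin 8) F)) (f : Module.End F (Fin 8 → F)) : Prop :=
  ∃ g ∈ H, ∀ x, (g : Matrix (Fin 8) (Fin 8) F).mulVec x = f x

section Realizes

variable {H : Subgroup (GL (Fin 8) F)} {f g : Module.End F (Fin 8 → F)}

theorem GL_mul_mulVec (a b : GL (Fin 8) F) (x : Fin 8 → F) :
    ((a * b : GL (Fin 8) F) : Matrix (Fin 8) (Fin 8) F).mulVec x
      = (a : Matrix (Fin 8) (Fin 8) F).mulVec ((b : Matrix (Fin 8) (Fin 8) F).mulVec x) := by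
  simp [Matrix.mulVec_mulVec]

theorem GL_inv_mulVec (a : GL (Fin 8) F) (x : Fin 8 → F) :
    ((a⁻¹ : GL (Fin 8) F) : Matrix (Fin 8) (Fin 8) F).mulVec
      ((a : Matrix (Fin 8) (Fin 8) F).mulVec x) = x := by
  rw [← GL_mul_mulVec]; simp

theorem GL_mulVec_inv (a : GL (Fin 8) F) (x : Fin 8 → F) :
    (a : Matrix (Fin 8) (Fin 8) F).mulVec
      (((a⁻¹ : GL (Fin 8) F) : Matrix (Fin 8) (Fin 8) F).mulVec x) = x := by
  rw [← GL_mul_mulVec]; simp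

theorem GL_ext {a b : GL (Fin 8) F} (h : ∀ x, (a : Matrix (Fin 8) (Fin 8) F).mulVec x
    = (b : Matrix (Fin 8) (Fin 8) F).mulVec x) : a = b := by
  apply Units.ext
  exact Matrix.mulVec_injective (funext h)

theorem Realizes.one : Realizes H 1 := ⟨1, H.one_mem, fun x => by simp⟩

theorem Realizes.mul (hf : Realizes H f) (hg : Realizes H g) : Realizes H (f * g) := by
  obtain ⟨a, ha, ha'⟩ := hf
  obtain ⟨b, hb, hb'⟩ := hg
  exact ⟨a * b, H.mul_mem ha hb, fun x => by rw [GL_mul_mulVec, hb', ha', Module.End.mul_apply]⟩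

theorem Realizes.of_mul_left (hf : Realizes H f) (hfg : Realizes H (f * g)) : Realizes H g := by
  obtain ⟨a, ha, ha'⟩ := hf
  obtain ⟨b, hb, hb'⟩ := hfg
  refine ⟨a⁻¹ * b, H.mul_mem (H.inv_mem ha) hb, fun x => ?_⟩
  rw [GL_mul_mulVec, hb', Module.End.mul_apply, ← ha', GL_inv_mulVec]

theorem Realizes.of_mul_right (hg : Realizes H g) (hfg : Realizes H (f * g)) : Realizes H f := by
  obtain ⟨a, ha, ha'⟩ := hg
  obtain ⟨b, hb, hb'⟩ := hfg
  refine ⟨b * a⁻¹, H.mul_mem hb (H.inv_mem ha), fun x => ?_⟩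
  rw [GL_mul_mulVec, hb', Module.End.mul_apply, ← ha', GL_mulVec_inv]

theorem Realizes.pow (hf : Realizes H f) (n : ℕ) : Realizes H (f ^ n) := by
  induction n with
  | zero => simpa using Realizes.one
  | succ k ih => rw [pow_succ]; exact ih.mul hf

/-- Conjugating a Siegel transformation inside `H`. -/
theorem Realizes.siegel_conj (hf : Realizes H f) (hi : IsIso f) {u v : Fin 8 → F}
    (h : Realizes H (siegel u v)) : Realizes H (siegel (f u) (f v)) := by
  apply hf.of_mul_right
  rw [← OmegaEight.siegel_conj hi]
  exact hf.mul h

end Realizes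

/-- The linear action of an invertible matrix. -/
def act (g : GL (Fin 8) F) : Module.End F (Fin 8 → F) :=
  Matrix.toLin' (g : Matrix (Fin 8) (Fin 8) F)

theorem act_apply (g : GL (Fin 8) F) (x : Fin 8 → F) :
    act g x = (g : Matrix (Fin 8) (Fin 8) F).mulVec x := Matrix.toLin'_apply _ _

theorem act_mul (g h : GL (Fin 8) F) : act (g * h) = act g * act h := by
  refine LinearMap.ext fun x => ?_
  rw [Module.End.mul_apply, act_apply, act_apply, act_apply, GL_mul_mulVec]

theorem act_one : act (1 : GL (Fin 8) F) = 1 := by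
  refine LinearMap.ext fun x => ?_
  simp [act_apply]

theorem act_inv_mul (g : GL (Fin 8) F) : act g⁻¹ * act g = 1 := by
  rw [← act_mul, inv_mul_cancel, act_one]

theorem act_injective : Function.Injective (act : GL (Fin 8) F → _) := by
  intro a b h
  apply GL_ext
  intro x
  rw [← act_apply, ← act_apply, h]

theorem realizes_act {H : Subgroup (GL (Fin 8) F)} {g : GL (Fin 8) F} (hg : g ∈ H) :
    Realizes H (act g) := ⟨g, hg, fun x => (act_apply g x).symm⟩

theorem Realizes.exists {H : Subgroup (GL (Fin 8) F)} {f : Module.End F (Fin 8 → F)}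
    (h : Realizes H f) : ∃ g ∈ H, act g = f := by
  obtain ⟨g, hg, h'⟩ := h
  refine ⟨g, hg, ?_⟩
  refine LinearMap.ext fun x => ?_
  rw [act_apply, h']

theorem Realizes.mem {H : Subgroup (GL (Fin 8) F)} {g : GL (Fin 8) F}
    (h : Realizes H (act g)) : g ∈ H := by
  obtain ⟨a, ha, h'⟩ := h.exists
  rwa [← act_injective h']

theorem mem_orthogonal_iff {g : GL (Fin 8) F} :
    g ∈ orthogonalGroupOf F (QPlus F) ↔ IsIso (act g) := by
  simp only [IsIso, act_apply]
  rfl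

theorem realizes_of_isIso {f : Module.End F (Fin 8 → F)} (hf : IsIso f) :
    Realizes (orthogonalGroupOf F (QPlus F)) f := by
  let e : (Fin 8 → F) ≃ₗ[F] (Fin 8 → F) := LinearEquiv.ofInjectiveEndo f hf.injective
  have hef : ∀ x, e x = f x := fun x => rfl
  let g : GL (Fin 8) F :=
    ⟨LinearMap.toMatrix' e.toLinearMap, LinearMap.toMatrix' e.symm.toLinearMap,
      by rw [← LinearMap.toMatrix'_comp]; simp,
      by rw [← LinearMap.toMatrix'_comp]; simp⟩
  have hg : ∀ x, (g : Matrix (Fin 8) (Fin 8) F).mulVec x = f x := by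
    intro x
    rw [← hef]
    exact LinearMap.toMatrix'_mulVec _ _
  refine ⟨g, ?_, hg⟩
  intro v
  rw [hg, hf]

/-- `H` contains all long root elements attached to the standard basis. -/
def HasRoots (H : Subgroup (GL (Fin 8) F)) : Prop :=
  ∀ i j : Fin 8, j ≠ i → j ≠ i + 4 → ∀ t : F, Realizes H (siegel (ev i) (t • ev j))

theorem siegel_sum {ι : Type*} (s : Finset ι) {u : Fin 8 → F} (hu : QPlus F u = 0)
    (w : ι → Fin 8 → F) (hw : ∀ i ∈ s, bil u (w i) = 0) {H : Subgroup (GL (Fin 8) F)}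
    (h : ∀ i ∈ s, Realizes H (siegel u (w i))) : Realizes H (siegel u (∑ i ∈ s, w i)) := by
  classical
  suffices Realizes H (siegel u (∑ i ∈ s, w i)) ∧ bil u (∑ i ∈ s, w i) = 0 from this.1
  induction s using Finset.induction_on with
  | empty => simpa [siegel_zero] using Realizes.one
  | insert a s ha ih =>
    obtain ⟨h1, h2⟩ := ih (fun i hi => hw i (Finset.mem_insert_of_mem hi))
      (fun i hi => h i (Finset.mem_insert_of_mem hi))
    have h3 := hw a (Finset.mem_insert_self a s)
    rw [Finset.sum_insert ha]
    refine ⟨?_, by rw [bil_add_right, h2, h3, add_zero]⟩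
    rw [← siegel_mul hu h3 h2]
    exact (h a (Finset.mem_insert_self a s)).mul h1

theorem add_four_val_mod (i : Fin 8) : (i + 4).val % 4 = i.val % 4 := by fin_cases i <;> rfl

theorem add_four_add_four (i : Fin 8) : i + 4 + 4 = i := by fin_cases i <;> rfl

theorem HasRoots.siegel_ev {H : Subgroup (GL (Fin 8) F)} (hH : HasRoots H) (i : Fin 8)
    {v : Fin 8 → F} (hv : bil (ev i) v = 0) : Realizes H (siegel (ev i) v) := by
  rw [bil_ev_left] at hv
  have hz : ∀ j : Fin 8, bil (ev i) (v j • (ev j : Fin 8 → F)) = 0 := by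
    intro j
    rw [bil_smul_right, bil_ev_left, ev_apply]
    split_ifs with h
    · rw [← h, hv, zero_mul]
    · rw [mul_zero]
  rw [eq_sum_ev v]
  refine siegel_sum _ (QPlus_ev i) _ (fun j _ => hz j) (fun j _ => ?_)
  by_cases h1 : j = i
  · subst h1
    have := siegel_add_smul_self (F := F) (QPlus_ev j) 0 (bil_zero_right _) (v j)
    rw [zero_add, siegel_zero] at this
    rw [this]
    exact Realizes.one
  · by_cases h2 : j = i + 4
    · subst h2
      rw [hv, zero_smul, siegel_zero]
      exact Realizes.one
    · exact hH i j h1 h2 _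

/-- Vectors supported on the coordinates outside the first `r + 1` hyperbolic pairs. -/
def tailSpace (F : Type*) [Field F] (r : ℕ) : Submodule F (Fin 8 → F) where
  carrier := {v | ∀ i : Fin 8, i.val % 4 ≤ r → v i = 0}
  add_mem' {a b} ha hb i hi := by simp [ha i hi, hb i hi]
  zero_mem' i hi := rfl
  smul_mem' c a ha i hi := by simp [ha i hi]

/-- The pointwise stabilizer of the first `r` hyperbolic pairs. -/
def fixer (F : Type*) [Field F] (r : ℕ) : Subgroup (GL (Fin 8) F) where
  carrier := {g | ∀ i : Fin 8, i.val % 4 < r → act g (ev i) = ev i}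
  one_mem' i hi := by simp [act_one]
  mul_mem' {a b} ha hb i hi := by
    rw [act_mul, Module.End.mul_apply, hb i hi, ha i hi]
  inv_mem' {a} ha i hi := by
    have h := LinearMap.congr_fun (act_inv_mul a) (ev i)
    rwa [Module.End.mul_apply, ha i hi] at h

/-- Some element realized in `H` maps `u` to `v`. -/
def Moves (H : Subgroup (GL (Fin 8) F)) (u v : Fin 8 → F) : Prop :=
  ∃ g ∈ H, act g u = v

theorem Moves.trans {H : Subgroup (GL (Fin 8) F)} {u v w : Fin 8 → F} (h : Moves H u v)
    (h' : Moves H v w) : Moves H u w := by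
  obtain ⟨a, ha, rfl⟩ := h
  obtain ⟨b, hb, rfl⟩ := h'
  exact ⟨b * a, H.mul_mem hb ha, by rw [act_mul]; rfl⟩

theorem Moves.symm {H : Subgroup (GL (Fin 8) F)} {u v : Fin 8 → F} (h : Moves H u v) :
    Moves H v u := by
  obtain ⟨a, ha, rfl⟩ := h
  exact ⟨a⁻¹, H.inv_mem ha, by rw [← Module.End.mul_apply, act_inv_mul]; rfl⟩

theorem Realizes.moves {H : Subgroup (GL (Fin 8) F)} {f : Module.End F (Fin 8 → F)}
    (h : Realizes H f) {u v : Fin 8 → F} (huv : f u = v) : Moves H u v := by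
  obtain ⟨g, hg, rfl⟩ := h.exists
  exact ⟨g, hg, huv⟩

section Orbits

variable {H : Subgroup (GL (Fin 8) F)} {W : Submodule F (Fin 8 → F)} {ε φ : Fin 8 → F}

theorem siegel_clear (hε : QPlus F ε = 0) (hεφ : bil ε φ = 1)
    {w : Fin 8 → F} (hw : bil ε w = 0) (hw' : bil φ w = 0) {a b : F} (hb : b ≠ 0)
    (hQ : a * b + QPlus F w = 0) :
    siegel ε (b⁻¹ • w) (a • ε + b • φ + w) = b • φ := by
  have e1 : bil w ε = 0 := by rw [bil_comm, hw]
  have e2 : bil φ ε = 1 := by rw [bil_comm, hεφ]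
  have e3 : bil ε ε = 0 := by rw [bil_self, hε, mul_zero]
  have ha : a = -(b⁻¹ * QPlus F w) := by
    field_simp
    linear_combination hQ
  simp only [siegel_apply, bil_add_left, bil_smul_left, bil_smul_right, hw, hw', e1, e2, e3,
    QPlus_smul, bil_self w, ha, mul_zero, add_zero, zero_add, mul_one, smul_smul]
  have : b * b⁻¹ = 1 := mul_inv_cancel₀ hb
  match_scalars
  · have : b * b⁻¹ = 1 := mul_inv_cancel₀ hb
    linear_combination (-(b⁻¹) * QPlus F w) * this
  · ring
  · linear_combination -this

theorem moves_of_coeff_ne_zero (hε : QPlus F ε = 0) (hφ : QPlus F φ = 0) (hεφ : bil ε φ = 1)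
    (hWε : ∀ w ∈ W, bil ε w = 0) (hWφ : ∀ w ∈ W, bil φ w = 0)
    (hHε : ∀ w ∈ W, Realizes H (siegel ε w)) (hHφ : ∀ w ∈ W, Realizes H (siegel φ w))
    {η θ : Fin 8 → F} (hη : η ∈ W) (hθ : θ ∈ W) (hQη : QPlus F η = 0) (hQθ : QPlus F θ = 0)
    (hηθ : bil η θ = 1) {w : Fin 8 → F} (hw : w ∈ W) {a b : F} (hab : a ≠ 0 ∨ b ≠ 0)
    (hQ : a * b + QPlus F w = 0) : Moves H (a • ε + b • φ + w) ε := by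
  have hφε : bil φ ε = 1 := by rw [bil_comm, hεφ]
  have key : ∀ {w : Fin 8 → F} (_ : w ∈ W) {a b : F} (_ : a * b + QPlus F w = 0) (_ : b ≠ 0),
      Moves H (a • ε + b • φ + w) (b • φ) := fun {w} hw {a b} hQ hb =>
    (hHε _ (W.smul_mem _ hw)).moves (siegel_clear hε hεφ (hWε w hw) (hWφ w hw) hb hQ)
  have key' : ∀ {w : Fin 8 → F} (_ : w ∈ W) {a b : F} (_ : a * b + QPlus F w = 0) (_ : a ≠ 0),
      Moves H (a • ε + b • φ + w) (a • ε) := fun {w} hw {a b} hQ ha => by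
    rw [add_comm (a • ε)]
    refine (hHφ _ (W.smul_mem _ hw)).moves (siegel_clear hφ hφε (hWφ w hw) (hWε w hw) ha ?_)
    rw [mul_comm, hQ]
  have hw1 : ∀ c : F, η - c • θ ∈ W := fun c => W.sub_mem hη (W.smul_mem _ hθ)
  have hw2 : ∀ c : F, QPlus F (η - c • θ) = -c := fun c => by
    rw [QPlus_sub, QPlus_smul, hQη, hQθ, bil_smul_right, hηθ]; ring
  have hb' : ∀ b : F, b ≠ 0 → Moves H (b • φ) ε := by
    intro b hb
    have h1 := key (hw1 b) (a := 1) (b := b) (by rw [hw2]; ring) hb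
    have h2 := key' (hw1 b) (a := 1) (b := b) (by rw [hw2]; ring) one_ne_zero
    rw [one_smul] at h2
    rw [one_smul] at h1
    exact h1.symm.trans h2
  rcases hab with ha | hb
  · have h1 := key (hw1 a) (a := a) (b := 1) (by rw [hw2]; ring) one_ne_zero
    have h2 := key' (hw1 a) (a := a) (b := 1) (by rw [hw2]; ring) ha
    exact (key' hw hQ ha).trans (h2.symm.trans (h1.trans (hb' 1 one_ne_zero)))
  · exact (key hw hQ hb).trans (hb' b hb)

theorem moves_of_singular (hε : QPlus F ε = 0) (hφ : QPlus F φ = 0) (hεφ : bil ε φ = 1)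
    (hWε : ∀ w ∈ W, bil ε w = 0) (hWφ : ∀ w ∈ W, bil φ w = 0)
    (hHε : ∀ w ∈ W, Realizes H (siegel ε w)) (hHφ : ∀ w ∈ W, Realizes H (siegel φ w))
    (hWn : ∀ w ∈ W, w ≠ 0 → ∃ w' ∈ W, bil w w' ≠ 0)
    {η θ : Fin 8 → F} (hη : η ∈ W) (hθ : θ ∈ W) (hQη : QPlus F η = 0) (hQθ : QPlus F θ = 0)
    (hηθ : bil η θ = 1) {w : Fin 8 → F} (hw : w ∈ W) {a b : F}
    (hQ : a * b + QPlus F w = 0) (hne : a • ε + b • φ + w ≠ 0) :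
    Moves H (a • ε + b • φ + w) ε := by
  by_cases hab : a ≠ 0 ∨ b ≠ 0
  · exact moves_of_coeff_ne_zero hε hφ hεφ hWε hWφ hHε hHφ hη hθ hQη hQθ hηθ hw hab hQ
  · push Not at hab
    obtain ⟨rfl, rfl⟩ := hab
    rw [zero_smul, zero_smul, zero_add, zero_add] at hne ⊢
    obtain ⟨w', hw', hb⟩ := hWn w hw hne
    have h1 : siegel ε w' w = bil w w' • ε + (0 : F) • φ + w := by
      rw [siegel_apply, bil_comm w ε, hWε w hw]; module
    refine ((hHε w' hw').moves h1).trans ?_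
    exact moves_of_coeff_ne_zero hε hφ hεφ hWε hWφ hHε hHφ hη hθ hQη hQθ hηθ hw (Or.inl hb)
      (by linear_combination hQ)

end Orbits

theorem bil_eq_zero_of_mem_tailSpace {r : ℕ} {v : Fin 8 → F} (hv : v ∈ tailSpace F r) {i : Fin 8}
    (hi : i.val % 4 ≤ r) : bil (ev i) v = 0 := by
  rw [bil_ev_left]
  apply hv
  revert hi
  fin_cases i <;> simp

theorem ev_mem_tailSpace {r : ℕ} {i : Fin 8} (hi : r < i.val % 4) : ev i ∈ tailSpace F r := by
  intro j hj
  rw [ev_apply, if_neg]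
  rintro rfl
  omega

theorem tailSpace_nondegenerate {r : ℕ} {w : Fin 8 → F} (hw : w ∈ tailSpace F r) (hne : w ≠ 0) :
    ∃ w' ∈ tailSpace F r, bil w w' ≠ 0 := by
  obtain ⟨i, hi⟩ := Function.ne_iff.mp hne
  refine ⟨ev (i + 4), ev_mem_tailSpace ?_, ?_⟩
  · by_contra h
    apply hi
    apply hw
    rw [add_four_val_mod] at h
    omega
  · rwa [bil_ev_right, add_four_add_four]

theorem realizes_inf_fixer {H : Subgroup (GL (Fin 8) F)} {f : Module.End F (Fin 8 → F)} {r : ℕ}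
    (hf : Realizes H f) (h : ∀ i : Fin 8, i.val % 4 < r → f (ev i) = ev i) :
    Realizes (H ⊓ fixer F r) f := by
  obtain ⟨g, hg, rfl⟩ := hf.exists
  exact realizes_act ⟨hg, h⟩

theorem HasRoots.siegel_tail {H : Subgroup (GL (Fin 8) F)} (hH : HasRoots H) {r : ℕ} {i : Fin 8}
    (hi : i.val % 4 = r) {w : Fin 8 → F} (hw : w ∈ tailSpace F r) :
    Realizes (H ⊓ fixer F r) (siegel (ev i) w) := by
  apply realizes_inf_fixer (hH.siegel_ev i (bil_eq_zero_of_mem_tailSpace hw hi.le))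
  intro j hj
  apply siegel_apply_of_orthogonal
  · rw [bil_ev_left, ev_apply, if_neg]
    rintro rfl
    revert hj hi
    fin_cases j <;> simp <;> omega
  · exact bil_eq_zero_of_mem_tailSpace hw hj.le

theorem exists_tail_decomposition {r : ℕ} (i : Fin 8) (hi : i.val = r) (hr : r < 4)
    {u : Fin 8 → F} (hu : ∀ j : Fin 8, j.val % 4 < r → u j = 0) :
    ∃ w ∈ tailSpace F r, u = u i • ev i + u (i + 4) • ev (i + 4) + w := by
  refine ⟨u - (u i • ev i + u (i + 4) • ev (i + 4)), ?_, by abel⟩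
  intro j hj
  rcases lt_or_eq_of_le hj with hj | hj
  · have h1 : j ≠ i := by rintro rfl; omega
    have h2 : j ≠ i + 4 := by
      rintro rfl
      revert hj hi
      fin_cases i <;> simp <;> omega
    simp [ev_apply, h1, h2, hu j hj]
  · have : j = i ∨ j = i + 4 := by
      subst hi
      revert hj hr
      fin_cases i <;> fin_cases j <;> simp
    have h4 : i ≠ i + 4 := by fin_cases i <;> simp
    rcases this with rfl | rfl
    · simp [ev_apply, h4]
    · simp [ev_apply, h4.symm]

theorem bil_ev_ev_add_four (i : Fin 8) : bil (ev i : Fin 8 → F) (ev (i + 4)) = 1 := by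
  rw [bil_ev_left, ev_apply, if_pos rfl]

theorem QPlus_tail_decomposition {r : ℕ} {i : Fin 8} (hi : i.val = r) (hr : r < 4)
    {w : Fin 8 → F} (hw : w ∈ tailSpace F r) (a b : F) :
    QPlus F (a • ev i + b • ev (i + 4) + w) = a * b + QPlus F w := by
  have h1 := bil_eq_zero_of_mem_tailSpace hw (i := i) (by omega)
  have h2 := bil_eq_zero_of_mem_tailSpace hw (i := i + 4) (by
    subst hi; revert hr; fin_cases i <;> simp)
  simp [QPlus_add, QPlus_smul, h1, h2, bil_ev_ev_add_four, mul_comm]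

theorem HasRoots.moves_tail {H : Subgroup (GL (Fin 8) F)} (hH : HasRoots H) {r : ℕ} (hr : r < 3)
    (i : Fin 8) (hi : i.val = r) {u : Fin 8 → F} (hu : ∀ j : Fin 8, j.val % 4 < r → u j = 0)
    (hQ : QPlus F u = 0) (hne : u ≠ 0) : Moves (H ⊓ fixer F r) u (ev i) := by
  obtain ⟨w, hw, hd⟩ := exists_tail_decomposition i hi (by omega) hu
  have hi4 : (i + 4).val % 4 = r := by subst hi; revert hr; fin_cases i <;> simp
  have h : Moves (H ⊓ fixer F r) (u i • ev i + u (i + 4) • ev (i + 4) + w) (ev i) := by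
    refine moves_of_singular (W := tailSpace F r) (QPlus_ev i) (QPlus_ev _)
      (bil_ev_ev_add_four i)
      (fun w hw => bil_eq_zero_of_mem_tailSpace hw (by omega))
      (fun w hw => bil_eq_zero_of_mem_tailSpace hw (by omega))
      (fun w hw => hH.siegel_tail (by omega) hw) (fun w hw => hH.siegel_tail hi4 hw)
      (fun w hw h => tailSpace_nondegenerate hw h)
      (η := ev 3) (θ := ev 7) (ev_mem_tailSpace (by simpa using hr))
      (ev_mem_tailSpace (by simpa using hr)) (QPlus_ev _) (QPlus_ev _) (bil_ev_ev_add_four 3) hw ?_ ?_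
    · rw [← QPlus_tail_decomposition hi (by omega) hw, ← hd, hQ]
    · rwa [← hd]
  rwa [← hd] at h

theorem HasRoots.fix_pair {H : Subgroup (GL (Fin 8) F)} (hH : HasRoots H)
    (hO : H ≤ orthogonalGroupOf F (QPlus F)) {r : ℕ} (hr : r < 3) {g : GL (Fin 8) F}
    (hg : g ∈ orthogonalGroupOf F (QPlus F)) (hgf : g ∈ fixer F r) :
    ∃ h ∈ H, h * g ∈ fixer F (r + 1) := by
  have hg := mem_orthogonal_iff.mp hg
  obtain ⟨i, hi⟩ : ∃ i : Fin 8, i.val = r := ⟨⟨r, by omega⟩, rfl⟩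
  have hi4 : (i + 4).val % 4 = r := by subst hi; revert hr; fin_cases i <;> simp
  have h0 : ∀ f : Module.End F (Fin 8 → F), IsIso f →
      (∀ j : Fin 8, j.val % 4 < r → f (ev j) = ev j) →
      ∀ k : Fin 8, k.val % 4 = r → ∀ j : Fin 8, j.val % 4 < r → f (ev k) j = 0 := by
    intro f hf hfix k hk j hj
    have hj4 : (j + 4).val % 4 < r := by revert hj; fin_cases j <;> simp
    have h := hf.bil (ev (j + 4)) (ev k)
    rw [hfix _ hj4, bil_ev_left, bil_ev_left, add_four_add_four, ev_apply, if_neg] at h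
    · exact h
    · rintro rfl; omega
  have hev : ∀ k : Fin 8, (ev k : Fin 8 → F) ≠ 0 := fun k h => by
    have := congrFun h k
    simp [ev_apply] at this
  obtain ⟨a, ha, hav⟩ := hH.moves_tail hr i hi (h0 _ hg hgf i (by omega))
    (by rw [hg, QPlus_ev]) (fun h => hev i (hg.injective (by rw [h, map_zero])))
  have haI : IsIso (act a) := mem_orthogonal_iff.mp (hO ha.1)
  have hag : IsIso (act (a * g)) := by
    intro v
    rw [act_mul, Module.End.mul_apply, haI, hg]
  have hagf : a * g ∈ fixer F r := (fixer F r).mul_mem ha.2 hgf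
  have hagi : act (a * g) (ev i) = ev i := by rw [act_mul, Module.End.mul_apply, hav]
  obtain ⟨w, hw, hd⟩ := exists_tail_decomposition i hi (by omega)
    (h0 _ hag hagf (i + 4) hi4)
  set u := act (a * g) (ev (i + 4)) with hu
  have hu1 : u (i + 4) = 1 := by
    have h := hag.bil (ev i) (ev (i + 4))
    rwa [hagi, ← hu, bil_ev_ev_add_four, bil_ev_left] at h
  have hQ := hag (ev (i + 4))
  rw [← hu, hd, QPlus_tail_decomposition hi (by omega) hw, QPlus_ev, hu1] at hQ
  have hS := hH.siegel_tail (by omega : i.val % 4 = r) hw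
  obtain ⟨b, hb, hbS⟩ := hS.exists
  have hbi : act b (ev i) = ev i := by
    rw [hbS]
    apply siegel_apply_of_orthogonal
    · rw [bil_self, QPlus_ev, mul_zero]
    · exact bil_eq_zero_of_mem_tailSpace hw (by omega)
  have hbu : act b u = ev (i + 4) := by
    have := siegel_clear (QPlus_ev i) (bil_ev_ev_add_four i)
      (bil_eq_zero_of_mem_tailSpace hw (by omega))
      (bil_eq_zero_of_mem_tailSpace hw (by omega)) one_ne_zero hQ
    rw [hbS, hd, hu1]
    simpa using this
  refine ⟨b * a, H.mul_mem hb.1 ha.1, fun j hj => ?_⟩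
  rw [mul_assoc, act_mul, Module.End.mul_apply]
  rcases Nat.lt_succ_iff_lt_or_eq.mp hj with hj | hj
  · rw [hagf j hj, hb.2 j hj]
  · have : j = i ∨ j = i + 4 := by
      subst hi
      revert hj hr
      fin_cases i <;> fin_cases j <;> simp
    rcases this with rfl | rfl
    · rw [hagi, hbi]
    · rw [← hu, hbu]

end

section

open scoped commutatorElement

variable {F : Type*} [Field F]

theorem IsIso.mul {f g : Module.End F (Fin 8 → F)} (hf : IsIso f) (hg : IsIso g) :
    IsIso (f * g) := fun v => by rw [Module.End.mul_apply, hf, hg]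

/-- The subgroup generated by all Siegel transformations. -/
def siegelGroup (F : Type*) [Field F] : Subgroup (GL (Fin 8) F) :=
  Subgroup.closure {g | ∃ u v, QPlus F u = 0 ∧ bil u v = 0 ∧ act g = siegel u v}

theorem siegelGroup_le_orthogonal : siegelGroup F ≤ orthogonalGroupOf F (QPlus F) := by
  rw [siegelGroup, Subgroup.closure_le]
  rintro g ⟨u, v, hu, huv, hg⟩
  exact mem_orthogonal_iff.mpr (hg ▸ siegel_isIso hu huv)

theorem realizes_siegelGroup {u v : Fin 8 → F} (hu : QPlus F u = 0) (huv : bil u v = 0) :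
    Realizes (siegelGroup F) (siegel u v) := by
  obtain ⟨g, -, hg⟩ := (realizes_of_isIso (siegel_isIso hu huv)).exists
  rw [← hg]
  exact realizes_act (Subgroup.subset_closure ⟨u, v, hu, huv, hg⟩)

theorem ev_ne_zero (k : Fin 8) : (ev k : Fin 8 → F) ≠ 0 := fun h => by
  have := congrFun h k
  simp [ev_apply] at this

theorem bil_ev_ev {i j : Fin 8} (h : j ≠ i + 4) : bil (ev i : Fin 8 → F) (ev j) = 0 := by
  rw [bil_ev_left, ev_apply, if_neg h.symm]

theorem hasRoots_siegelGroup : HasRoots (siegelGroup F) := fun i j _ h t =>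
  realizes_siegelGroup (QPlus_ev i) (by rw [bil_smul_right, bil_ev_ev h, mul_zero])

theorem HasRoots.inf_orthogonal {H : Subgroup (GL (Fin 8) F)} (hH : HasRoots H) :
    HasRoots (H ⊓ orthogonalGroupOf F (QPlus F)) := fun i j h h' t => by
  obtain ⟨g, hg, hg'⟩ := (hH i j h h' t).exists
  rw [← hg']
  refine realizes_act ⟨hg, mem_orthogonal_iff.mpr ?_⟩
  rw [hg']
  exact siegel_isIso (QPlus_ev i) (by rw [bil_smul_right, bil_ev_ev h', mul_zero])

/-- A subgroup with all roots is transitive on nonzero singular vectors. -/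
theorem HasRoots.moves {H : Subgroup (GL (Fin 8) F)} (hH : HasRoots H) {u : Fin 8 → F}
    (hQ : QPlus F u = 0) (hne : u ≠ 0) : Moves H u (ev 0) := by
  obtain ⟨g, hg, h⟩ := hH.moves_tail (r := 0) (by norm_num) 0 rfl (fun j hj => by omega) hQ hne
  exact ⟨g, hg.1, h⟩

theorem HasRoots.siegelGroup_le {H : Subgroup (GL (Fin 8) F)} (hH : HasRoots H) :
    siegelGroup F ≤ H := by
  rw [siegelGroup, Subgroup.closure_le]
  rintro g ⟨u, v, hu, huv, hg⟩
  apply Realizes.mem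
  rw [hg]
  by_cases h0 : u = 0
  · rw [h0, siegel_zero_left]
    exact Realizes.one
  obtain ⟨a, ha, hau⟩ := hH.inf_orthogonal.moves hu h0
  have hi := mem_orthogonal_iff.mp ha.2
  have h1 : Realizes H (siegel (act a u) (act a v)) := by
    rw [hau]
    apply hH.siegel_ev
    rw [← hau, hi.bil, huv]
  apply (realizes_act ha.1).of_mul_left
  rw [siegel_conj hi]
  exact h1.mul (realizes_act ha.1)

theorem siegelGroup_conj {a g : GL (Fin 8) F} (ha : a ∈ orthogonalGroupOf F (QPlus F))
    (hg : g ∈ siegelGroup F) : a * g * a⁻¹ ∈ siegelGroup F := by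
  have hi := mem_orthogonal_iff.mp ha
  induction hg using Subgroup.closure_induction with
  | mem g hg =>
    obtain ⟨u, v, hu, huv, hg⟩ := hg
    refine Subgroup.subset_closure ⟨act a u, act a v, by rw [hi, hu], by rw [hi.bil, huv], ?_⟩
    have h1 : act a * siegel u v * act a⁻¹ = siegel (act a u) (act a v) := by
      rw [siegel_conj hi, mul_assoc, ← act_mul, mul_inv_cancel, act_one, mul_one]
    rw [act_mul, act_mul, hg, h1]
  | one => simp
  | mul x y _ _ hx hy =>
    have : a * (x * y) * a⁻¹ = (a * x * a⁻¹) * (a * y * a⁻¹) := by group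
    rw [this]
    exact Subgroup.mul_mem _ hx hy
  | inv x _ hx =>
    have : a * x⁻¹ * a⁻¹ = (a * x * a⁻¹)⁻¹ := by group
    rw [this]
    exact Subgroup.inv_mem _ hx

/-- The torus element scaling the last hyperbolic pair. -/
def torus (t s : F) : Module.End F (Fin 8 → F) where
  toFun x := ![x 0, x 1, x 2, t * x 3, x 4, x 5, x 6, s * x 7]
  map_add' x y := by funext k; fin_cases k <;> simp <;> ring
  map_smul' a x := by funext k; fin_cases k <;> simp <;> ring

/-- The long root element attached to two standard basis vectors. -/
def rt (i j : Fin 8) (t : F) : Module.End F (Fin 8 → F) := siegel (ev i) (t • ev j)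

theorem rt_apply (i j : Fin 8) (t : F) (x : Fin 8 → F) (k : Fin 8) :
    rt i j t x k = x k + (if k = i then t * x (j + 4) else 0)
      - (if k = j then t * x (i + 4) else 0) := by
  simp only [rt, siegel_apply, QPlus_smul, QPlus_ev, bil_smul_right, bil_ev_right, Pi.add_apply,
    Pi.sub_apply, Pi.smul_apply, smul_eq_mul, ev_apply]
  split_ifs <;> ring

theorem torus_apply (t s : F) (x : Fin 8 → F) :
    torus t s x = ![x 0, x 1, x 2, t * x 3, x 4, x 5, x 6, s * x 7] := rfl

theorem weyl_two {t : F} (ht : t ≠ 0) (x : Fin 8 → F) :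
    rt 3 2 t (rt 7 6 t⁻¹ (rt 3 2 t x))
      = ![x 0, x 1, - (t * x 7), t * x 6, x 4, x 5, - (t⁻¹ * x 3), t⁻¹ * x 2] := by
  have h1 : t * t⁻¹ = 1 := mul_inv_cancel₀ ht
  funext k
  fin_cases k <;> simp [rt_apply] <;> grind

theorem weyl_six {t : F} (ht : t ≠ 0) (x : Fin 8 → F) :
    rt 3 6 t (rt 7 2 t⁻¹ (rt 3 6 t x))
      = ![x 0, x 1, - (t⁻¹ * x 3), t * x 2, x 4, x 5, - (t * x 7), t⁻¹ * x 6] := by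
  have h1 : t * t⁻¹ = 1 := mul_inv_cancel₀ ht
  funext k
  fin_cases k <;> simp [rt_apply] <;> grind

theorem torus_sq_mem {t : F} (ht : t ≠ 0) :
    Realizes (siegelGroup F) (torus (t ^ 2) (t⁻¹ ^ 2)) := by
  have hr : ∀ i j : Fin 8, j ≠ i → j ≠ i + 4 → ∀ s : F, Realizes (siegelGroup F) (rt i j s) :=
    hasRoots_siegelGroup
  have h : torus (t ^ 2) (t⁻¹ ^ 2)
      = ((rt 3 2 t * rt 7 6 t⁻¹ * rt 3 2 t) * (rt 3 2 (-1) * rt 7 6 (-1)⁻¹ * rt 3 2 (-1))) *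
        ((rt 3 6 t * rt 7 2 t⁻¹ * rt 3 6 t) * (rt 3 6 (-1) * rt 7 2 (-1)⁻¹ * rt 3 6 (-1))) := by
    refine LinearMap.ext fun x => ?_
    have hn : (-1 : F) ≠ 0 := neg_ne_zero.mpr one_ne_zero
    simp only [Module.End.mul_apply, weyl_six ht, weyl_two ht, weyl_two hn, weyl_six hn,
      torus_apply]
    have h1 : t * t⁻¹ = 1 := mul_inv_cancel₀ ht
    have h2 : ∀ y : F, t * (t⁻¹ * y) = y := fun y => by rw [← mul_assoc, h1, one_mul]
    have h3 : ∀ y : F, t⁻¹ * (t * y) = y := fun y => by rw [← mul_assoc, mul_comm t⁻¹, h1, one_mul]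
    funext k
    fin_cases k <;> simp [inv_neg, h2, h3, pow_two, mul_assoc]
  rw [h]
  have a1 := fun s : F => hr 3 2 (by decide) (by decide) s
  have a2 := fun s : F => hr 7 6 (by decide) (by decide) s
  have a3 := fun s : F => hr 3 6 (by decide) (by decide) s
  have a4 := fun s : F => hr 7 2 (by decide) (by decide) s
  exact ((((a1 _).mul (a2 _)).mul (a1 _)).mul (((a1 _).mul (a2 _)).mul (a1 _))).mul
    ((((a3 _).mul (a4 _)).mul (a3 _)).mul (((a3 _).mul (a4 _)).mul (a3 _)))

set_option maxHeartbeats 1000000 in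
theorem sq_mem_of_fixer {g : GL (Fin 8) F} (hg : g ∈ orthogonalGroupOf F (QPlus F))
    (hf : g ∈ fixer F 3) : g ^ 2 ∈ siegelGroup F := by
  have hi := mem_orthogonal_iff.mp hg
  have hz : ∀ k : Fin 8, k = 3 ∨ k = 7 → ∀ j : Fin 8, j.val % 4 < 3 → act g (ev k) j = 0 := by
    intro k hk j hj
    have h := hi.bil (ev (j + 4)) (ev k)
    rw [hf _ (by rwa [add_four_val_mod]), bil_ev_left, bil_ev_left, add_four_add_four, ev_apply,
      if_neg] at h
    · exact h
    · rintro rfl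
      rcases hk with rfl | rfl <;> simp at hj
  set a := act g (ev 3) 3 with ha
  set b := act g (ev 3) 7 with hb
  set c := act g (ev 7) 3 with hc
  set d := act g (ev 7) 7 with hd
  have h3 : act g (ev 3) = ![0, 0, 0, a, 0, 0, 0, b] := by
    have := hz 3 (Or.inl rfl)
    funext k
    fin_cases k <;> first | exact this _ (by decide) | rfl
  have h7 : act g (ev 7) = ![0, 0, 0, c, 0, 0, 0, d] := by
    have := hz 7 (Or.inr rfl)
    funext k
    fin_cases k <;> first | exact this _ (by decide) | rfl
  clear_value a b c d
  have q1 := hi (ev 3)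
  have q2 := hi (ev 7)
  have q3 := hi.bil (ev 3) (ev 7)
  rw [h3] at q1 q3
  rw [h7] at q2 q3
  simp [QPlus, bil, ev_apply] at q1 q2 q3
  have hact : ∀ x, act g x = ![x 0, x 1, x 2, a * x 3 + c * x 7, x 4, x 5, x 6,
      b * x 3 + d * x 7] := by
    intro x
    conv_lhs => rw [eq_sum_ev x]
    have f : ∀ i : Fin 8, i.val % 4 < 3 → act g (ev i) = ev i := hf
    simp only [Fin.sum_univ_eight, map_add, map_smul, h3, h7, f 0 (by decide), f 1 (by decide),
      f 2 (by decide), f 4 (by decide), f 5 (by decide), f 6 (by decide)]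
    funext k
    simp only [Pi.add_apply, Pi.smul_apply, ev_apply, smul_eq_mul]
    fin_cases k <;> simp <;> ring
  apply Realizes.mem
  rw [pow_two, act_mul]
  rcases q1 with h0 | h0
  · have h1 : act g * act g = 1 := by
      have hd0 : d = 0 := by
        rw [h0, zero_mul, zero_add] at q3
        rcases q2 with h | h
        · rw [h, mul_zero] at q3; exact absurd q3 zero_ne_one
        · exact h
      rw [h0, zero_mul, zero_add] at q3
      refine LinearMap.ext fun x => ?_
      rw [Module.End.mul_apply, hact, hact, h0, hd0]
      funext k
      fin_cases k <;> simp <;> grind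
    rw [h1]
    exact Realizes.one
  · have hc0 : c = 0 := by
      rw [h0, zero_mul, add_zero] at q3
      rcases q2 with h | h
      · exact h
      · rw [h, mul_zero] at q3; exact absurd q3 zero_ne_one
    rw [h0, zero_mul, add_zero] at q3
    have ha0 : a ≠ 0 := left_ne_zero_of_mul_eq_one q3
    have : d = a⁻¹ := eq_inv_of_mul_eq_one_right q3
    have h1 : act g * act g = torus (a ^ 2) (a⁻¹ ^ 2) := by
      refine LinearMap.ext fun x => ?_
      rw [Module.End.mul_apply, hact, hact, h0, hc0, this]
      funext k
      fin_cases k <;> simp [torus] <;> ring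
    rw [h1]
    exact torus_sq_mem ha0

theorem sq_mem_siegelGroup {g : GL (Fin 8) F} (hg : g ∈ orthogonalGroupOf F (QPlus F)) :
    g ^ 2 ∈ siegelGroup F := by
  have hE := siegelGroup_le_orthogonal (F := F)
  have hR := hasRoots_siegelGroup (F := F)
  obtain ⟨a, ha, h1⟩ := hR.fix_pair hE (r := 0) (by norm_num) hg (fun j hj => by omega)
  obtain ⟨b, hb, h2⟩ := hR.fix_pair hE (r := 1) (by norm_num) (mul_mem (hE ha) hg) h1
  obtain ⟨c, hc, h3⟩ := hR.fix_pair hE (r := 2) (by norm_num)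
    (mul_mem (hE hb) (mul_mem (hE ha) hg)) h2
  set h := c * b * a with hh
  have hh' : h ∈ siegelGroup F := mul_mem (mul_mem hc hb) ha
  have hk : c * (b * (a * g)) = h * g := by rw [hh]; group
  rw [hk] at h3
  have hO : h * g ∈ orthogonalGroupOf F (QPlus F) := mul_mem (hE hh') hg
  have h4 := sq_mem_of_fixer hO h3
  have h5 := siegelGroup_conj hg hh'
  have : g ^ 2 = (g * h * g⁻¹)⁻¹ * (h⁻¹ * (h * g) ^ 2) := by
    rw [pow_two, pow_two]; group
  rw [this]
  exact mul_mem (inv_mem h5) (mul_mem (inv_mem hh') h4)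

/-- The derived subgroup of the orthogonal group, inside `GL₈`. -/
def derivedGroup (F : Type*) [Field F] : Subgroup (GL (Fin 8) F) :=
  (commutator (orthogonalGroupOf F (QPlus F))).map (orthogonalGroupOf F (QPlus F)).subtype

theorem derivedGroup_le_siegelGroup : derivedGroup F ≤ siegelGroup F := by
  rw [derivedGroup, Subgroup.map_le_iff_le_comap, commutator_eq_closure, Subgroup.closure_le]
  rintro _ ⟨a, b, rfl⟩
  obtain ⟨a, ha⟩ := a
  obtain ⟨b, hb⟩ := b
  change a * b * a⁻¹ * b⁻¹ ∈ siegelGroup F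
  have : a * b * a⁻¹ * b⁻¹ = (a * b) ^ 2 * (b⁻¹ * (a⁻¹) ^ 2 * b⁻¹⁻¹) * (b⁻¹) ^ 2 := by
    simp only [pow_two]; group
  rw [this]
  exact mul_mem (mul_mem (sq_mem_siegelGroup (mul_mem ha hb))
    (siegelGroup_conj (inv_mem hb) (sq_mem_siegelGroup (inv_mem ha))))
    (sq_mem_siegelGroup (inv_mem hb))

theorem derivedGroup_le_orthogonal : derivedGroup F ≤ orthogonalGroupOf F (QPlus F) :=
  derivedGroup_le_siegelGroup.trans siegelGroup_le_orthogonal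

theorem HasRoots.derivedGroup_le {H : Subgroup (GL (Fin 8) F)} (hH : HasRoots H) :
    derivedGroup F ≤ H := derivedGroup_le_siegelGroup.trans hH.siegelGroup_le

theorem hasRoots_derivedGroup : HasRoots (derivedGroup F) := by
  intro i j hji hji4 t
  obtain ⟨k, hk1, hk2, hk3, hk4⟩ : ∃ k : Fin 8, k ≠ i ∧ k ≠ i + 4 ∧ k ≠ j ∧ k ≠ j + 4 := by
    revert i j; decide
  have o1 : bil (ev i : Fin 8 → F) (t • ev k) = 0 := by rw [bil_smul_right, bil_ev_ev hk2, mul_zero]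
  have o2 : bil (ev j : Fin 8 → F) (ev (k + 4)) = 0 := by
    apply bil_ev_ev
    intro h
    exact hk3 (add_right_cancel h)
  have o3 : bil (ev i : Fin 8 → F) (t • ev j) = 0 := by rw [bil_smul_right, bil_ev_ev hji4, mul_zero]
  have o4 : bil (ev i : Fin 8 → F) (ev (k + 4)) = 0 := by
    apply bil_ev_ev
    intro h
    exact hk1 (add_right_cancel h)
  have hgi := siegel_isIso (F := F) (QPlus_ev j) o2
  obtain ⟨s, hs, hs'⟩ := (realizes_of_isIso (siegel_isIso (QPlus_ev i) o1)).exists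
  obtain ⟨g, hg, hg'⟩ := (realizes_of_isIso hgi).exists
  have gi : siegel (ev j) (ev (k + 4)) (ev i) = (ev i : Fin 8 → F) :=
    siegel_apply_of_orthogonal (bil_ev_ev hji4) o4
  have gk : siegel (ev j) (ev (k + 4)) (ev k) = (ev k + ev j : Fin 8 → F) := by
    rw [siegel_apply, bil_ev_ev_add_four, bil_ev_ev]
    · simp
    · intro h
      apply hk4
      rw [h, add_four_add_four]
  have hmem : s⁻¹ * g * s * g⁻¹ ∈ derivedGroup F := by
    refine ⟨⁅(⟨s⁻¹, inv_mem hs⟩ : orthogonalGroupOf F (QPlus F)),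
      (⟨g, hg⟩ : orthogonalGroupOf F (QPlus F))⁆, ?_, ?_⟩
    · exact Subgroup.commutator_mem_commutator (Subgroup.mem_top _) (Subgroup.mem_top _)
    · simp [commutatorElement_def]
  have hconj : act g * act s * act g⁻¹ = siegel (ev i) (t • (ev k + ev j)) := by
    rw [hg', hs', siegel_conj hgi, ← hg', mul_assoc, ← act_mul, mul_inv_cancel, act_one, mul_one,
      hg', map_smul, gi, gk]
  have hact : act (s⁻¹ * g * s * g⁻¹) = siegel (ev i) (t • ev j) := by
    rw [smul_add, ← siegel_mul (QPlus_ev i) o1 o3, ← hs'] at hconj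
    rw [mul_assoc, mul_assoc, act_mul, ← mul_assoc, act_mul, act_mul, hconj, ← mul_assoc,
      act_inv_mul, one_mul]
  rw [← hact]
  exact realizes_act hmem

end

section

variable {F : Type*} [Field F]

theorem isTwoThreeGenerated_iff :
    IsTwoThreeGenerated ↥(commutator ↥(orthogonalGroupOf F (QPlus F))) ↔
      ∃ x y : GL (Fin 8) F, orderOf x = 2 ∧ orderOf y = 3 ∧
        Subgroup.closure {x, y} = derivedGroup F := by
  let ψ : ↥(commutator ↥(orthogonalGroupOf F (QPlus F))) →* GL (Fin 8) F :=
    (orthogonalGroupOf F (QPlus F)).subtype.comp (Subgroup.subtype _)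
  have hψ : Function.Injective ψ :=
    (Subgroup.subtype_injective _).comp (Subgroup.subtype_injective _)
  have hr : Subgroup.map ψ ⊤ = derivedGroup F := by
    rw [derivedGroup, ← Subgroup.map_map, ← MonoidHom.range_eq_map, Subgroup.range_subtype]
  have hc : ∀ x y, Subgroup.map ψ (Subgroup.closure {x, y}) = Subgroup.closure {ψ x, ψ y} := by
    intro x y
    rw [MonoidHom.map_closure, Set.image_pair]
  constructor
  · rintro ⟨x, y, hx, hy, h⟩
    refine ⟨ψ x, ψ y, ?_, ?_, ?_⟩
    · rw [orderOf_injective ψ hψ, hx]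
    · rw [orderOf_injective ψ hψ, hy]
    · rw [← hc, h, hr]
  · rintro ⟨x, y, hx, hy, h⟩
    have hx' : x ∈ Subgroup.map ψ ⊤ := hr ▸ h ▸ Subgroup.subset_closure (by simp)
    have hy' : y ∈ Subgroup.map ψ ⊤ := hr ▸ h ▸ Subgroup.subset_closure (by simp)
    obtain ⟨x, -, rfl⟩ := hx'
    obtain ⟨y, -, rfl⟩ := hy'
    rw [orderOf_injective ψ hψ] at hx hy
    refine ⟨x, y, hx, hy, Subgroup.map_injective hψ ?_⟩
    rw [hc, h, hr]

/-- The element of order three, permuting the first three hyperbolic pairs cyclically. -/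
def yEnd (F : Type*) [Field F] : Module.End F (Fin 8 → F) where
  toFun v := ![v 2, v 0, v 1, v 3, v 6, v 4, v 5, v 7]
  map_add' x y := by funext k; fin_cases k <;> rfl
  map_smul' a x := by funext k; fin_cases k <;> rfl

theorem yEnd_apply (v : Fin 8 → F) :
    yEnd F v = ![v 2, v 0, v 1, v 3, v 6, v 4, v 5, v 7] := rfl

/-- A family of involutions. -/
def xEnd (b c d z : F) : Module.End F (Fin 8 → F) where
  toFun v := ![v 6 + b * v 1 + d * v 3 + c * v 7 + z * v 4 - c * d * v 2, -v 5 + b * v 2, v 4,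
    v 7 + c * v 4 - d * v 2, v 2, -v 1 + b * v 4,
    v 0 + b * v 5 - c * v 3 - d * v 7 - c * d * v 4 + (c ^ 2 + d ^ 2 - b ^ 2 - z) * v 2,
    v 3 + d * v 4 - c * v 2]
  map_add' x y := by
    funext k
    fin_cases k <;> simp only [Pi.add_apply] <;> simp <;> ring
  map_smul' a x := by
    funext k
    fin_cases k <;> simp only [Pi.smul_apply, smul_eq_mul] <;> simp <;> ring

theorem xEnd_apply (b c d z : F) (v : Fin 8 → F) : xEnd b c d z v =
    ![v 6 + b * v 1 + d * v 3 + c * v 7 + z * v 4 - c * d * v 2, -v 5 + b * v 2, v 4,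
    v 7 + c * v 4 - d * v 2, v 2, -v 1 + b * v 4,
    v 0 + b * v 5 - c * v 3 - d * v 7 - c * d * v 4 + (c ^ 2 + d ^ 2 - b ^ 2 - z) * v 2,
    v 3 + d * v 4 - c * v 2] := rfl

theorem yEnd_isIso : IsIso (yEnd F) := fun v => by
  rw [yEnd_apply]; simp [QPlus]; ring

theorem xEnd_isIso (b c d z : F) : IsIso (xEnd b c d z) := fun v => by
  rw [xEnd_apply]; simp [QPlus]; ring

theorem yEnd_pow_three : yEnd F * (yEnd F * yEnd F) = 1 := by
  refine LinearMap.ext fun x => ?_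
  simp only [Module.End.mul_apply, yEnd_apply]
  funext k
  fin_cases k <;> simp

theorem xEnd_sq (b c d z : F) : xEnd b c d z * xEnd b c d z = 1 := by
  refine LinearMap.ext fun x => ?_
  simp only [Module.End.mul_apply, xEnd_apply]
  funext k
  fin_cases k <;> simp <;> ring

/-- A Weyl group element. -/
def weyl (i j : Fin 8) (t : F) : Module.End F (Fin 8 → F) :=
  rt i j t * rt (i + 4) (j + 4) t * rt i j t

theorem realizes_rt {H : Subgroup (GL (Fin 8) F)} (hH : HasRoots H) {i j : Fin 8} (h : j ≠ i)
    (h' : j ≠ i + 4) (t : F) : Realizes H (rt i j t) := hH i j h h' t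

theorem realizes_weyl {H : Subgroup (GL (Fin 8) F)} (hH : HasRoots H) {i j : Fin 8} (h : j ≠ i)
    (h' : j ≠ i + 4) (t : F) : Realizes H (weyl i j t) := by
  have h1 : j + 4 ≠ i + 4 := fun e => h (add_right_cancel e)
  have h2 : j + 4 ≠ i + 4 + 4 := fun e => h' (add_right_cancel e)
  exact ((realizes_rt hH h h' t).mul (realizes_rt hH h1 h2 t)).mul (realizes_rt hH h h' t)

theorem weyl_zero_two (x : Fin 8 → F) :
    weyl 0 2 (-1) x = ![-x 6, x 1, x 4, x 3, -x 2, x 5, x 0, x 7] := by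
  simp only [weyl, Module.End.mul_apply]
  funext k
  fin_cases k <;> simp [rt_apply]

theorem weyl_one_three (x : Fin 8 → F) :
    weyl 1 3 1 x = ![x 0, x 7, x 2, -x 5, x 4, x 3, x 6, -x 1] := by
  simp only [weyl, Module.End.mul_apply]
  funext k
  fin_cases k <;> simp [rt_apply]

theorem weyl_one_seven (x : Fin 8 → F) :
    weyl 1 7 (-1) x = ![x 0, -x 3, x 2, x 1, x 4, -x 7, x 6, x 5] := by
  simp only [weyl, Module.End.mul_apply]
  funext k
  fin_cases k <;> simp [rt_apply]

theorem weyl_zero_one (x : Fin 8 → F) :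
    weyl 0 1 1 x = ![x 5, -x 4, x 2, x 3, x 1, -x 0, x 6, x 7] := by
  simp only [weyl, Module.End.mul_apply]
  funext k
  fin_cases k <;> simp [rt_apply]

theorem xEnd_eq (b c d z : F) : xEnd b c d z =
    siegel (ev 6) (-(b • ev 5 + c • ev 3 + d • ev 7 + z • ev 0)) *
    siegel (ev 0) (-(b • ev 1) + c • ev 7 + d • ev 3) *
    ((weyl 0 1 1 * weyl 0 1 1) * (weyl 1 7 (-1) * weyl 1 3 1) * weyl 0 2 (-1)) := by
  refine LinearMap.ext fun x => ?_
  simp only [Module.End.mul_apply, weyl_zero_one, weyl_one_seven, weyl_one_three, weyl_zero_two,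
    xEnd_apply, siegel_apply, bil_add_right, bil_neg_right, bil_smul_right, bil_ev_right,
    QPlus_neg, QPlus_add, QPlus_smul, QPlus_ev]
  funext k
  simp only [Pi.add_apply, Pi.sub_apply, Pi.smul_apply, Pi.neg_apply, smul_eq_mul, ev_apply]
  fin_cases k <;> simp <;> ring

theorem realizes_xEnd (b c d z : F) : Realizes (derivedGroup F) (xEnd b c d z) := by
  have hH := hasRoots_derivedGroup (F := F)
  rw [xEnd_eq]
  refine ((hH.siegel_ev 6 ?_).mul (hH.siegel_ev 0 ?_)).mul ((((realizes_weyl hH ?_ ?_ _).mul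
    (realizes_weyl hH ?_ ?_ _)).mul ((realizes_weyl hH ?_ ?_ _).mul
    (realizes_weyl hH ?_ ?_ _))).mul (realizes_weyl hH ?_ ?_ _)) <;>
    first | decide | simp [bil_ev_left, ev_apply]

theorem realizes_yEnd : Realizes (derivedGroup F) (yEnd F) := by
  obtain ⟨g, hg, hg'⟩ := (realizes_of_isIso (yEnd_isIso (F := F))).exists
  have h3 : g ^ 3 = 1 := by
    apply act_injective
    rw [pow_succ, pow_two, act_mul, act_mul, act_one, hg', mul_assoc, yEnd_pow_three]
  have h4 : g = (g ^ 2) ^ 2 := by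
    rw [← pow_mul]
    calc g = g ^ 3 * g := by rw [h3, one_mul]
      _ = g ^ (2 * 2) := by group
  rw [← hg', h4]
  exact realizes_act (hasRoots_derivedGroup.siegelGroup_le
    (sq_mem_siegelGroup (pow_mem hg 2)))

/-- Generation of the derived group by an involution `f` and the element `yEnd F` of order
three once all roots are realized. -/
theorem generated_of_hasRoots_of_involution {f : Module.End F (Fin 8 → F)}
    (hf : Realizes (derivedGroup F) f) (hf2 : f * f = 1) (hf1 : f ≠ 1)
    (h : ∀ H : Subgroup (GL (Fin 8) F), Realizes H f → Realizes H (yEnd F) → HasRoots H) :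
    IsTwoThreeGenerated ↥(commutator ↥(orthogonalGroupOf F (QPlus F))) := by
  rw [isTwoThreeGenerated_iff]
  obtain ⟨x, hx, hx'⟩ := hf.exists
  obtain ⟨y, hy, hy'⟩ := (realizes_yEnd (F := F)).exists
  refine ⟨x, y, ?_, ?_, le_antisymm ?_ ?_⟩
  · apply orderOf_eq_prime
    · apply act_injective
      rw [pow_two, act_mul, act_one, hx', hf2]
    · rintro rfl
      exact hf1 (hx'.symm.trans act_one)
  · apply orderOf_eq_prime
    · apply act_injective
      rw [pow_succ, pow_two, act_mul, act_mul, act_one, hy', mul_assoc, yEnd_pow_three]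
    · rintro rfl
      rw [act_one] at hy'
      have := congrFun (LinearMap.congr_fun hy' (ev 0)) 0
      simp [yEnd_apply, ev_apply] at this
  · rw [Subgroup.closure_le]
    rintro g (rfl | rfl)
    · exact hx
    · exact hy
  · apply HasRoots.derivedGroup_le
    apply h
    · rw [← hx']
      exact realizes_act (Subgroup.subset_closure (by simp))
    · rw [← hy']
      exact realizes_act (Subgroup.subset_closure (by simp))

/-- Generation of the derived group by `x` and `y` once all roots are realized. -/
theorem generated_of_hasRoots (b c d z : F)
    (h : ∀ H : Subgroup (GL (Fin 8) F), Realizes H (xEnd b c d z) → Realizes H (yEnd F) →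
      HasRoots H) :
    IsTwoThreeGenerated ↥(commutator ↥(orthogonalGroupOf F (QPlus F))) := by
  refine generated_of_hasRoots_of_involution (realizes_xEnd b c d z) (xEnd_sq b c d z)
    (fun e => ?_) h
  have := congrFun (LinearMap.congr_fun e (ev 0)) 0
  simp [xEnd_apply, ev_apply] at this

open Polynomial in
/-- A separable polynomial with nonzero constant term divides some `X ^ m - 1` with `m` nonzero
in the field. -/
theorem exists_dvd_X_pow_sub_one [Finite F] {P : F[X]} (hP : P.Separable) (h0 : P.coeff 0 ≠ 0) :
    ∃ m : ℕ, (m : F) ≠ 0 ∧ P ∣ X ^ m - 1 := by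
  have hP0 : P ≠ 0 := hP.ne_zero
  have hroot : IsUnit (AdjoinRoot.root P) := by
    obtain ⟨Q, hQ⟩ := X_dvd_sub_C (p := P)
    have h1 : AdjoinRoot.mk P (P - C (P.coeff 0)) = AdjoinRoot.mk P (X * Q) := by rw [hQ]
    rw [map_sub, AdjoinRoot.mk_self, map_mul, AdjoinRoot.mk_X, zero_sub, AdjoinRoot.mk_C] at h1
    have h2 : IsUnit (AdjoinRoot.root P * AdjoinRoot.mk P Q) := by
      rw [← h1]
      exact ((isUnit_iff_ne_zero.mpr h0).map (AdjoinRoot.of P)).neg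
    exact isUnit_of_mul_isUnit_left h2
  have : Module.Finite F (AdjoinRoot P) := (AdjoinRoot.powerBasis hP0).finite
  have : Finite (AdjoinRoot P) := Module.finite_of_finite F
  obtain ⟨n, hn, hn'⟩ := (isOfFinOrder_of_finite hroot.unit).exists_pow_eq_one
  have hn2 : P ∣ X ^ n - 1 := by
    rw [← AdjoinRoot.mk_eq_zero]
    have := congrArg Units.val hn'
    simpa [sub_eq_zero] using this
  obtain ⟨p, hp⟩ := CharP.exists F
  have hpp : p.Prime := CharP.char_is_prime F p
  obtain ⟨k, m, hm, rfl⟩ := Nat.exists_eq_pow_mul_and_not_dvd hn.ne' p hpp.ne_one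
  have := Fact.mk hpp
  refine ⟨m, fun h => hm ((CharP.cast_eq_zero_iff F p m).mp h), ?_⟩
  have h3 : (X ^ (p ^ k * m) - 1 : F[X]) = (X ^ m - 1) ^ (p ^ k) := by
    rw [sub_pow_char_pow, one_pow, ← pow_mul, mul_comm]
  rw [h3] at hn2
  exact (hP.squarefree.dvd_pow_iff_dvd (pow_ne_zero _ hpp.ne_zero)).mp hn2

/-- The product of the two generators. -/
def wEnd (b c d z : F) : Module.End F (Fin 8 → F) := xEnd b c d z * yEnd F

theorem wEnd_apply (b c d z : F) (v : Fin 8 → F) : wEnd b c d z v =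
    ![v 5 + b * v 0 + d * v 3 + c * v 7 + z * v 6 - c * d * v 1, -v 4 + b * v 1, v 6,
    v 7 + c * v 6 - d * v 1, v 1, -v 0 + b * v 6,
    v 2 + b * v 4 - c * v 3 - d * v 7 - c * d * v 6 + (c ^ 2 + d ^ 2 - b ^ 2 - z) * v 1,
    v 3 + d * v 6 - c * v 1] := by
  rw [wEnd, Module.End.mul_apply, yEnd_apply, xEnd_apply]
  funext k
  fin_cases k <;> simp

/-- The totally singular line `⟨ev 0, ev 5⟩`. -/
def invLine (F : Type*) [Field F] : Submodule F (Fin 8 → F) where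
  carrier := {v | v 1 = 0 ∧ v 2 = 0 ∧ v 3 = 0 ∧ v 4 = 0 ∧ v 6 = 0 ∧ v 7 = 0}
  add_mem' {a b} ha hb := by
    obtain ⟨h1, h2, h3, h4, h5, h6⟩ := ha
    obtain ⟨k1, k2, k3, k4, k5, k6⟩ := hb
    simp [*]
  zero_mem' := by simp
  smul_mem' c a ha := by
    obtain ⟨h1, h2, h3, h4, h5, h6⟩ := ha
    simp [*]

theorem aeval_mem_of_mem {f : Module.End F (Fin 8 → F)} {U : Submodule F (Fin 8 → F)}
    (hf : ∀ u ∈ U, f u ∈ U) (Q : Polynomial F) {u : Fin 8 → F} (hu : u ∈ U) :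
    Polynomial.aeval f Q u ∈ U := by
  induction Q using Polynomial.induction_on' with
  | add p q hp hq => simpa using U.add_mem hp hq
  | monomial n a =>
    have : (f ^ n) u ∈ U := by
      induction n with
      | zero => simpa
      | succ k ih => rw [pow_succ', Module.End.mul_apply]; exact hf _ ih
    simpa [Polynomial.aeval_monomial, Module.algebraMap_end_apply] using U.smul_mem a this

theorem eq_rt_of_sub_mem_invLine {r : Module.End F (Fin 8 → F)} (hr : IsIso r)
    (h : ∀ v, r v - v ∈ invLine F) : ∃ s : F, r = rt 0 5 s := by
  have hQ : ∀ v, (r v 0 - v 0) * v 4 + (r v 5 - v 5) * v 1 = 0 := by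
    intro v
    obtain ⟨h1, h2, h3, h4, h5, h6⟩ := h v
    simp only [Pi.sub_apply, sub_eq_zero] at h1 h2 h3 h4 h5 h6
    have := hr v
    simp only [QPlus, h1, h2, h3, h4, h5, h6] at this
    linear_combination this
  have h4 := hQ (ev 4)
  have h1 := hQ (ev 1)
  simp [ev_apply] at h4 h1
  have hi0 : ∀ i : Fin 8, i ≠ 1 → r (ev i) 0 = (ev i : Fin 8 → F) 0 := by
    intro i hi
    by_cases hi4 : i = 4
    · rw [hi4, h4]; simp [ev_apply]
    have := hQ (ev i + ev 4)
    simp [ev_apply, h4, hi.symm, Ne.symm hi4] at this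
    rw [ev_apply]
    exact sub_eq_zero.mp this
  have hi5 : ∀ i : Fin 8, i ≠ 4 → r (ev i) 5 = (ev i : Fin 8 → F) 5 := by
    intro i hi
    by_cases hi1 : i = 1
    · rw [hi1, h1]; simp [ev_apply]
    have := hQ (ev i + ev 1)
    simp [ev_apply, h1, hi.symm, Ne.symm hi1] at this
    rw [ev_apply]
    exact sub_eq_zero.mp this
  have h14 := hQ (ev 1 + ev 4)
  simp [ev_apply, h1, h4] at h14
  refine ⟨r (ev 1) 0, ?_⟩
  refine LinearMap.pi_ext' fun i => LinearMap.ext_ring ?_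
  change r (ev i) = rt 0 5 (r (ev 1) 0) (ev i)
  obtain ⟨k1, k2, k3, k4, k6, k7⟩ := h (ev i)
  simp only [Pi.sub_apply, sub_eq_zero] at k1 k2 k3 k4 k6 k7
  have h45 : r (ev 4) 5 = - r (ev 1) 0 := by linear_combination h14
  funext k
  rw [rt_apply]
  fin_cases k
  · by_cases h : i = 1
    · subst h; simp [ev_apply]
    · simp [hi0 i h, ev_apply, Ne.symm h]
  · simpa using k1
  · simpa using k2
  · simpa using k3
  · simpa using k4
  · by_cases h : i = 4
    · subst h; simp [ev_apply, h45]
    · simp [hi5 i h, ev_apply, Ne.symm h]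
  · simpa using k6
  · simpa using k7

open Polynomial in
theorem exists_root_element [Finite F] (b c d z : F) (g : F[X])
    (hg : ∀ v : Fin 8 → F, v 1 = 0 → v 4 = 0 → aeval (wEnd b c d z) g v ∈ invLine F)
    (hsep : ((X ^ 2 - C b * X + 1) * g).Separable) (h0 : g.coeff 0 ≠ 0)
    (hne : aeval (wEnd b c d z) ((X ^ 2 - C b * X + 1) * g) ≠ 0) :
    ∃ s : F, s ≠ 0 ∧ ∀ H : Subgroup (GL (Fin 8) F), Realizes H (xEnd b c d z) →
      Realizes H (yEnd F) → Realizes H (rt 0 5 s) := by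
  set w := wEnd b c d z with hw
  set a : F[X] := X ^ 2 - C b * X + 1 with ha
  have hwL : ∀ u ∈ invLine F, w u ∈ invLine F := by
    rintro u ⟨h1, h2, h3, h4, h5, h6⟩
    rw [hw, wEnd_apply]
    refine ⟨?_, ?_, ?_, ?_, ?_, ?_⟩ <;> simp [h1, h2, h3, h4, h5, h6]
  have haw : ∀ v, aeval w a v = w (w v) - b • w v + v := by
    intro v
    simp [ha, pow_two, Module.algebraMap_end_apply]
  have ha1 : ∀ v, aeval w a v 1 = 0 ∧ aeval w a v 4 = 0 := by
    intro v
    rw [haw, hw]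
    simp [wEnd_apply]
  have ha2 : ∀ v ∈ invLine F, aeval w a v = 0 := by
    rintro v ⟨h1, h2, h3, h4, h5, h6⟩
    rw [haw, hw]
    funext k
    fin_cases k <;> simp [wEnd_apply, h1, h2, h3, h4, h5, h6]
  have hP : ∀ v, aeval w (a * g) v ∈ invLine F := by
    intro v
    rw [mul_comm, map_mul, Module.End.mul_apply]
    exact hg _ (ha1 v).1 (ha1 v).2
  have haP : aeval w (a * (a * g)) = 0 := by
    refine LinearMap.ext fun v => ?_
    rw [map_mul, Module.End.mul_apply]
    exact ha2 _ (hP v)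
  have hc : (a * g).coeff 0 ≠ 0 := by
    rw [mul_coeff_zero, ha]
    simpa using h0
  obtain ⟨m, hm, Q, hQ⟩ := exists_dvd_X_pow_sub_one hsep hc
  have hwi : IsIso w := (xEnd_isIso b c d z).mul yEnd_isIso
  have hri : IsIso (w ^ m) := by
    clear hQ hm
    induction m with
    | zero => intro v; simp
    | succ k ih => rw [pow_succ]; exact ih.mul hwi
  have hrm : ∀ v, (w ^ m) v - v = aeval w Q (aeval w (a * g) v) := by
    intro v
    rw [← Module.End.mul_apply, ← map_mul, mul_comm, ← hQ]
    simp
  obtain ⟨s, hs⟩ := eq_rt_of_sub_mem_invLine hri fun v => by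
    rw [hrm]
    exact aeval_mem_of_mem hwL _ (hP v)
  refine ⟨s, ?_, fun H hx hy => ?_⟩
  · rintro rfl
    apply hne
    have h1 : aeval w (a * g * Q) = 0 := by
      rw [← hQ]
      have : rt 0 5 (0 : F) = 1 := by rw [rt, zero_smul, siegel_zero]
      simp [hs, this]
    have hsepm : (X ^ m - 1 : F[X]).Separable := by
      have := X_pow_sub_one_separable_iff (F := F) (n := m)
      exact this.mpr hm
    rw [hQ, show a * g * Q = (a * Q) * g by ring] at hsepm
    obtain ⟨u, v, huv⟩ := hsepm.of_mul_left.isCoprime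
    have h2 : a * g = u * (a * (a * g)) + v * (a * g * Q) := by
      linear_combination (-(a * g)) * huv
    rw [h2, map_add, map_mul, map_mul _ v, haP, h1, mul_zero, mul_zero, add_zero]
  · rw [← hs]
    exact (hx.mul hy).pow m

theorem rt_add (i j : Fin 8) (h : j ≠ i + 4) (s t : F) : rt i j s * rt i j t = rt i j (s + t) := by
  rw [rt, rt, siegel_mul (QPlus_ev i), ← add_smul, rt] <;>
    rw [bil_smul_right, bil_ev_ev h, mul_zero]

theorem rt_zero (i j : Fin 8) : rt i j (0 : F) = 1 := by rw [rt, zero_smul, siegel_zero]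

theorem rt_swap (i j : Fin 8) (t : F) : rt i j t = rt j i (-t) := by
  refine LinearMap.ext fun x => funext fun k => ?_
  rw [rt_apply, rt_apply]
  split_ifs <;> ring

theorem rt_isIso {i j : Fin 8} (h : j ≠ i + 4) (t : F) : IsIso (rt i j t) :=
  siegel_isIso (QPlus_ev i) (by rw [bil_smul_right, bil_ev_ev h, mul_zero])

theorem rt_ev (i j : Fin 8) (t : F) (k : Fin 8) : rt i j t (ev k) =
    ev k + (if j + 4 = k then t else 0) • ev i - (if i + 4 = k then t else 0) • ev j := by
  funext l
  rw [rt_apply]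
  simp only [Pi.add_apply, Pi.sub_apply, Pi.smul_apply, smul_eq_mul, ev_apply]
  split_ifs <;> simp

theorem rt_neg_left_inv {H : Subgroup (GL (Fin 8) F)} {i j : Fin 8} (h : j ≠ i + 4) {t : F}
    (ht : Realizes H (rt i j t)) : Realizes H (rt i j (-t)) := by
  apply ht.of_mul_left
  rw [rt_add i j h, add_neg_cancel, rt_zero]
  exact Realizes.one

/-- Remove a known factor from a Siegel transformation. -/
theorem Realizes.siegel_cancel {H : Subgroup (GL (Fin 8) F)} {u v v' : Fin 8 → F}
    (hu : QPlus F u = 0) (hv : bil u v = 0) (hv' : bil u v' = 0) (h : Realizes H (siegel u v))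
    (h' : Realizes H (siegel u (v + v'))) : Realizes H (siegel u v') := by
  apply h.of_mul_left
  rwa [siegel_mul hu hv hv']

theorem Realizes.siegel_add {H : Subgroup (GL (Fin 8) F)} {u v v' : Fin 8 → F}
    (hu : QPlus F u = 0) (hv : bil u v = 0) (hv' : bil u v' = 0) (h : Realizes H (siegel u v))
    (h' : Realizes H (siegel u v')) : Realizes H (siegel u (v + v')) := by
  rw [← siegel_mul hu hv hv']
  exact h.mul h'

theorem Realizes.siegel_neg {H : Subgroup (GL (Fin 8) F)} {u v : Fin 8 → F}
    (hu : QPlus F u = 0) (hv : bil u v = 0) (h : Realizes H (siegel u v)) :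
    Realizes H (siegel u (-v)) := by
  apply h.siegel_cancel hu hv (by rw [bil_neg_right, hv, neg_zero])
  rw [add_neg_cancel, siegel_zero]
  exact Realizes.one

theorem siegel_add_left {u u' v : Fin 8 → F} (hu : QPlus F u = 0) (hu' : QPlus F u' = 0)
    (huu : bil u u' = 0) (huv : bil u v = 0) (huv' : bil u' v = 0) :
    siegel (u + u') v = siegel u v * siegel u' v * siegel u ((QPlus F v) • u') := by
  have e1 : bil u' u = 0 := by rw [bil_comm, huu]
  have e2 : bil v u = 0 := by rw [bil_comm, huv]
  have e4 : bil u u = 0 := by rw [bil_self, hu, mul_zero]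
  have e5 : bil u' u' = 0 := by rw [bil_self, hu', mul_zero]
  refine LinearMap.ext fun x => ?_
  simp only [Module.End.mul_apply, siegel_apply, bil_add_left, bil_sub_left, bil_smul_left,
    bil_add_right, bil_smul_right, QPlus_smul, hu', huu, huv, huv', e1, e2, e4, e5,
    bil_self v]
  module

/-- The scalars `t` for which the long root element `rt i j t` is realized in `H`. -/
def rootScalars (H : Subgroup (GL (Fin 8) F)) (i j : Fin 8) : Set F :=
  {t | Realizes H (rt i j t)}

section RootScalars

variable {H : Subgroup (GL (Fin 8) F)} {i j k : Fin 8} {s t : F}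

theorem zero_mem_rootScalars : (0 : F) ∈ rootScalars H i j := by
  change Realizes H (rt i j 0)
  rw [rt_zero]
  exact Realizes.one

theorem add_mem_rootScalars (h : j ≠ i + 4) (hs : s ∈ rootScalars H i j)
    (ht : t ∈ rootScalars H i j) : s + t ∈ rootScalars H i j := by
  change Realizes H (rt i j (s + t))
  rw [← rt_add i j h]
  exact hs.mul ht

theorem neg_mem_rootScalars (h : j ≠ i + 4) (hs : s ∈ rootScalars H i j) :
    -s ∈ rootScalars H i j := rt_neg_left_inv h hs

theorem rootScalars_swap (h : j ≠ i + 4) (hs : s ∈ rootScalars H i j) :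
    s ∈ rootScalars H j i := by
  have h1 : Realizes H (rt i j (-s)) := neg_mem_rootScalars h hs
  rwa [rt_swap, neg_neg] at h1

theorem mul_mem_rootScalars (hij : j ≠ i + 4) (hik : k ≠ i + 4) (hi : i ≠ j) (hjk : j ≠ k)
    (hjk' : k ≠ j + 4) (hs : s ∈ rootScalars H i j) (ht : t ∈ rootScalars H k (j + 4)) :
    s * t ∈ rootScalars H i k := by
  have hk : j + 4 ≠ k + 4 := fun e => hjk (add_right_cancel e)
  have h1 := Realizes.siegel_conj (f := rt k (j + 4) t) ht (rt_isIso hk t) hs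
  have hki : ¬ k + 4 = i := by
    rintro rfl
    exact hik (add_four_add_four k).symm
  have hkj : ¬ k + 4 = j := by
    rintro rfl
    exact hjk' (add_four_add_four k).symm
  rw [map_smul, rt_ev, rt_ev, if_neg hki, if_neg hkj, add_four_add_four, if_neg hi.symm,
    if_pos rfl] at h1
  simp only [zero_smul, add_zero, sub_zero, smul_add, smul_smul] at h1
  exact Realizes.siegel_cancel (QPlus_ev i) (by rw [bil_smul_right, bil_ev_ev hij, mul_zero])
    (by rw [bil_smul_right, bil_ev_ev hik, mul_zero]) hs h1

/-- The permutation of the basis induced by `yEnd`. -/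
def shift : Fin 8 → Fin 8 := ![1, 2, 0, 3, 5, 6, 4, 7]

theorem yEnd_ev (i : Fin 8) : yEnd F (ev i) = ev (shift i) := by
  have h1 : ∀ k : Fin 8, yEnd F (ev i) k = ev i ((![2, 0, 1, 3, 6, 4, 5, 7] : Fin 8 → Fin 8) k) := by
    intro k
    fin_cases k <;> rfl
  have h2 : ∀ i k : Fin 8, (![2, 0, 1, 3, 6, 4, 5, 7] : Fin 8 → Fin 8) k = i ↔ k = shift i := by
    decide
  funext k
  rw [h1, ev_apply, ev_apply]
  exact if_congr (h2 i k) rfl rfl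

theorem shift_mem_rootScalars (hy : Realizes H (yEnd F)) (hs : s ∈ rootScalars H i j) :
    s ∈ rootScalars H (shift i) (shift j) := by
  have := hy.siegel_conj yEnd_isIso hs
  rwa [map_smul, yEnd_ev, yEnd_ev] at this

end RootScalars

theorem pairs_of_core (P : Fin 8 → Fin 8 → Prop) (sh : ∀ i j, P i j → P (shift i) (shift j))
    (sw : ∀ i j, j ≠ i + 4 → P i j → P j i)
    (mu : ∀ i j k, j ≠ i + 4 → k ≠ i + 4 → i ≠ j → j ≠ k → k ≠ j + 4 → P i j → P k (j + 4) → P i k)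
    (h05 : P 0 5) (h06 : P 0 6) (h45 : P 4 5) (h13 : P 1 3) (h17 : P 1 7) (i j : Fin 8)
    (hij : j ≠ i) (hij' : j ≠ i + 4) : P i j := by
  have h16 : P 1 6 := sh _ _ h05
  have h24 : P 2 4 := sh _ _ h16
  have h14 : P 1 4 := sh _ _ h06
  have h25 : P 2 5 := sh _ _ h14
  have h56 : P 5 6 := sh _ _ h45
  have h64 : P 6 4 := sh _ _ h56
  have h23 : P 2 3 := sh _ _ h13
  have h03 : P 0 3 := sh _ _ h23
  have h27 : P 2 7 := sh _ _ h17
  have h07 : P 0 7 := sh _ _ h27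
  have h12 : P 1 2 := mu 1 3 2 (by decide) (by decide) (by decide) (by decide) (by decide) h13 h27
  have h20 : P 2 0 := sh _ _ h12
  have h01 : P 0 1 := sh _ _ h20
  have h34 : P 3 4 := mu 3 1 4 (by decide) (by decide) (by decide) (by decide) (by decide)
    (sw _ _ (by decide) h13) h45
  have h35 : P 3 5 := sh _ _ h34
  have h36 : P 3 6 := sh _ _ h35
  have h74 : P 7 4 := mu 7 1 4 (by decide) (by decide) (by decide) (by decide) (by decide)
    (sw _ _ (by decide) h17) h45
  have h75 : P 7 5 := sh _ _ h74
  have h76 : P 7 6 := sh _ _ h75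
  fin_cases i <;> fin_cases j <;>
    first
    | exact absurd rfl hij
    | exact absurd rfl hij'
    | assumption
    | exact sw _ _ (by decide) (by assumption)

theorem hasRoots_of_core {H : Subgroup (GL (Fin 8) F)} (hy : Realizes H (yEnd F))
    (h05 : ∀ t, t ∈ rootScalars H 0 5) (h06 : ∀ t, t ∈ rootScalars H 0 6)
    (h45 : ∀ t, t ∈ rootScalars H 4 5) (h13 : ∀ t, t ∈ rootScalars H 1 3)
    (h17 : ∀ t, t ∈ rootScalars H 1 7) : HasRoots H :=
  pairs_of_core (fun i j => ∀ t, t ∈ rootScalars H i j)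
    (fun _ _ h t => shift_mem_rootScalars hy (h t)) (fun _ _ h h' t => rootScalars_swap h (h' t))
    (fun _ _ _ a b c d e h h' t => by
      have := mul_mem_rootScalars a b c d e (h t) (h' 1)
      rwa [mul_one] at this) h05 h06 h45 h13 h17

theorem Realizes.siegel_conj_of_eq {H : Subgroup (GL (Fin 8) F)} {f : Module.End F (Fin 8 → F)}
    (hf : Realizes H f) (hi : IsIso f) {u v u' v' : Fin 8 → F} (h : Realizes H (siegel u v))
    (hu : f u = u') (hv : f v = v') : Realizes H (siegel u' v') := by
  rw [← hu, ← hv]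
  exact hf.siegel_conj hi h

/-- The vectors `v` orthogonal to `ev i` for which `siegel (ev i) v` is realized in `H`. -/
def siegelVectors (H : Subgroup (GL (Fin 8) F)) (i : Fin 8) : AddSubgroup (Fin 8 → F) where
  carrier := {v | v (i + 4) = 0 ∧ Realizes H (siegel (ev i) v)}
  zero_mem' := ⟨rfl, by rw [siegel_zero]; exact Realizes.one⟩
  add_mem' {v w} hv hw := ⟨by simp [hv.1, hw.1], hv.2.siegel_add (QPlus_ev i)
    (by rw [bil_ev_left, hv.1]) (by rw [bil_ev_left, hw.1]) hw.2⟩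
  neg_mem' {v} hv := ⟨by simp [hv.1], hv.2.siegel_neg (QPlus_ev i) (by rw [bil_ev_left, hv.1])⟩

section SiegelVectors

variable {H : Subgroup (GL (Fin 8) F)} {i j k l : Fin 8} {v w : Fin 8 → F} {s t : F}

theorem smul_ev_mem_siegelVectors (h : j ≠ i + 4) (ht : t ∈ rootScalars H i j) :
    t • ev j ∈ siegelVectors H i :=
  ⟨by rw [Pi.smul_apply, ev_apply, if_neg h.symm, smul_zero], ht⟩

theorem mem_rootScalars (h : t • ev j ∈ siegelVectors H i) : t ∈ rootScalars H i j := h.2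

theorem smul_ev_self_mem_siegelVectors : t • ev i ∈ siegelVectors H i := by
  refine ⟨?_, ?_⟩
  · rw [Pi.smul_apply, ev_apply, if_neg, smul_zero]
    intro h
    have := congrArg Fin.val h
    revert this
    fin_cases i <;> decide
  · have := siegel_add_smul_self (QPlus_ev i) (0 : Fin 8 → F) (bil_zero_right _) t
    rw [zero_add, siegel_zero] at this
    rw [this]
    exact Realizes.one

theorem rt_apply_eq (i j : Fin 8) (t : F) (v : Fin 8 → F) :
    rt i j t v = v + (t * v (j + 4)) • ev i - (t * v (i + 4)) • ev j := by
  funext k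
  rw [rt_apply]
  simp only [Pi.add_apply, Pi.sub_apply, Pi.smul_apply, smul_eq_mul, ev_apply]
  split_ifs <;> simp

/-- Commutator of a Siegel element with a root element fixing its singular vector. -/
theorem siegelVectors_comm (hv : v ∈ siegelVectors H i) (hs : s ∈ rootScalars H k l)
    (h : l ≠ k + 4) (h1 : l + 4 ≠ i) (h2 : k + 4 ≠ i) :
    (s * v (l + 4)) • ev k - (s * v (k + 4)) • ev l ∈ siegelVectors H i := by
  have e : rt k l s (ev i) = ev i := by rw [rt_ev, if_neg h1, if_neg h2]; simp
  have hmem : rt k l s v ∈ siegelVectors H i := by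
    refine ⟨?_, Realizes.siegel_conj_of_eq hs (rt_isIso h s) hv.2 e rfl⟩
    have := (rt_isIso h s).bil (ev i) v
    rwa [e, bil_ev_left, bil_ev_left, hv.1] at this
  rw [rt_apply_eq] at hmem
  have := (siegelVectors H i).sub_mem hmem hv
  convert this using 1
  abel

theorem yEnd_mem_siegelVectors (hy : Realizes H (yEnd F)) (hv : v ∈ siegelVectors H i) :
    yEnd F v ∈ siegelVectors H (shift i) := by
  refine ⟨?_, Realizes.siegel_conj_of_eq hy yEnd_isIso hv.2 (yEnd_ev i) rfl⟩
  have := yEnd_isIso.bil (ev i) v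
  rwa [yEnd_ev, bil_ev_left, bil_ev_left, hv.1] at this

/-- Transport of a Siegel element along a root element moving its singular vector. -/
theorem siegelVectors_move (hv : v ∈ siegelVectors H i) (hli : l ≠ i) (hil : l ≠ i + 4)
    (h1 : v i = 0) (h2 : v (l + 4) = 0) (hs : s ∈ rootScalars H (i + 4) l)
    (hc : s * QPlus F v ∈ rootScalars H i l) : s • v ∈ siegelVectors H l := by
  have hl : l ≠ i + 4 + 4 := by rwa [add_four_add_four]
  have hl4 : l + 4 ≠ i := by
    rintro rfl
    exact hil (add_four_add_four l).symm
  have e1 : rt (i + 4) l s (ev i) = ev i + (-s) • ev l := by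
    rw [rt_ev, if_neg hl4, add_four_add_four, if_pos rfl]
    module
  have e2 : rt (i + 4) l s v = v := by
    rw [rt_apply_eq, add_four_add_four, h1, h2]
    simp
  have h3 := Realizes.siegel_conj_of_eq hs (rt_isIso hl s) hv.2 e1 e2
  have hb : bil ((-s) • ev l) v = 0 := by rw [bil_smul_left, bil_ev_left, h2, mul_zero]
  rw [siegel_add_left (QPlus_ev i) (by rw [QPlus_smul, QPlus_ev, mul_zero])
    (by rw [bil_smul_right, bil_ev_ev hil, mul_zero]) (by rw [bil_ev_left, hv.1]) hb] at h3
  have h4 : Realizes H (siegel (ev i) (QPlus F v • (-s) • ev l)) := by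
    have e : QPlus F v • (-s) • (ev l : Fin 8 → F) = (-(s * QPlus F v)) • ev l := by
      rw [smul_smul]
      congr 1
      ring
    rw [e]
    exact neg_mem_rootScalars hil hc
  have h5 := hv.2.of_mul_left (Realizes.of_mul_right h4 h3)
  rw [siegel_smul] at h5
  have h6 : (-s) • v ∈ siegelVectors H l := ⟨by simp [h2], h5⟩
  have := (siegelVectors H l).neg_mem h6
  rwa [neg_smul, neg_neg] at this

end SiegelVectors

section Pair

variable {H : Subgroup (GL (Fin 8) F)} {s t : F}

theorem mul_mem_rootScalars_zero_six (hy : Realizes H (yEnd F)) (hs : s ∈ rootScalars H 0 5)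
    (ht : t ∈ rootScalars H 0 5) : s * t ∈ rootScalars H 0 6 :=
  mul_mem_rootScalars (i := 0) (j := 5) (k := 6) (by decide) (by decide) (by decide) (by decide)
    (by decide) hs (rootScalars_swap (i := 1) (j := 6) (by decide)
      (shift_mem_rootScalars (i := 0) (j := 5) hy ht))

theorem mul_mem_rootScalars_zero_five (hy : Realizes H (yEnd F)) (hs : s ∈ rootScalars H 0 6)
    (ht : t ∈ rootScalars H 0 6) : s * t ∈ rootScalars H 0 5 :=
  mul_mem_rootScalars (i := 0) (j := 6) (k := 5) (by decide) (by decide) (by decide) (by decide)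
    (by decide) hs (rootScalars_swap (i := 2) (j := 5) (by decide)
      (shift_mem_rootScalars (i := 1) (j := 4) hy (shift_mem_rootScalars (i := 0) (j := 6) hy ht)))

end Pair

section OddCore

variable {H : Subgroup (GL (Fin 8) F)} {c d z μ s t : F}

theorem xEnd_image_zero (hx : Realizes H (xEnd 0 c d z)) (hy : Realizes H (yEnd F))
    (hμ : μ ∈ rootScalars H 0 6) :
    μ • (![z, 0, 1, c, 0, 0, -(c * d), d] : Fin 8 → F) ∈ siegelVectors H 5 := by
  have h1 : μ ∈ rootScalars H 1 4 := shift_mem_rootScalars (i := 0) (j := 6) hy hμ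
  have h2 := Realizes.siegel_conj_of_eq hx (xEnd_isIso 0 c d z) h1
    (u' := (-1 : F) • ev 5) (v' := μ • ![z, 0, 1, c, 0, 0, -(c * d), d])
    (by rw [xEnd_apply]; funext k; fin_cases k <;> simp [ev_apply])
    (by rw [map_smul, xEnd_apply]; congr 1; funext k; fin_cases k <;> simp [ev_apply])
  rw [siegel_smul] at h2
  have h3 : (-1 : F) • μ • (![z, 0, 1, c, 0, 0, -(c * d), d] : Fin 8 → F) ∈ siegelVectors H 5 :=
    ⟨by simp, h2⟩
  have := (siegelVectors H 5).neg_mem h3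
  rwa [neg_smul, one_smul, neg_neg] at this

theorem mem_five_of_scalars (hx : Realizes H (xEnd 0 c d z)) (hy : Realizes H (yEnd F))
    (hμ : μ ∈ rootScalars H 0 6) (ht : t ∈ rootScalars H 0 5) :
    (μ * t * z) • (ev 2 : Fin 8 → F) + (μ * t * (c * d)) • ev 4 ∈ siegelVectors H 5 := by
  have h24 : t ∈ rootScalars H 2 4 := shift_mem_rootScalars (i := 1) (j := 6) hy
    (shift_mem_rootScalars (i := 0) (j := 5) hy ht)
  have := siegelVectors_comm (xEnd_image_zero hx hy hμ) h24 (by decide) (by decide) (by decide)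
  convert this using 1
  funext k
  fin_cases k <;> simp [ev_apply] <;> ring

theorem mul_mem_two_five (hx : Realizes H (xEnd 0 c d z)) (hy : Realizes H (yEnd F))
    {s' : F} (hμ : μ ∈ rootScalars H 0 6) (ht : t ∈ rootScalars H 0 5)
    (hs : s ∈ rootScalars H 0 6) (hs' : s' ∈ rootScalars H 0 5) :
    (s' * (μ * t * s * z)) • (ev 2 : Fin 8 → F) ∈ siegelVectors H 5 := by
  have h1 : (μ * t * s * z) • (ev 0 : Fin 8 → F) - (μ * t * s * (c * d)) • ev 6 ∈
      siegelVectors H 5 := by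
    have := siegelVectors_comm (mem_five_of_scalars hx hy hμ ht) hs (by decide) (by decide)
      (by decide)
    convert this using 1
    funext k
    fin_cases k <;> simp [ev_apply] <;> ring
  have h2 : (μ * t * s * z) • (ev 2 : Fin 8 → F) - (μ * t * s * (c * d)) • ev 5 ∈
      siegelVectors H 4 := by
    have := yEnd_mem_siegelVectors hy (yEnd_mem_siegelVectors hy h1)
    simp only [map_sub, map_smul, yEnd_ev] at this
    exact this
  have h3 := siegelVectors_move (i := 4) (l := 5) (s := s') h2 (by decide) (by decide)
    (by simp [ev_apply]) (by simp [ev_apply]) hs' (by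
      have : QPlus F ((μ * t * s * z) • ev 2 - (μ * t * s * (c * d)) • ev 5) = 0 := by
        simp [QPlus, ev_apply]
      rw [this, mul_zero]
      exact zero_mem_rootScalars)
  have h4 := (siegelVectors H 5).add_mem h3
    (smul_ev_self_mem_siegelVectors (t := s' * (μ * t * s * (c * d))))
  convert h4 using 1
  module


/-- A nonzero scalar for the roots joining two of the last four basis vectors. -/
theorem mem_five_four (hx : Realizes H (xEnd 0 c d z)) (hy : Realizes H (yEnd F))
    (hs : s ∈ rootScalars H 0 5) : s ^ 6 * (c * d) ∈ rootScalars H 4 5 := by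
  have hs2 := mul_mem_rootScalars_zero_six hy hs hs
  have hs4 := mul_mem_rootScalars_zero_five hy hs2 hs2
  have h1 := (siegelVectors H 5).sub_mem (mem_five_of_scalars hx hy hs2 hs4)
    (mul_mem_two_five hx hy hs2 hs hs2 hs)
  refine rootScalars_swap (i := 5) (j := 4) (by decide) (mem_rootScalars ?_)
  convert h1 using 1
  module

theorem mem_zero_one (hx : Realizes H (xEnd 0 c d z)) (hy : Realizes H (yEnd F))
    (hs : s ∈ rootScalars H 4 5) : s ∈ rootScalars H 0 1 := by
  have h56 : s ∈ rootScalars H 5 6 := shift_mem_rootScalars (i := 4) (j := 5) hy hs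
  have h := Realizes.siegel_conj_of_eq hx (xEnd_isIso 0 c d z) h56
    (u' := (-1 : F) • ev 1) (v' := s • ev 0)
    (by rw [xEnd_apply]; funext k; fin_cases k <;> simp [ev_apply])
    (by rw [map_smul, xEnd_apply]; congr 1; funext k; fin_cases k <;> simp [ev_apply])
  rw [siegel_smul, smul_smul, neg_one_mul] at h
  have h' : Realizes H (rt 1 0 (-s)) := h
  rwa [rt_swap, neg_neg] at h'

theorem mul_mem_zero_five_of_pair (hx : Realizes H (xEnd 0 c d z)) (hy : Realizes H (yEnd F))
    (hs : s ∈ rootScalars H 4 5) (ht : t ∈ rootScalars H 4 5) : s * t ∈ rootScalars H 0 5 := by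
  have h20 : s ∈ rootScalars H 2 0 := shift_mem_rootScalars (i := 1) (j := 2) hy
    (shift_mem_rootScalars (i := 0) (j := 1) hy (mem_zero_one hx hy hs))
  exact mul_mem_rootScalars (i := 0) (j := 2) (k := 5) (by decide) (by decide) (by decide)
    (by decide) (by decide) (rootScalars_swap (by decide) h20)
    (shift_mem_rootScalars (i := 4) (j := 5) hy ht)

theorem mul_mem_zero_six_of_pair (hx : Realizes H (xEnd 0 c d z)) (hy : Realizes H (yEnd F))
    (hs : s ∈ rootScalars H 4 5) (ht : t ∈ rootScalars H 4 5) : s * t ∈ rootScalars H 0 6 :=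
  mul_mem_rootScalars (i := 0) (j := 1) (k := 6) (by decide) (by decide) (by decide)
    (by decide) (by decide) (mem_zero_one hx hy hs) (rootScalars_swap (i := 5) (j := 6) (by decide)
      (shift_mem_rootScalars (i := 4) (j := 5) hy ht))

theorem one_mem_of_mem_inter [Finite F] (hy : Realizes H (yEnd F)) (h0 : s ≠ 0)
    (h5 : s ∈ rootScalars H 0 5) (h6 : s ∈ rootScalars H 0 6) :
    (1 : F) ∈ rootScalars H 0 5 ∧ (1 : F) ∈ rootScalars H 0 6 := by
  have hp : ∀ n : ℕ, s ^ (n + 1) ∈ rootScalars H 0 5 ∧ s ^ (n + 1) ∈ rootScalars H 0 6 := by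
    intro n
    induction n with
    | zero => simpa using ⟨h5, h6⟩
    | succ n ih =>
      rw [pow_succ]
      exact ⟨mul_mem_rootScalars_zero_five hy ih.2 h6, mul_mem_rootScalars_zero_six hy ih.1 h5⟩
  obtain ⟨n, hn, hn'⟩ := (isOfFinOrder_of_finite (Units.mk0 s h0)).exists_pow_eq_one
  have h1 : s ^ n = 1 := by simpa using congrArg Units.val hn'
  obtain ⟨m, rfl⟩ := Nat.exists_eq_succ_of_ne_zero hn.ne'
  have := hp m
  rwa [h1] at this

theorem scalars_eq_of_one_mem (hy : Realizes H (yEnd F)) (h5 : (1 : F) ∈ rootScalars H 0 5)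
    (h6 : (1 : F) ∈ rootScalars H 0 6) : rootScalars H 0 5 = rootScalars H 0 6 := by
  ext t
  constructor
  · intro h
    simpa using mul_mem_rootScalars_zero_six hy h h5
  · intro h
    simpa using mul_mem_rootScalars_zero_five hy h h6

/-- The common scalar ring of the roots `(0,5)` and `(0,6)`. -/
def scalarRing (hy : Realizes H (yEnd F)) (h5 : (1 : F) ∈ rootScalars H 0 5)
    (h6 : (1 : F) ∈ rootScalars H 0 6) : Subring F where
  carrier := rootScalars H 0 5
  mul_mem' {a b} ha hb := by
    rw [scalars_eq_of_one_mem hy h5 h6]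
    exact mul_mem_rootScalars_zero_six hy ha hb
  one_mem' := h5
  add_mem' ha hb := add_mem_rootScalars (by decide) ha hb
  zero_mem' := zero_mem_rootScalars
  neg_mem' ha := neg_mem_rootScalars (by decide) ha

theorem all_scalars_of_mem (hy : Realizes H (yEnd F)) (h5 : (1 : F) ∈ rootScalars H 0 5)
    (h6 : (1 : F) ∈ rootScalars H 0 6) (hz : z ∈ rootScalars H 0 5)
    (hgen : Subring.closure {z} = ⊤) (t : F) :
    t ∈ rootScalars H 0 5 ∧ t ∈ rootScalars H 0 6 := by
  have h : Subring.closure {z} ≤ scalarRing hy h5 h6 := by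
    rw [Subring.closure_le, Set.singleton_subset_iff]
    exact hz
  rw [hgen] at h
  have h1 : t ∈ rootScalars H 0 5 := h (Subring.mem_top t)
  exact ⟨h1, by rwa [← scalars_eq_of_one_mem hy h5 h6]⟩

theorem hasRoots_of_root_element_odd [Finite F] (hx : Realizes H (xEnd 0 c d z))
    (hy : Realizes H (yEnd F)) (hc : c ≠ 0) (hd : d ≠ 0) (hcd : c ^ 2 ≠ d ^ 2)
    (hgen : Subring.closure {z} = ⊤) (hs0 : s ≠ 0) (hs : s ∈ rootScalars H 0 5) : HasRoots H := by
  have hδ := mem_five_four hx hy hs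
  set δ := s ^ 6 * (c * d) with hδe
  have hδ0 : δ ≠ 0 := by positivity
  obtain ⟨o5, o6⟩ := one_mem_of_mem_inter hy (mul_ne_zero hδ0 hδ0)
    (mul_mem_zero_five_of_pair hx hy hδ hδ) (mul_mem_zero_six_of_pair hx hy hδ hδ)
  have hz : z ∈ rootScalars H 0 5 := by
    rw [scalars_eq_of_one_mem hy o5 o6]
    have h := mul_mem_two_five hx hy o6 o5 o6 o5
    simp only [one_mul] at h
    have h' : z ∈ rootScalars H 2 5 := rootScalars_swap (i := 5) (j := 2) (by decide)
      (mem_rootScalars h)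
    exact shift_mem_rootScalars (i := 2) (j := 5) hy h'
  have hall := all_scalars_of_mem hy o5 o6 hz hgen
  have h05 : ∀ t, t ∈ rootScalars H 0 5 := fun t => (hall t).1
  have h06 : ∀ t, t ∈ rootScalars H 0 6 := fun t => (hall t).2
  have h16 : ∀ t, t ∈ rootScalars H 1 6 := fun t =>
    shift_mem_rootScalars (i := 0) (j := 5) hy (h05 t)
  have h14 : ∀ t, t ∈ rootScalars H 1 4 := fun t =>
    shift_mem_rootScalars (i := 0) (j := 6) hy (h06 t)
  have h25 : ∀ t, t ∈ rootScalars H 2 5 := fun t =>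
    shift_mem_rootScalars (i := 1) (j := 4) hy (h14 t)
  have h45 : ∀ t, t ∈ rootScalars H 4 5 := fun t => by
    have h46 : δ ∈ rootScalars H 4 6 := rootScalars_swap (i := 6) (j := 4) (by decide)
      (shift_mem_rootScalars (i := 5) (j := 6) hy (shift_mem_rootScalars (i := 4) (j := 5) hy hδ))
    have := mul_mem_rootScalars (i := 4) (j := 6) (k := 5) (by decide) (by decide) (by decide)
      (by decide) (by decide) h46 (rootScalars_swap (i := 2) (j := 5) (by decide) (h25 (δ⁻¹ * t)))
    rwa [mul_inv_cancel_left₀ hδ0] at this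
  have h01 : ∀ t, t ∈ rootScalars H 0 1 := fun t => mem_zero_one hx hy (h45 t)
  have h56 : ∀ t, t ∈ rootScalars H 5 6 := fun t =>
    shift_mem_rootScalars (i := 4) (j := 5) hy (h45 t)
  have m5 : ∀ μ : F, (μ * c) • (ev 3 : Fin 8 → F) + (μ * d) • ev 7 ∈ siegelVectors H 5 := by
    intro μ
    have a1 := smul_ev_mem_siegelVectors (by decide)
      (rootScalars_swap (i := 0) (j := 5) (by decide) (h05 (μ * z)))
    have a2 := smul_ev_mem_siegelVectors (by decide)
      (rootScalars_swap (i := 2) (j := 5) (by decide) (h25 μ))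
    have a3 := smul_ev_mem_siegelVectors (i := 5) (j := 6) (by decide) (h56 (-(μ * (c * d))))
    have := (siegelVectors H 5).sub_mem (xEnd_image_zero hx hy (h06 μ))
      ((siegelVectors H 5).add_mem ((siegelVectors H 5).add_mem a1 a2) a3)
    convert this using 1
    funext k
    fin_cases k <;> simp [ev_apply]
  have m4 : ∀ μ : F, (μ * c) • (ev 3 : Fin 8 → F) + (μ * d) • ev 7 ∈ siegelVectors H 4 := by
    intro μ
    have := yEnd_mem_siegelVectors hy (yEnd_mem_siegelVectors hy (m5 μ))
    simp only [map_add, map_smul, yEnd_ev] at this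
    exact this
  have m1 : ∀ μ : F, (μ * c) • (ev 3 : Fin 8 → F) + (μ * d) • ev 7 ∈ siegelVectors H 1 := by
    intro μ
    have := siegelVectors_move (i := 4) (l := 1) (s := 1) (m4 μ) (by decide) (by decide)
      (by simp [ev_apply]) (by simp [ev_apply]) (h01 1)
      (rootScalars_swap (i := 1) (j := 4) (by decide) (h14 _))
    rwa [one_smul] at this
  have m1' : ∀ μ : F, (μ * d) • (ev 3 : Fin 8 → F) + (μ * c) • ev 7 ∈ siegelVectors H 1 := by
    intro μ
    have h := Realizes.siegel_conj_of_eq hx (xEnd_isIso 0 c d z) (m5 μ).2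
      (u' := (-1 : F) • ev 1) (v' := (μ * d) • ev 3 + (μ * c) • ev 7 + (2 * (μ * c * d)) • ev 0
        + (-(μ * (c ^ 2 + d ^ 2))) • ev 6)
      (by rw [xEnd_apply]; funext k; fin_cases k <;> simp [ev_apply])
      (by rw [xEnd_apply]; funext k; fin_cases k <;> simp [ev_apply] <;> ring)
    rw [siegel_smul] at h
    have a0 := smul_ev_mem_siegelVectors (by decide)
      (rootScalars_swap (i := 0) (j := 1) (by decide) (h01 (2 * (μ * c * d))))
    have a6 := smul_ev_mem_siegelVectors (i := 1) (j := 6) (by decide)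
      (h16 (-(μ * (c ^ 2 + d ^ 2))))
    have h' : (-1 : F) • ((μ * d) • ev 3 + (μ * c) • ev 7 + (2 * (μ * c * d)) • ev 0
        + (-(μ * (c ^ 2 + d ^ 2))) • ev 6) ∈ siegelVectors H 1 := ⟨by simp [ev_apply], h⟩
    have := (siegelVectors H 1).neg_mem ((siegelVectors H 1).add_mem h'
      ((siegelVectors H 1).add_mem a0 a6))
    convert this using 1
    module
  have hD : c ^ 2 - d ^ 2 ≠ 0 := sub_ne_zero.mpr hcd
  have h13 : ∀ t, t ∈ rootScalars H 1 3 := fun t => by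
    have := (siegelVectors H 1).sub_mem (m1 (t * c / (c ^ 2 - d ^ 2)))
      (m1' (t * d / (c ^ 2 - d ^ 2)))
    apply mem_rootScalars
    convert this using 1
    have e1 : t = t * c / (c ^ 2 - d ^ 2) * c - t * d / (c ^ 2 - d ^ 2) * d := by
      field_simp
    have e2 : t * c / (c ^ 2 - d ^ 2) * d - t * d / (c ^ 2 - d ^ 2) * c = 0 := by ring
    calc t • (ev 3 : Fin 8 → F) = (t * c / (c ^ 2 - d ^ 2) * c - t * d / (c ^ 2 - d ^ 2) * d) • ev 3
        + (t * c / (c ^ 2 - d ^ 2) * d - t * d / (c ^ 2 - d ^ 2) * c) • ev 7 := by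
          rw [e2, ← e1, zero_smul, add_zero]
      _ = _ := by module
  have h17 : ∀ t, t ∈ rootScalars H 1 7 := fun t => by
    have := (siegelVectors H 1).sub_mem (m1 (t / d)) (smul_ev_mem_siegelVectors (i := 1) (j := 3)
      (by decide) (h13 (t / d * c)))
    apply mem_rootScalars
    convert this using 1
    rw [div_mul_cancel₀ t hd]
    module
  exact hasRoots_of_core hy h05 h06 h45 h13 h17

end OddCore

section QuarticFactor

open Polynomial

/-- The characteristic polynomial of the product of the generators on the section
`ℓ^⊥ / ℓ`, where `ℓ = ⟨ev 0, ev 5⟩`. -/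
noncomputable def quartic (c d : F) : F[X] :=
  X ^ 4 + C (c * d) * X ^ 3 + C (c ^ 2 + d ^ 2 - 2) * X ^ 2 + C (c * d) * X + 1

theorem quartic_coeff_zero (c d : F) : (quartic c d).coeff 0 = 1 := by
  simp [quartic, coeff_zero_eq_eval_zero]

theorem aeval_quartic_apply (f : Module.End F (Fin 8 → F)) (c d : F) (v : Fin 8 → F) :
    aeval f (quartic c d) v = f (f (f (f v))) + (c * d) • f (f (f v)) +
      (c ^ 2 + d ^ 2 - 2) • f (f v) + (c * d) • f v + v := by
  simp only [quartic, map_add, map_mul, aeval_X, aeval_C, map_one, LinearMap.add_apply,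
    Module.End.mul_apply, Module.End.one_apply, Module.algebraMap_end_apply, pow_succ, pow_zero,
    one_mul, mul_smul]

theorem quartic_mem_invLine (b c d z : F) (v : Fin 8 → F) (h1 : v 1 = 0) (h4 : v 4 = 0) :
    aeval (wEnd b c d z) (quartic c d) v ∈ invLine F := by
  rw [aeval_quartic_apply]
  simp only [invLine, Submodule.mem_mk, AddSubmonoid.mem_mk, AddSubsemigroup.mem_mk,
    Set.mem_ofPred_eq, wEnd_apply, Pi.add_apply, Pi.smul_apply, smul_eq_mul]
  simp [h1, h4]
  refine ⟨?_, ?_, ?_, ?_⟩ <;> ring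

theorem aeval_quadratic_quartic_ne_zero (b c d z : F) (hb : b ^ 2 ≠ 2)
    (hK : b ^ 2 + c ^ 2 + d ^ 2 + c ^ 2 * d ^ 2 + 3 * b * c * d + z ^ 2 +
      z * (b ^ 2 - c ^ 2 - d ^ 2) ≠ 0) :
    aeval (wEnd b c d z) ((X ^ 2 - C b * X + 1) * quartic c d) ≠ 0 := by
  intro h
  have h1 := congrFun (LinearMap.congr_fun h (ev 4)) 5
  have h2 : aeval (wEnd b c d z) (X ^ 2 - C b * X + 1) (ev 4) =
      ![b * z + c * d, 0, b, b * c + d, 0, b ^ 2, z - b * c * d - c ^ 2 - d ^ 2, b * d + c] := by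
    simp only [map_add, map_sub, map_mul, aeval_X, aeval_C, map_one, pow_two,
      LinearMap.add_apply, LinearMap.sub_apply, Module.End.mul_apply, Module.End.one_apply,
      Module.algebraMap_end_apply, wEnd_apply]
    funext k
    fin_cases k <;> simp [ev_apply] <;> ring
  rw [mul_comm, map_mul, Module.End.mul_apply, h2, aeval_quartic_apply] at h1
  simp only [wEnd_apply, Pi.add_apply, Pi.smul_apply, smul_eq_mul] at h1
  simp at h1
  refine mul_ne_zero (sub_ne_zero.mpr hb) hK ?_
  linear_combination -h1

theorem isCoprime_X_of_coeff_zero {p : F[X]} (hp : p.coeff 0 = 1) : IsCoprime p X := by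
  obtain ⟨q, hq⟩ := X_dvd_sub_C (p := p)
  refine ⟨1, -q, ?_⟩
  rw [hp, C_1] at hq
  linear_combination hq

theorem isCoprime_of_eq_add {p q r s : F[X]} (h : p = q * r + s) (hs : IsCoprime q s) :
    IsCoprime q p := by
  rw [h, add_comm]
  exact hs.add_mul_left_right r

theorem isCoprime_C_mul {p q : F[X]} {a : F} (ha : a ≠ 0) (h : IsCoprime p q) :
    IsCoprime p (C a * q) :=
  (isCoprime_mul_unit_left_right (isUnit_C.mpr (isUnit_iff_ne_zero.mpr ha)) p q).mpr h

theorem isCoprime_quadratic_quartic {b c d : F}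
    (hG : b ^ 2 + c ^ 2 + d ^ 2 + b * c * d - 4 ≠ 0) :
    IsCoprime (X ^ 2 - C b * X + 1) (quartic c d) := by
  refine isCoprime_of_eq_add (r := X ^ 2 + C (c * d + b) * X + 1)
    (s := C (b ^ 2 + c ^ 2 + d ^ 2 + b * c * d - 4) * X ^ 2) ?_ ?_
  · simp only [quartic, map_add, map_sub, map_mul, map_pow, map_ofNat]
    ring
  · refine isCoprime_C_mul hG (IsCoprime.pow_right ?_)
    exact isCoprime_X_of_coeff_zero (by simp [coeff_zero_eq_eval_zero])

theorem separable_quartic_of_odd {c d : F} (h2 : (2 : F) ≠ 0) (hc : c ^ 2 ≠ 4) (hd : d ^ 2 ≠ 4)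
    (hcd : c ^ 2 ≠ d ^ 2) : (quartic c d).Separable := by
  have h1 : IsCoprime (quartic c d) (X - C 1) := by
    refine IsCoprime.symm (isCoprime_of_eq_add (r := X ^ 3 + C (c * d + 1) * X ^ 2 +
      C (c ^ 2 + d ^ 2 - 1 + c * d) * X + C (c ^ 2 + d ^ 2 - 1 + 2 * (c * d)))
      (s := C ((c + d) ^ 2) * 1) ?_ ?_)
    · simp only [quartic, map_add, map_sub, map_mul, map_pow, map_ofNat, map_one]
      ring
    · refine isCoprime_C_mul (pow_ne_zero 2 fun h => hcd ?_) isCoprime_one_right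
      linear_combination (c - d) * h
  have h1' : IsCoprime (quartic c d) (X + C 1) := by
    refine IsCoprime.symm (isCoprime_of_eq_add (r := X ^ 3 + C (c * d - 1) * X ^ 2 +
      C (c ^ 2 + d ^ 2 - 1 - c * d) * X + C (1 - c ^ 2 - d ^ 2 + 2 * (c * d)))
      (s := C ((c - d) ^ 2) * 1) ?_ ?_)
    · simp only [quartic, map_add, map_sub, map_mul, map_pow, map_ofNat, map_one]
      ring
    · refine isCoprime_C_mul (pow_ne_zero 2 fun h => hcd ?_) isCoprime_one_right
      linear_combination (c + d) * h
  have h3 : IsCoprime (quartic c d) (C 2 * X ^ 2 + C (c * d) * X + C 2) := by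
    have h4 : IsCoprime (C 2 * X ^ 2 + C (c * d) * X + C 2) (C 4 * quartic c d) := by
      refine isCoprime_of_eq_add (r := C 2 * X ^ 2 + C (c * d) * X + C 2)
        (s := C (-((c ^ 2 - 4) * (d ^ 2 - 4))) * X ^ 2) ?_ ?_
      · simp only [quartic, map_add, map_sub, map_mul, map_pow, map_ofNat, map_neg]
        ring
      · refine isCoprime_C_mul (neg_ne_zero.mpr (mul_ne_zero (sub_ne_zero.mpr hc)
          (sub_ne_zero.mpr hd))) (IsCoprime.pow_right ?_)
        refine IsCoprime.symm (isCoprime_of_eq_add (r := C 2 * X + C (c * d)) (s := C 2 * 1) ?_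
          (isCoprime_C_mul h2 isCoprime_one_right))
        ring
    exact (h4.of_isCoprime_of_dvd_right (dvd_mul_left _ _)).symm
  have h5 : X * derivative (quartic c d) =
      quartic c d * C 2 + (X - C 1) * (X + C 1) * (C 2 * X ^ 2 + C (c * d) * X + C 2) := by
    have h6 : derivative (quartic c d) = 4 * X ^ 3 + C (c * d) * (3 * X ^ 2) +
        C (c ^ 2 + d ^ 2 - 2) * (2 * X) + C (c * d) := by
      simp [quartic, -map_sub, -map_mul, -map_pow]
      rw [map_ofNat C 3, map_ofNat C 2]
      ring
    rw [h6]
    simp only [quartic, map_add, map_sub, map_mul, map_pow, map_ofNat, map_one]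
    ring
  have h6 : IsCoprime (quartic c d) (X * derivative (quartic c d)) :=
    isCoprime_of_eq_add h5 ((h1.mul_right h1').mul_right h3)
  exact h6.of_mul_right_right

theorem separable_quadratic_mul_quartic {b c d : F} (ha : (X ^ 2 - C b * X + 1 : F[X]).Separable)
    (hg : (quartic c d).Separable) (hG : b ^ 2 + c ^ 2 + d ^ 2 + b * c * d - 4 ≠ 0) :
    ((X ^ 2 - C b * X + 1) * quartic c d).Separable :=
  ha.mul hg (isCoprime_quadratic_quartic hG)

theorem separable_quadratic_of_odd (h2 : (2 : F) ≠ 0) :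
    (X ^ 2 - C (0 : F) * X + 1 : F[X]).Separable := by
  refine ⟨1, C (-2⁻¹) * X, ?_⟩
  have h3 : (C (-2⁻¹ : F) * 2 : F[X]) = -1 := by
    rw [← map_ofNat C, ← C_mul, neg_mul, inv_mul_cancel₀ h2]; simp
  have h4 : derivative (X ^ 2 - C (0 : F) * X + 1 : F[X]) = 2 * X := by
    simpa [one_add_one_eq_two] using map_ofNat C 2
  rw [h4, C_0]
  linear_combination X ^ 2 * h3

end QuarticFactor

theorem exists_primitive [Finite F] : ∃ γ : F, γ ≠ 0 ∧ ∀ x : F, x ≠ 0 → ∃ n : ℕ, x = γ ^ n := by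
  obtain ⟨g, hg⟩ := IsCyclic.exists_generator (α := Fˣ)
  refine ⟨g, g.ne_zero, fun x hx => ?_⟩
  obtain ⟨n, hn⟩ := (mem_powers_iff_mem_zpowers.mpr (hg (Units.mk0 x hx)))
  exact ⟨n, by simpa using congrArg Units.val hn.symm⟩

theorem closure_eq_top_of_primitive {γ : F} (h : ∀ x : F, x ≠ 0 → ∃ n : ℕ, x = γ ^ n)
    {z : F} (hz : γ ∈ Subring.closure {z}) : Subring.closure {z} = ⊤ := by
  refine eq_top_iff.mpr fun x _ => ?_
  by_cases hx : x = 0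
  · rw [hx]; exact zero_mem _
  · obtain ⟨n, rfl⟩ := h x hx
    exact pow_mem hz n

/-- A monic quadratic is nonzero at some generator of the field. -/
theorem exists_generator_quadratic_ne_zero [Finite F] (h2 : (2 : F) ≠ 0) (p r : F) :
    ∃ z : F, Subring.closure {z} = ⊤ ∧ z ^ 2 + p * z + r ≠ 0 := by
  obtain ⟨γ, -, h⟩ := exists_primitive (F := F)
  have key : ∀ k : ℕ, Subring.closure {γ + k} = ⊤ := fun k =>
    closure_eq_top_of_primitive h (by
      have := sub_mem (Subring.subset_closure (Set.mem_singleton (γ + k)))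
        (natCast_mem (Subring.closure {γ + (k : F)}) k)
      simpa using this)
  by_contra! hcon
  have e0 := hcon _ (key 0)
  have e1 := hcon _ (key 1)
  have e2 := hcon _ (key 2)
  push_cast at e0 e1 e2
  exact h2 (by linear_combination e0 - 2 * e1 + e2)

open Polynomial in
theorem exists_odd_parameters [Fintype F] (hq : 7 ≤ Fintype.card F) :
    ∃ c d : F, c ≠ 0 ∧ d ≠ 0 ∧ c ^ 2 ≠ 4 ∧ d ^ 2 ≠ 4 ∧ c ^ 2 ≠ d ^ 2 ∧ c ^ 2 + d ^ 2 ≠ 4 := by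
  by_cases h7 : Fintype.card F = 7
  · have h : (7 : F) = 0 := by
      have := Nat.cast_card_eq_zero F
      rw [h7] at this
      exact_mod_cast this
    have h1 : (1 : F) ≠ 0 := one_ne_zero
    refine ⟨3, 1, fun e => h1 ?_, h1, fun e => h1 ?_, fun e => h1 ?_, fun e => h1 ?_,
      fun e => h1 ?_⟩
    · linear_combination h - 2 * e
    · linear_combination 3 * e - 2 * h
    · linear_combination 2 * e + h
    · linear_combination e - h
    · linear_combination h - e
  · have h8 : 8 ≤ Fintype.card F := by omega
    obtain ⟨d, hd⟩ := exists_eval_ne_zero_of_natDegree_lt_card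
      (X * (X ^ 2 - C 4) : F[X]) (mul_ne_zero X_ne_zero (X_pow_sub_C_ne_zero two_pos _)) (by
        rw [Cardinal.mk_fintype]
        exact_mod_cast lt_of_le_of_lt (by compute_degree : _ ≤ 3) (by omega))
    obtain ⟨c, hc⟩ := exists_eval_ne_zero_of_natDegree_lt_card
      (X * (X ^ 2 - C 4) * (X ^ 2 - C (d ^ 2)) * (X ^ 2 - C (4 - d ^ 2)) : F[X]) (mul_ne_zero
        (mul_ne_zero (mul_ne_zero X_ne_zero (X_pow_sub_C_ne_zero two_pos _))
          (X_pow_sub_C_ne_zero two_pos _)) (X_pow_sub_C_ne_zero two_pos _)) (by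
        rw [Cardinal.mk_fintype]
        exact_mod_cast lt_of_le_of_lt (by compute_degree : _ ≤ 7) (by omega))
    simp only [eval_mul, eval_X, eval_sub, eval_pow, eval_C, mul_ne_zero_iff, sub_ne_zero] at hc hd
    obtain ⟨⟨⟨c0, c1⟩, c2⟩, c3⟩ := hc
    exact ⟨c, d, c0, hd.1, c1, hd.2, c2, fun e => c3 (by linear_combination e)⟩

theorem generated_of_odd [Fintype F] (h2 : (2 : F) ≠ 0) (hq : 7 ≤ Fintype.card F) :
    IsTwoThreeGenerated ↥(commutator ↥(orthogonalGroupOf F (QPlus F))) := by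
  obtain ⟨c, d, hc, hd, hc4, hd4, hcd, hG⟩ := exists_odd_parameters (F := F) hq
  obtain ⟨z, hz, hK⟩ := exists_generator_quadratic_ne_zero h2 (-c ^ 2 - d ^ 2)
    (c ^ 2 + d ^ 2 + c ^ 2 * d ^ 2)
  obtain ⟨s, hs0, hs⟩ := exists_root_element 0 c d z (quartic c d)
    (quartic_mem_invLine 0 c d z)
    (separable_quadratic_mul_quartic (separable_quadratic_of_odd h2)
      (separable_quartic_of_odd h2 hc4 hd4 hcd)
      (by rw [show (0 : F) ^ 2 + c ^ 2 + d ^ 2 + 0 * c * d - 4 = c ^ 2 + d ^ 2 - 4 by ring]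
          exact sub_ne_zero.mpr hG))
    (by rw [quartic_coeff_zero]; exact one_ne_zero)
    (aeval_quadratic_quartic_ne_zero 0 c d z (by simpa using h2.symm)
      (fun h => hK (by linear_combination h)))
  refine generated_of_hasRoots 0 c d z fun H hx hy => ?_
  exact hasRoots_of_root_element_odd hx hy hc hd hcd hz hs0 (hs H hx hy)

end

section FieldFive

instance : Fact (Nat.Prime 5) := ⟨by norm_num⟩

/-- An involution over the field with five elements, conjugate to `xEnd 0 0 0 0`. -/
def involutionFive : Module.End (ZMod 5) (Fin 8 → ZMod 5) :=
  rt 7 5 1 * rt 0 7 2 * xEnd 0 0 0 0 * (rt 0 7 (-2) * rt 7 5 (-1))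

/-- The coordinates of `involutionFive` and of the powers of `yEnd`, on lists of residues. -/
def residueStep (k : ℕ) : List ℕ → List ℕ
  | [a, b, c, d, e, f, g, h] =>
    match k with
    | 0 => [(3 * b + 4 * e + g + 2 * h) % 5, (4 * d + 4 * f) % 5, e, (4 * b + 2 * e + h) % 5, c,
        (3 * e + 4 * h) % 5, (a + 3 * d) % 5, (3 * c + 4 * f) % 5]
    | 1 => [c, a, b, d, g, e, f, h]
    | _ => [b, c, a, d, f, g, e, h]
  | _ => []

/-- The vector over the field with five elements with the given list of residues. -/
def ofResidues (l : List ℕ) (i : Fin 8) : ZMod 5 := (l.getD i 0 : ℕ)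

/-- Letters of a word in the generators. -/
def letterFive (k : ℕ) : Module.End (ZMod 5) (Fin 8 → ZMod 5) :=
  match k with
  | 0 => involutionFive
  | 1 => yEnd _
  | _ => yEnd _ * yEnd _

theorem involutionFive_apply (v : Fin 8 → ZMod 5) : involutionFive v =
    ![3 * v 1 + 4 * v 4 + v 6 + 2 * v 7, 4 * v 3 + 4 * v 5, v 4, 4 * v 1 + 2 * v 4 + v 7, v 2,
      3 * v 4 + 4 * v 7, v 0 + 3 * v 3, 3 * v 2 + 4 * v 5] := by
  funext k
  simp only [involutionFive, Module.End.mul_apply, rt_apply, xEnd_apply]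
  fin_cases k <;> simp <;> ring_nf <;> reduce_mod_char <;> ring_nf <;> reduce_mod_char

theorem ofResidues_residueStep (k : ℕ) (l : List ℕ) (hl : l.length = 8) :
    ofResidues (residueStep k l) = letterFive k (ofResidues l) ∧
      (residueStep k l).length = 8 := by
  obtain ⟨a, b, c, d, e, f, g, h, rfl⟩ : ∃ a b c d e f g h, l = [a, b, c, d, e, f, g, h] := by
    match l, hl with
    | [a, b, c, d, e, f, g, h], _ => exact ⟨a, b, c, d, e, f, g, h, rfl⟩
  have hm : ∀ n : ℕ, ((n % 5 : ℕ) : ZMod 5) = n := fun n => ZMod.natCast_mod n 5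
  match k with
  | 0 =>
    refine ⟨?_, rfl⟩
    simp only [letterFive, involutionFive_apply]
    funext i
    fin_cases i <;> simp [ofResidues, residueStep, hm]
  | 1 =>
    refine ⟨?_, rfl⟩
    simp only [letterFive, yEnd_apply]
    funext i
    fin_cases i <;> simp [ofResidues, residueStep]
  | k + 2 =>
    refine ⟨?_, rfl⟩
    simp only [letterFive, yEnd_apply, Module.End.mul_apply]
    funext i
    fin_cases i <;> simp [ofResidues, residueStep]

theorem ofResidues_foldr (w l : List ℕ) (hl : l.length = 8) :
    ofResidues (w.foldr residueStep l) = (w.map letterFive).prod (ofResidues l) ∧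
      (w.foldr residueStep l).length = 8 := by
  induction w with
  | nil => simp [hl]
  | cons k w ih =>
    obtain ⟨h1, h2⟩ := ofResidues_residueStep k _ ih.2
    exact ⟨by simp [h1, ih.1], h2⟩

theorem isIso_letterFive (k : ℕ) : IsIso (letterFive k) := by
  match k with
  | 0 =>
    exact (((rt_isIso (by decide) _).mul (rt_isIso (by decide) _)).mul (xEnd_isIso _ _ _ _)).mul
      ((rt_isIso (by decide) _).mul (rt_isIso (by decide) _))
  | 1 => exact yEnd_isIso
  | k + 2 => exact yEnd_isIso.mul yEnd_isIso

variable {H : Subgroup (GL (Fin 8) (ZMod 5))}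

theorem realizes_letterFive (hx : Realizes H involutionFive) (hy : Realizes H (yEnd (ZMod 5)))
    (k : ℕ) : Realizes H (letterFive k) := by
  match k with
  | 0 => exact hx
  | 1 => exact hy
  | k + 2 => exact hy.mul hy

theorem realizes_word (hx : Realizes H involutionFive) (hy : Realizes H (yEnd (ZMod 5)))
    (w : List ℕ) : Realizes H (w.map letterFive).prod ∧ IsIso (w.map letterFive).prod := by
  induction w with
  | nil => exact ⟨by simpa using Realizes.one, fun v => by simp⟩
  | cons k w ih =>
    simp only [List.map_cons, List.prod_cons]
    exact ⟨(realizes_letterFive hx hy k).mul ih.1, (isIso_letterFive k).mul ih.2⟩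

theorem end_ext_ev {f g : Module.End (ZMod 5) (Fin 8 → ZMod 5)} (h : ∀ i, f (ev i) = g (ev i)) :
    f = g := by
  refine (Pi.basisFun (ZMod 5) (Fin 8)).ext fun i => ?_
  have : (Pi.basisFun (ZMod 5) (Fin 8)) i = ev i := by
    funext k
    simp [ev_apply, Pi.single_apply]
  rw [this, h]

theorem realizes_siegel_of_power (hx : Realizes H involutionFive)
    (hy : Realizes H (yEnd (ZMod 5))) :
    Realizes H (siegel (ofResidues [2, 3, 2, 2, 0, 0, 4, 1])
      (ofResidues [0, 4, 3, 2, 4, 2, 0, 1])) := by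
  have h := (realizes_word hx hy ((List.replicate 12 [0, 2, 0, 1, 0, 1]).flatten)).1
  convert h using 1
  refine end_ext_ev fun i => ?_
  have hi : ev i = ofResidues ((List.range 8).map fun k => if k = (i : ℕ) then 1 else 0) := by
    revert i
    decide +kernel
  rw [hi, ← (ofResidues_foldr _ _ (by simp)).1]
  revert i
  decide +kernel

theorem mem_of_path (hx : Realizes H involutionFive) (hy : Realizes H (yEnd (ZMod 5)))
    {i j : Fin 8} {l u' v' : List ℕ} {s : ZMod 5} (hji : j ≠ i + 4) (hs : s ≠ 0)
    (hu : l.foldr residueStep [2, 3, 2, 2, 0, 0, 4, 1] = u')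
    (hv : l.foldr residueStep [0, 4, 3, 2, 4, 2, 0, 1] = v')
    (h : ∀ k, siegel (ofResidues u') (ofResidues v') (ev k) = rt i j s (ev k)) (t : ZMod 5) :
    t ∈ rootScalars H i j := by
  have h1 := realizes_word hx hy l
  have h2 := h1.1.siegel_conj_of_eq h1.2 (realizes_siegel_of_power hx hy)
    (ofResidues_foldr _ _ rfl).1.symm (ofResidues_foldr _ _ rfl).1.symm
  rw [hu, hv, end_ext_ev h] at h2
  have h3 : ∀ n : ℕ, (n : ZMod 5) * s ∈ rootScalars H i j := by
    intro n
    induction n with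
    | zero => simpa using zero_mem_rootScalars
    | succ n ih =>
      rw [Nat.cast_succ, add_mul, one_mul]
      exact add_mem_rootScalars hji ih h2
  have h4 := h3 (t * s⁻¹).val
  rwa [ZMod.natCast_zmod_val, mul_assoc, inv_mul_cancel₀ hs, mul_one] at h4

theorem generated_five : IsTwoThreeGenerated
    ↥(commutator ↥(orthogonalGroupOf (ZMod 5) (QPlus (ZMod 5)))) := by
  have hH := hasRoots_derivedGroup (F := ZMod 5)
  refine generated_of_hasRoots_of_involution (f := involutionFive) ?_ ?_ ?_ fun H hx hy => ?_
  · refine (((realizes_rt hH ?_ ?_ _).mul (realizes_rt hH ?_ ?_ _)).mul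
      (realizes_xEnd 0 0 0 0)).mul ((realizes_rt hH ?_ ?_ _).mul (realizes_rt hH ?_ ?_ _)) <;>
      decide
  · refine end_ext_ev fun i => ?_
    rw [Module.End.mul_apply, involutionFive_apply, involutionFive_apply, Module.End.one_apply]
    revert i
    decide +kernel
  · intro h
    have := congrFun (LinearMap.congr_fun h (ev 0)) 0
    simp [involutionFive_apply, ev_apply] at this
  · refine hasRoots_of_core hy ?_ ?_ ?_ ?_ ?_
    · exact mem_of_path hx hy (i := 0) (j := 5)
        (l := [1, 0, 2, 0, 1, 0, 1, 0, 1, 0, 2, 0, 1, 0, 2, 0, 2, 0, 2, 0, 2, 0, 1, 0, 1, 0, 2, 0, 1,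
      0, 1, 0, 2, 0, 1, 0, 2])
        (u' := [2, 0, 0, 0, 0, 1, 0, 0]) (v' := [2, 0, 0, 0, 0, 0, 0, 0]) (s := 3)
        (by decide) (by decide) (by decide +kernel)
        (by decide +kernel) (by decide +kernel)
    · exact mem_of_path hx hy (i := 0) (j := 6)
        (l := [1, 0, 2, 0, 1, 0, 1, 0, 1, 0, 2, 0, 2, 0, 1, 0, 1, 0, 1, 0, 2, 0, 1, 0, 1, 0, 2, 0, 1,
      0, 2, 0, 1])
        (u' := [0, 0, 0, 0, 0, 0, 1, 0]) (v' := [4, 0, 0, 0, 0, 0, 1, 0]) (s := 1)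
        (by decide) (by decide) (by decide +kernel)
        (by decide +kernel) (by decide +kernel)
    · exact mem_of_path hx hy (i := 4) (j := 5)
        (l := [0, 2, 0, 2, 0, 1, 0, 2, 0, 1, 0, 2, 0, 1, 0, 1, 0, 2, 0, 2, 0, 1, 0, 2, 0, 1, 0, 1, 0,
      1, 0, 1, 0, 1, 0, 2, 0])
        (u' := [0, 0, 0, 0, 2, 2, 0, 0]) (v' := [0, 0, 0, 0, 2, 0, 0, 0]) (s := 1)
        (by decide) (by decide) (by decide +kernel)
        (by decide +kernel) (by decide +kernel)
    · exact mem_of_path hx hy (i := 1) (j := 3)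
        (l := [1, 0, 2, 0, 2, 0, 1, 0, 1, 0, 1, 0, 2, 0, 1, 0, 2, 0, 2, 0, 2, 0, 2, 0, 1, 0, 1, 0, 2,
      0, 1, 0, 1, 0, 2, 0, 1, 0, 2])
        (u' := [0, 2, 0, 3, 0, 0, 0, 0]) (v' := [0, 1, 0, 3, 0, 0, 0, 0]) (s := 3)
        (by decide) (by decide) (by decide +kernel)
        (by decide +kernel) (by decide +kernel)
    · exact mem_of_path hx hy (i := 1) (j := 7)
        (l := [0, 2, 0, 2, 0, 2, 0, 1, 0, 1, 0, 1, 0, 1, 0, 1, 0, 2, 0, 1, 0, 2, 0, 1, 0, 2, 0, 1, 0,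
      1, 0, 2, 0, 2])
        (u' := [0, 4, 0, 0, 0, 0, 0, 0]) (v' := [0, 3, 0, 0, 0, 0, 0, 1]) (s := 4)
        (by decide) (by decide) (by decide +kernel)
        (by decide +kernel) (by decide +kernel)

end FieldFive

theorem _root_.IsTwoThreeGenerated.congr {G G' : Type*} [Group G] [Group G']
    (h : IsTwoThreeGenerated G) (φ : G ≃* G') : IsTwoThreeGenerated G' := by
  obtain ⟨x, y, hx, hy, hxy⟩ := h
  refine ⟨φ x, φ y, ?_, ?_, ?_⟩
  · rwa [MulEquiv.orderOf_eq]
  · rwa [MulEquiv.orderOf_eq]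
  · have : ({φ x, φ y} : Set G') = φ.toMonoidHom '' {x, y} := by simp [Set.image_pair]
    rw [this, ← MonoidHom.map_closure, hxy]
    exact Subgroup.map_top_of_surjective _ φ.surjective

theorem map_commutator_eq {G G' : Type*} [Group G] [Group G'] (φ : G ≃* G') :
    (commutator G).map φ.toMonoidHom = commutator G' := by
  rw [commutator_def, commutator_def, Subgroup.map_commutator,
    Subgroup.map_top_of_surjective _ φ.surjective]

theorem map_orthogonal_le {F K : Type*} [Field F] [Field K] (e : F ≃+* K) {g : GL (Fin 8) F}
    (hg : g ∈ orthogonalGroupOf F (QPlus F)) :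
    Matrix.GeneralLinearGroup.map e.toRingHom g ∈ orthogonalGroupOf K (QPlus K) := by
  have hQ : ∀ v : Fin 8 → F, QPlus K (e ∘ v) = e (QPlus F v) := fun v => by simp [QPlus]
  intro v
  obtain ⟨w, rfl⟩ : ∃ w : Fin 8 → F, e ∘ w = v := ⟨e.symm ∘ v, by funext i; simp⟩
  have h1 : ((Matrix.GeneralLinearGroup.map e.toRingHom g : GL (Fin 8) K) :
      Matrix (Fin 8) (Fin 8) K).mulVec (e ∘ w) =
      e ∘ ((g : Matrix (Fin 8) (Fin 8) F).mulVec w) := by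
    funext i
    simp [Matrix.mulVec, dotProduct]
  rw [h1, hQ, hQ, hg w]

/-- The isomorphism of orthogonal groups induced by an isomorphism of fields. -/
def orthogonalEquiv {F K : Type*} [Field F] [Field K] (e : F ≃+* K) :
    ↥(orthogonalGroupOf F (QPlus F)) ≃* ↥(orthogonalGroupOf K (QPlus K)) where
  toFun g := ⟨Matrix.GeneralLinearGroup.map e.toRingHom g, map_orthogonal_le e g.2⟩
  invFun g := ⟨Matrix.GeneralLinearGroup.map e.symm.toRingHom g, map_orthogonal_le e.symm g.2⟩
  left_inv g := by
    ext i j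
    simp
  right_inv g := by
    ext i j
    simp
  map_mul' g h := by
    ext i j
    simp

theorem isTwoThreeGenerated_of_ringEquiv {F K : Type*} [Field F] [Field K] (e : F ≃+* K)
    (h : IsTwoThreeGenerated ↥(commutator ↥(orthogonalGroupOf F (QPlus F)))) :
    IsTwoThreeGenerated ↥(commutator ↥(orthogonalGroupOf K (QPlus K))) :=
  h.congr (((commutator _).equivMapOfInjective (orthogonalEquiv e).toMonoidHom
    (orthogonalEquiv e).injective).trans
      (MulEquiv.subgroupCongr (map_commutator_eq (orthogonalEquiv e))))

section

variable {F : Type*} [Field F]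

/-- Exchange of two Siegel transformations with orthogonal singular vectors. -/
theorem siegel_exchange {u u' v v' : Fin 8 → F} (hu' : QPlus F u' = 0)
    (huu : bil u u' = 0) (h2 : bil u v' = 0) (h3 : bil u' v = 0)
    (h4 : bil u' v' = 0) :
    siegel u v * siegel u' v' = siegel u' v' * siegel u (v - bil v v' • u') := by
  have e1 : bil u' u = 0 := by rw [bil_comm, huu]
  have e3 : bil v' u = 0 := by rw [bil_comm, h2]
  have e4 : bil v u' = 0 := by rw [bil_comm, h3]
  have e7 : bil u' u' = 0 := by rw [bil_self, hu', mul_zero]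
  have e8 : QPlus F (v - bil v v' • u') = QPlus F v := by
    rw [QPlus_sub, QPlus_smul, hu', bil_smul_right, e4]
    ring
  refine LinearMap.ext fun x => ?_
  simp only [Module.End.mul_apply, siegel_apply, bil_add_left, bil_sub_left, bil_smul_left,
    bil_sub_right, bil_smul_right, e8, h2, h3, h4, huu, e1, e3, e4, e7,
    bil_comm v' v]
  module

section Pair

variable {H : Subgroup (GL (Fin 8) F)} {i j k : Fin 8} {v v' : Fin 8 → F}
  {f : Module.End F (Fin 8 → F)} {a b : F}

/-- The product of a Siegel transformation at `ev i` and a root element commuting with it is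
realized. -/
def RealizesPair (H : Subgroup (GL (Fin 8) F)) (i j k : Fin 8) (v : Fin 8 → F) (a : F) : Prop :=
  v (i + 4) = 0 ∧ v (j + 4) = 0 ∧ v (k + 4) = 0 ∧ Realizes H (siegel (ev i) v * rt j k a)

theorem siegel_mul_rt (h : k ≠ j + 4) (hj : j + 4 ≠ i) (hk : k + 4 ≠ i) (v2 : v (j + 4) = 0)
    (v3 : v (k + 4) = 0) : rt j k a * siegel (ev i) v = siegel (ev i) v * rt j k a := by
  have e : rt j k a (ev i) = ev i := by rw [rt_ev, if_neg hk, if_neg hj]; simp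
  have e' : rt j k a v = v := by rw [rt_apply_eq, v2, v3]; simp
  rw [siegel_conj (rt_isIso h a), e, e']

theorem RealizesPair.add (hv : RealizesPair H i j k v a) (hv' : RealizesPair H i j k v' b)
    (h : k ≠ j + 4) (hj : j + 4 ≠ i) (hk : k + 4 ≠ i) :
    RealizesPair H i j k (v + v') (a + b) := by
  obtain ⟨v1, v2, v3, hv⟩ := hv
  obtain ⟨w1, w2, w3, hw⟩ := hv'
  refine ⟨by simp [v1, w1], by simp [v2, w2], by simp [v3, w3], ?_⟩
  rw [← siegel_mul (QPlus_ev i) (by rw [bil_ev_left, v1]) (by rw [bil_ev_left, w1]),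
    ← rt_add j k h]
  have := hv.mul hw
  rwa [mul_assoc, ← mul_assoc (rt j k a), siegel_mul_rt h hj hk w2 w3, mul_assoc,
    ← mul_assoc] at this

theorem Realizes.conj_pair (hf : Realizes H f) (hi : IsIso f) {u u' : Fin 8 → F}
    {u₁ v₁ u₂ v₂ : Fin 8 → F} (h : Realizes H (siegel u v * siegel u' v'))
    (e1 : f u = u₁) (e2 : f v = v₁) (e3 : f u' = u₂) (e4 : f v' = v₂) :
    Realizes H (siegel u₁ v₁ * siegel u₂ v₂) := by
  have h1 := hf.mul h
  rw [← mul_assoc, OmegaEight.siegel_conj hi, mul_assoc, OmegaEight.siegel_conj hi, ← mul_assoc, e1, e2,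
    e3, e4] at h1
  exact hf.of_mul_right h1

theorem RealizesPair.shift (hy : Realizes H (yEnd F)) (h : RealizesPair H i j k v a) :
    RealizesPair H (shift i) (shift j) (shift k) (yEnd F v) a := by
  have key : ∀ l : Fin 8, v (l + 4) = 0 → yEnd F v (OmegaEight.shift l + 4) = 0 := fun l hl => by
    have := yEnd_isIso.bil (ev l) v
    rwa [yEnd_ev, bil_ev_left, bil_ev_left, hl] at this
  exact ⟨key _ h.1, key _ h.2.1, key _ h.2.2.1, hy.conj_pair yEnd_isIso h.2.2.2 (yEnd_ev i) rfl
    (yEnd_ev j) (by rw [map_smul, yEnd_ev])⟩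

theorem Realizes.cancel_right (h : Realizes H (f * siegel (ev i) v')) (hv : v (i + 4) = 0)
    (hd : v' - v ∈ siegelVectors H i) : Realizes H (f * siegel (ev i) v) := by
  apply hd.2.of_mul_right
  rw [mul_assoc, siegel_mul (QPlus_ev i) (by rw [bil_ev_left, hv]) (by rw [bil_ev_left, hd.1])]
  rwa [add_sub_cancel]

theorem Realizes.cancel_left (h : Realizes H (siegel (ev i) v' * f)) (hv : v (i + 4) = 0)
    (hd : v' - v ∈ siegelVectors H i) : Realizes H (siegel (ev i) v * f) := by
  apply hd.2.of_mul_left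
  rw [← mul_assoc, siegel_mul (QPlus_ev i) (by rw [bil_ev_left, hd.1]) (by rw [bil_ev_left, hv])]
  rwa [sub_add_cancel]

/-- The root scalars `(i, j)` and `(i, k)` being full, combinations of `ev j`, `ev k` and `ev i`
are Siegel vectors. -/
theorem mem_siegelVectors_of_full {i j k : Fin 8} (hj : j ≠ i + 4) (hk : k ≠ i + 4)
    (h : ∀ t, t ∈ rootScalars H i j) (h' : ∀ t, t ∈ rootScalars H i k) {v : Fin 8 → F}
    (a b e : F) (hv : v = a • ev j + b • ev k + e • ev i) : v ∈ siegelVectors H i := by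
  rw [hv]
  exact add_mem (add_mem (smul_ev_mem_siegelVectors hj (h a))
    (smul_ev_mem_siegelVectors hk (h' b))) smul_ev_self_mem_siegelVectors

/-- The multiples of a vector in the fourth hyperbolic plane. -/
def midVec (c d t : F) : Fin 8 → F := ![0, 0, 0, t * c, 0, 0, 0, t * d]

theorem midVec_apply (c d t : F) (k : Fin 8) :
    midVec c d t k = if k = 3 then t * c else if k = 7 then t * d else 0 := by
  fin_cases k <;> rfl

theorem midVec_add (c d s t : F) : midVec c d s + midVec c d t = midVec c d (s + t) := by
  funext k; fin_cases k <;> simp [midVec] <;> ring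

theorem yEnd_midVec (c d t : F) : yEnd F (midVec c d t) = midVec c d t := by
  rw [yEnd_apply]; funext k; fin_cases k <;> simp [midVec]

/-- A Siegel transformation and a root element at a common totally singular space. -/
def mixedPair (c d t : F) : Module.End F (Fin 8 → F) := siegel (ev 5) (midVec c d t) * rt 0 2 t

theorem mixedPair_mul (c d s t : F) : mixedPair c d s * mixedPair c d t =
    mixedPair c d (s + t) := by
  rw [mixedPair, mixedPair, mixedPair, mul_assoc, ← mul_assoc (rt 0 2 s), siegel_mul_rt (by decide)
    (by decide) (by decide) (by simp [midVec_apply]) (by simp [midVec_apply]), mul_assoc, ← mul_assoc,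
    siegel_mul (QPlus_ev 5) (by simp [bil_ev_left, midVec_apply]) (by simp [bil_ev_left, midVec_apply]),
    rt_add _ _ (by decide), midVec_add]

end Pair

section Even

variable [CharP F 2] {H : Subgroup (GL (Fin 8) F)} {c d z r s t : F}

theorem siegel_swap_even {u v : Fin 8 → F} (hu : QPlus F u = 0) (hv : QPlus F v = 0) :
    siegel u v = siegel v u := by
  rw [siegel_swap hu hv]
  congr 1
  funext k
  exact CharTwo.neg_eq _

theorem realizes_image_root (hx : Realizes H (xEnd 1 c d z)) (hy : Realizes H (yEnd F))
    (ht : t ∈ rootScalars H 0 6) :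
    Realizes H (siegel (ev 0 + ev 5) ![t * z, 0, t, t * c, 0, t, t * (c * d), t * d]) := by
  have h : t ∈ rootScalars H 1 4 := shift_mem_rootScalars (i := 0) (j := 6) hy ht
  refine Realizes.siegel_conj_of_eq hx (xEnd_isIso 1 c d z) h ?_ ?_
  · rw [xEnd_apply]; funext k; fin_cases k <;> simp [ev_apply, CharTwo.neg_eq]
  · rw [map_smul, xEnd_apply]; funext k; fin_cases k <;> simp [ev_apply, CharTwo.neg_eq]

theorem realizes_image_pair (hx : Realizes H (xEnd 1 c d z)) (hy : Realizes H (yEnd F))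
    (h05 : ∀ t, t ∈ rootScalars H 0 5) (h06 : ∀ t, t ∈ rootScalars H 0 6) (t : F) :
    Realizes H (siegel (ev 0) ![0, 0, t, t * c, 0, 0, 0, t * d] *
      siegel (ev 5) ![0, 0, 0, t * c, 0, 0, t * (c * d), t * d]) := by
  have h2 : (2 : F) = 0 := CharTwo.two_eq_zero
  have h := realizes_image_root hx hy (h06 t)
  rw [siegel_add_left (QPlus_ev 0) (QPlus_ev 5) (bil_ev_ev (by decide))
    (by simp [bil_ev_left]) (by simp [bil_ev_left])] at h
  have e : QPlus F ![t * z, 0, t, t * c, 0, t, t * (c * d), t * d] = 0 := by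
    simp [QPlus]
    linear_combination (t ^ 2 * c * d) * h2
  rw [e, zero_smul, siegel_zero, mul_one] at h
  refine Realizes.cancel_right (Realizes.cancel_left h (by simp) ?_) (by simp) ?_
  · refine mem_siegelVectors_of_full (by decide) (by decide) h05 h06 t (t * (c * d)) (t * z) ?_
    funext k; fin_cases k <;> simp [ev_apply]
  · refine mem_siegelVectors_of_full (i := 5) (j := 0) (k := 2) (by decide) (by decide)
      (fun t => rootScalars_swap (by decide) (h05 t)) (fun t => rootScalars_swap (by decide)
        (shift_mem_rootScalars (i := 1) (j := 4) hy (shift_mem_rootScalars (i := 0) (j := 6) hy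
          (h06 t)))) (t * z) t t ?_
    funext k; fin_cases k <;> simp [ev_apply]

theorem siegel_midVec_exchange (i j : Fin 8) (hij : j ≠ i + 4)
    (hi : midVec c d t (i + 4) = 0) (hj : midVec c d s (j + 4) = 0)
    (hj' : midVec c d t (j + 4) = 0) :
    siegel (ev i) (midVec c d s) * siegel (ev j) (midVec c d t) =
      siegel (ev j) (midVec c d t) * siegel (ev i) (midVec c d s) := by
  have h2 : (2 : F) = 0 := CharTwo.two_eq_zero
  have e : bil (midVec c d s) (midVec c d t) = 0 := by
    simp [bil, midVec_apply]
    linear_combination (s * t * c * d) * h2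
  rw [siegel_exchange (QPlus_ev j) (bil_ev_ev hij) (by rw [bil_ev_left, hi])
    (by rw [bil_ev_left, hj]) (by rw [bil_ev_left, hj']), e, zero_smul, sub_zero]

theorem siegel_image_root (r s : F) :
    siegel (ev 0 + r • ev 2) ![0, 0, s, s * c, 0, 0, 0, s * d] =
      siegel (ev 2) (midVec c d (r * s)) * rt 0 2 (r * s ^ 2 * (c * d)) *
        siegel (ev 0) ![0, 0, s, s * c, 0, 0, 0, s * d] := by
  have h2 : (2 : F) = 0 := CharTwo.two_eq_zero
  set V : Fin 8 → F := ![0, 0, s, s * c, 0, 0, 0, s * d] with hV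
  have e0 : bil (ev 0) V = 0 := by simp [bil_ev_left, hV]
  have e2 : bil (ev 2) V = 0 := by simp [bil_ev_left, hV]
  have eb : bil V (r • V) = 0 := by rw [bil_smul_right, bil_self, h2]; simp
  have eQ : QPlus F V = s ^ 2 * (c * d) := by simp [QPlus, hV]; ring
  have em : r • V = midVec c d (r * s) + (r * s) • ev 2 := by
    funext k; fin_cases k <;> simp [ev_apply, hV, midVec_apply] <;> ring
  rw [siegel_add_left (QPlus_ev 0) (by rw [QPlus_smul, QPlus_ev, mul_zero])
    (by rw [bil_smul_right, bil_ev_ev (by decide), mul_zero]) e0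
    (by rw [bil_smul_left, e2, mul_zero]), siegel_smul, eQ,
    siegel_exchange (QPlus_ev 2) (bil_ev_ev (by decide)) (by rw [bil_smul_right, e0, mul_zero]) e2
    (by rw [bil_smul_right, e2, mul_zero]), eb, zero_smul, sub_zero, mul_assoc, mul_assoc,
    siegel_mul (QPlus_ev 0) e0 (by simp [bil_ev_left, ev_apply]), rt,
    siegel_mul (QPlus_ev 0) (by simp [bil_ev_left, ev_apply]) e0, em,
    siegel_add_smul_self (QPlus_ev 2) _ (by simp [bil_ev_left, midVec_apply])]
  congr 2
  module

theorem realizes_mixed (hx : Realizes H (xEnd 1 c d z)) (hy : Realizes H (yEnd F))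
    (h05 : ∀ t, t ∈ rootScalars H 0 5) (h06 : ∀ t, t ∈ rootScalars H 0 6) (r s : F) :
    Realizes H (siegel (ev 2) (midVec c d (r * s)) *
      (siegel (ev 5) (midVec c d (r * s ^ 2 * (c * d))) * rt 0 2 (r * s ^ 2 * (c * d))) *
      rt 5 4 (r * s * (c * d))) := by
  have h2 : (2 : F) = 0 := CharTwo.two_eq_zero
  have hR := realizes_image_pair hx hy h05 h06 s
  have h24 : Realizes H (rt 2 4 r) := shift_mem_rootScalars (i := 1) (j := 6) hy
    (shift_mem_rootScalars (i := 0) (j := 5) hy (h05 r))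
  set V : Fin 8 → F := ![0, 0, s, s * c, 0, 0, 0, s * d] with hV
  set V' : Fin 8 → F := ![0, 0, 0, s * c, 0, 0, s * (c * d), s * d] with hV'
  set k := r * s * (c * d) with hk
  have h := Realizes.conj_pair h24 (rt_isIso (by decide) r) hR (u₁ := ev 0 + r • ev 2) (v₁ := V)
    (u₂ := ev 5) (v₂ := V' + k • ev 4)
    (by rw [rt_ev]; simp) (by rw [rt_apply_eq]; simp [hV])
    (by rw [rt_ev]; simp) (by
      rw [rt_apply_eq]; funext l
      fin_cases l <;> simp [hV', ev_apply, CharTwo.sub_eq_add, hk]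
      ring)
  have e5 : bil (ev 5) V' = 0 := by simp [bil_ev_left, hV']
  rw [siegel_image_root, ← siegel_mul (QPlus_ev 5) e5 (by simp [bil_ev_left, ev_apply]),
    mul_assoc, ← mul_assoc (siegel (ev 0) V)] at h
  have hi : IsIso (siegel (ev 0) V * siegel (ev 5) V') :=
    (siegel_isIso (QPlus_ev 0) (by simp [bil_ev_left, hV])).mul (siegel_isIso (QPlus_ev 5) e5)
  rw [siegel_conj hi, ← mul_assoc] at h
  have h := hR.of_mul_right h
  have a1 : (siegel (ev 0) V * siegel (ev 5) V') (ev 5) = ev 5 := by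
    rw [Module.End.mul_apply, siegel_apply_of_orthogonal (bil_ev_ev (by decide)) e5,
      siegel_apply_of_orthogonal (bil_ev_ev (by decide)) (by simp [bil_ev_left, hV])]
  have a2 : (siegel (ev 0) V * siegel (ev 5) V') (ev 4) = ev 4 - V - (s ^ 2 * (c * d)) • ev 0 := by
    rw [Module.End.mul_apply, siegel_apply_of_orthogonal (bil_ev_ev (by decide))
      (by simp [bil_ev_left, hV'])]
    have eQ : QPlus F V = s ^ 2 * (c * d) := by simp [QPlus, hV]; ring
    rw [siegel_apply, eQ]
    simp [bil_ev_left, ev_apply, hV]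
  rw [a1, map_smul, a2] at h
  have h := Realizes.cancel_right h (v := midVec c d (r * s ^ 2 * (c * d)) + k • ev 4)
    (by simp [midVec_apply, ev_apply])
    (mem_siegelVectors_of_full (i := 5) (j := 0) (k := 2) (by decide) (by decide)
      (fun t => rootScalars_swap (by decide) (h05 t)) (fun t => rootScalars_swap (by decide)
        (shift_mem_rootScalars (i := 1) (j := 4) hy (shift_mem_rootScalars (i := 0) (j := 6) hy
          (h06 t)))) (k * (s ^ 2 * (c * d))) (k * s) 0 (by
      funext l
      simp only [Pi.add_apply, Pi.sub_apply, Pi.smul_apply, smul_eq_mul, ev_apply, hV, midVec_apply,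
        CharTwo.sub_eq_add, hk]
      fin_cases l <;> simp <;> grind))
  rw [← siegel_mul (QPlus_ev 5) (by simp [bil_ev_left, midVec_apply])
    (by simp [bil_ev_left, ev_apply])] at h
  convert h using 1
  rw [← siegel_mul_rt (by decide) (by decide) (by decide) (by simp [midVec_apply]) (by simp [midVec_apply])]
  simp only [mul_assoc]
  rfl

theorem siegel_mul_mixedPair (s t : F) : siegel (ev 2) (midVec c d s) * mixedPair c d t =
    mixedPair c d t * siegel (ev 2) (midVec c d s) := by
  rw [mixedPair, ← mul_assoc, siegel_midVec_exchange 2 5 (by decide) (by simp [midVec_apply])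
    (by simp [midVec_apply]) (by simp [midVec_apply]), mul_assoc, mul_assoc, siegel_mul_rt (by decide)
    (by decide) (by decide) (by simp [midVec_apply]) (by simp [midVec_apply])]

theorem realizes_mixedPair (hx : Realizes H (xEnd 1 c d z)) (hy : Realizes H (yEnd F))
    (h05 : ∀ t, t ∈ rootScalars H 0 5) (h06 : ∀ t, t ∈ rootScalars H 0 6) (hcd : c * d ≠ 0)
    (hs0 : s ≠ 0) (hs1 : s ≠ 1) (t : F) : Realizes H (mixedPair c d t) := by
  have hs : s - 1 ≠ 0 := sub_ne_zero.mpr hs1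
  obtain ⟨hc, hd⟩ := mul_ne_zero_iff.mp hcd
  set r := t / ((s - 1) * (c * d)) with hr
  have h1 := realizes_mixed hx hy h05 h06 r 1
  have h2 := realizes_mixed hx hy h05 h06 (r / s) s
  have e1 : r / s * s = r := div_mul_cancel₀ r hs0
  have e2 : r / s * s ^ 2 * (c * d) = t + r * (c * d) := by rw [hr]; field_simp; ring
  simp only [one_pow, mul_one] at h1
  rw [e1, e2] at h2
  change Realizes H (_ * mixedPair c d _ * _) at h1 h2
  rw [← mixedPair_mul, ← mul_assoc, siegel_mul_mixedPair, mul_assoc, mul_assoc] at h2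
  rw [mul_assoc] at h1
  exact h1.of_mul_right h2

theorem realizesPair_two (hx : Realizes H (xEnd 1 c d z)) (hy : Realizes H (yEnd F))
    (h05 : ∀ t, t ∈ rootScalars H 0 5) (h06 : ∀ t, t ∈ rootScalars H 0 6) (hcd : c * d ≠ 0)
    (hs0 : s ≠ 0) (hs1 : s ≠ 1) (t : F) :
    RealizesPair H 2 4 5 (midVec c d t) (t * (c * d)) := by
  refine ⟨by simp [midVec_apply], by simp [midVec_apply], by simp [midVec_apply], ?_⟩
  have h1 := realizes_mixed hx hy h05 h06 t 1
  simp only [one_pow, mul_one] at h1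
  change Realizes H (_ * mixedPair c d _ * _) at h1
  rw [siegel_mul_mixedPair, mul_assoc] at h1
  rw [rt_swap, CharTwo.neg_eq]
  exact (realizes_mixedPair hx hy h05 h06 hcd hs0 hs1 _).of_mul_left h1

theorem xEnd_midVec (c d z t : F) :
    xEnd 1 c d z (midVec c d t) = midVec d c t + (t * (c ^ 2 + d ^ 2)) • ev 6 := by
  have h2 : (2 : F) = 0 := CharTwo.two_eq_zero
  rw [xEnd_apply]; funext k
  simp only [Pi.add_apply, Pi.smul_apply, smul_eq_mul, ev_apply]
  fin_cases k <;> simp [midVec_apply] <;> grind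

theorem realizesPair_one_bar (hx : Realizes H (xEnd 1 c d z)) (hy : Realizes H (yEnd F))
    (h05 : ∀ t, t ∈ rootScalars H 0 5) (h06 : ∀ t, t ∈ rootScalars H 0 6)
    (hm : Realizes H (mixedPair c d t)) : RealizesPair H 2 4 5 (midVec d c t) t := by
  have h2 : (2 : F) = 0 := CharTwo.two_eq_zero
  have h16 : ∀ t, t ∈ rootScalars H 1 6 := fun t =>
    shift_mem_rootScalars (i := 0) (j := 5) hy (h05 t)
  suffices h : RealizesPair H 1 6 4 (midVec d c t) t by
    have := h.shift hy
    rwa [yEnd_midVec] at this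
  refine ⟨by simp [midVec_apply], by simp [midVec_apply], by simp [midVec_apply], ?_⟩
  have h := hx.conj_pair (xEnd_isIso 1 c d z) hm (u₁ := ev 1 + ev 6)
    (u₂ := ev 6) (v₂ := ![t * (c * d), t, 0, t * d, t, 0, t * (c ^ 2 + d ^ 2 - 1 - z), t * c])
    (by rw [xEnd_apply]; funext k; fin_cases k <;> simp [ev_apply, CharTwo.neg_eq])
    (xEnd_midVec c d z t)
    (by rw [xEnd_apply]; funext k; fin_cases k <;> simp [ev_apply])
    (by rw [map_smul, xEnd_apply]; funext k; fin_cases k <;> simp [ev_apply, CharTwo.neg_eq])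
  rw [siegel_add_left (QPlus_ev 1) (QPlus_ev 6) (bil_ev_ev (by decide))
    (by simp [bil_ev_left, midVec_apply, ev_apply]) (by simp [bil_ev_left, midVec_apply, ev_apply]),
    siegel_swap_even (v := QPlus F _ • ev 6) (QPlus_ev 1) (by rw [QPlus_smul, QPlus_ev, mul_zero]),
    siegel_smul,
    mul_assoc, mul_assoc,
    siegel_mul (QPlus_ev 6) (by simp [bil_ev_left, ev_apply]) (by simp [bil_ev_left]),
    siegel_mul (QPlus_ev 6) (by simp [bil_ev_left, midVec_apply, ev_apply])
      (by rw [bil_add_right, bil_smul_right, bil_ev_ev (by decide)]; simp [bil_ev_left])] at h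
  refine Realizes.cancel_right (Realizes.cancel_left h (by simp [midVec_apply]) ?_) (by simp [ev_apply]) ?_
  · rw [add_sub_cancel_left]
    exact smul_ev_mem_siegelVectors (by decide) (h16 _)
  · set q := QPlus F (midVec d c t + (t * (c ^ 2 + d ^ 2)) • ev 6)
    refine mem_siegelVectors_of_full (i := 6) (j := 0) (k := 1) (by decide) (by decide)
      (fun t => rootScalars_swap (by decide) (h06 t)) (fun t => rootScalars_swap (by decide)
        (h16 t)) (t * (c * d)) (t + q) (t * (-1 - z)) ?_
    funext l
    simp only [Pi.add_apply, Pi.sub_apply, Pi.smul_apply, smul_eq_mul, ev_apply, midVec_apply]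
    fin_cases l <;> simp <;> grind

theorem realizesPair_four_bar (hx : Realizes H (xEnd 1 c d z)) (hy : Realizes H (yEnd F))
    (h06 : ∀ t, t ∈ rootScalars H 0 6)
    (hB : RealizesPair H 2 4 5 (midVec c d t) (t * (c * d))) :
    RealizesPair H 4 2 1 (midVec d c t) (t * (c * d)) := by
  suffices h : RealizesPair H 6 1 0 (midVec d c t) (t * (c * d)) by
    have := h.shift hy
    rwa [yEnd_midVec] at this
  have hB' : RealizesPair H 0 5 6 (midVec c d t) (t * (c * d)) := by
    have := hB.shift hy
    rwa [yEnd_midVec] at this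
  refine ⟨by simp [midVec_apply], by simp [midVec_apply], by simp [midVec_apply], ?_⟩
  have h := hx.conj_pair (xEnd_isIso 1 c d z) hB'.2.2.2 (u₁ := ev 6) (u₂ := ev 1 + ev 6)
    (v₂ := (t * (c * d)) • ev 0)
    (by rw [xEnd_apply]; funext k; fin_cases k <;> simp [ev_apply])
    (xEnd_midVec c d z t)
    (by rw [xEnd_apply]; funext k; fin_cases k <;> simp [ev_apply, CharTwo.neg_eq])
    (by rw [map_smul, xEnd_apply]; congr 1; funext k; fin_cases k <;> simp [ev_apply])
  rw [siegel_add_left (QPlus_ev 1) (QPlus_ev 6) (bil_ev_ev (by decide))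
    (by simp [bil_ev_left, ev_apply]) (by simp [bil_ev_left, ev_apply]), QPlus_smul, QPlus_ev,
    mul_zero, zero_smul, siegel_zero, mul_one,
    siegel_add_smul_self (QPlus_ev 6) _ (by simp [bil_ev_left, midVec_apply]), ← mul_assoc] at h
  exact Realizes.of_mul_right (rootScalars_swap (i := 0) (j := 6) (by decide) (h06 _)) h

end Even

section Even

variable [CharP F 2] {H : Subgroup (GL (Fin 8) F)} {c d z s t : F}

theorem rt_mul_self {i j : Fin 8} (h : j ≠ i + 4) (t : F) : rt i j t * rt i j t = 1 := by
  rw [rt_add i j h, CharTwo.add_self_eq_zero, rt_zero]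

theorem rt_comm {i j : Fin 8} (t : F) : rt i j t = rt j i t := by
  rw [rt_swap, CharTwo.neg_eq]

theorem conjugator_apply (c d : F) (v : Fin 8 → F) :
    (siegel (ev 4) (midVec d c 1) * rt 2 1 (c * d)) v =
      v + (c * d * v 5) • ev 2 + (c * d * v 6) • ev 1 +
        (v 7 * d + v 3 * c - c * d * v 0) • ev 4 - v 0 • midVec d c 1 := by
  have h2 : (2 : F) = 0 := CharTwo.two_eq_zero
  rw [Module.End.mul_apply, rt_apply_eq, siegel_apply]
  funext k
  simp only [Pi.add_apply, Pi.sub_apply, Pi.smul_apply, smul_eq_mul, ev_apply, midVec_apply, bil,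
    QPlus]
  fin_cases k <;> simp <;> grind

theorem realizesPair_conjugate (h05 : ∀ t, t ∈ rootScalars H 0 5)
    (h06 : ∀ t, t ∈ rootScalars H 0 6) (hy : Realizes H (yEnd F))
    (hm : Realizes H (mixedPair c d t))
    (hD : RealizesPair H 4 2 1 (midVec d c 1) (1 * (c * d))) :
    RealizesPair H 2 4 5 (midVec c d (c * d * t) + midVec d c t) (t * (c ^ 2 + d ^ 2)) := by
  have h2 : (2 : F) = 0 := CharTwo.two_eq_zero
  have h24 : ∀ t, t ∈ rootScalars H 2 4 := fun t => shift_mem_rootScalars (i := 1) (j := 6) hy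
    (shift_mem_rootScalars (i := 0) (j := 5) hy (h05 t))
  have h25 : ∀ t, t ∈ rootScalars H 2 5 := fun t => shift_mem_rootScalars (i := 1) (j := 4) hy
    (shift_mem_rootScalars (i := 0) (j := 6) hy (h06 t))
  refine ⟨by simp [midVec_apply], by simp [midVec_apply], by simp [midVec_apply], ?_⟩
  have hg := hD.2.2.2
  rw [one_mul] at hg
  have hi : IsIso (siegel (ev 4) (midVec d c 1) * rt 2 1 (c * d)) :=
    (siegel_isIso (QPlus_ev 4) (by simp [bil_ev_left, midVec_apply])).mul
      (rt_isIso (by decide) _)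
  set V := midVec c d t + (t * (c ^ 2 + d ^ 2)) • (ev 4 : Fin 8 → F) with hV
  set U := (ev 0 : Fin 8 → F) + midVec d c 1 + (c * d) • (ev 4 : Fin 8 → F) with hU
  have h := hg.conj_pair hi hm (u₁ := ev 5 + (c * d) • ev 2) (v₁ := V) (u₂ := U) (v₂ := t • ev 2)
    (by rw [conjugator_apply]; simp [ev_apply])
    (by
      rw [conjugator_apply, hV]; funext k
      simp only [Pi.add_apply, Pi.sub_apply, Pi.smul_apply, smul_eq_mul, ev_apply, midVec_apply]
      fin_cases k <;> simp <;> grind)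
    (by
      rw [conjugator_apply, hU]; funext k
      simp only [Pi.add_apply, Pi.sub_apply, Pi.smul_apply, smul_eq_mul, ev_apply, midVec_apply]
      fin_cases k <;> simp <;> grind)
    (by rw [conjugator_apply]; simp [ev_apply])
  have v5 : bil (ev 5) V = 0 := by simp [hV, bil_ev_left, midVec_apply, ev_apply]
  have v2 : bil (ev 2) V = 0 := by simp [hV, bil_ev_left, midVec_apply, ev_apply]
  have u2 : bil (ev 2) U = 0 := by simp [hU, bil_ev_left, midVec_apply, ev_apply]
  have qU : QPlus F U = 0 := by simp [hU, QPlus, midVec_apply, ev_apply]; grind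
  set q := QPlus F V with hq
  rw [siegel_add_left (QPlus_ev 5) (by rw [QPlus_smul, QPlus_ev, mul_zero])
    (by rw [bil_smul_right, bil_ev_ev (by decide), mul_zero]) v5
    (by rw [bil_smul_left, v2, mul_zero]), siegel_smul, ← hq, smul_smul,
    siegel_swap_even (v := (q * (c * d)) • ev 2) (QPlus_ev 5) (by
      rw [QPlus_smul, QPlus_ev, mul_zero]), siegel_smul,
    siegel_swap_even (u := U) qU (by
      rw [QPlus_smul, QPlus_ev, mul_zero]), siegel_smul, mul_assoc,
    mul_assoc, siegel_mul (QPlus_ev 2) (by simp [bil_ev_left, ev_apply])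
      (by rw [bil_smul_right, u2, mul_zero]), siegel_mul (QPlus_ev 2)
      (by rw [bil_smul_right, v2, mul_zero])
      (by rw [bil_add_right, bil_smul_right t, u2]; simp [bil_ev_left, ev_apply])] at h
  set W := midVec c d (c * d * t) + midVec d c t with hW
  have h := Realizes.cancel_right h (v := t • ev 0 + W)
    (by simp [hW, midVec_apply, ev_apply])
    (mem_siegelVectors_of_full (i := 2) (j := 4) (k := 5) (by decide) (by decide) h24 h25
      (c * d * t * (c ^ 2 + d ^ 2) + t * (c * d)) (q * (c * d)) 0 (by
      funext k
      simp only [Pi.add_apply, Pi.sub_apply, Pi.smul_apply, smul_eq_mul, ev_apply, midVec_apply,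
        hW, hU, hV]
      fin_cases k <;> simp <;> grind))
  have w2 : bil (ev 2) W = 0 := by simp [hW, bil_ev_left, midVec_apply]
  rw [hV, ← siegel_mul (QPlus_ev 5) (by simp [bil_ev_left, midVec_apply])
    (by simp [bil_ev_left, ev_apply]), ← siegel_mul (QPlus_ev 2) (by simp [bil_ev_left, ev_apply])
    w2] at h
  have e : siegel (ev 5) (midVec c d t) * siegel (ev 5) ((t * (c ^ 2 + d ^ 2)) • ev 4) *
      (siegel (ev 2) (t • ev 0) * siegel (ev 2) W) = mixedPair c d t *
        (siegel (ev 5) (rt 0 2 t ((t * (c ^ 2 + d ^ 2)) • ev 4)) * siegel (ev 2) W) := by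
    have e5 : rt 0 2 t (ev 5) = ev 5 := by rw [rt_ev]; simp
    have h1 := siegel_conj (rt_isIso (i := 0) (j := 2) (by decide) t) (ev 5)
      ((t * (c ^ 2 + d ^ 2)) • ev 4)
    rw [e5] at h1
    have h3 : siegel (ev 2) (t • ev 0) = rt 0 2 t := (rt_comm t).symm
    have h4 := rt_mul_self (i := 0) (j := 2) (by decide) t
    rw [h3, mixedPair]
    calc _ = siegel (ev 5) (midVec c d t) * (rt 0 2 t * rt 0 2 t) *
          siegel (ev 5) ((t * (c ^ 2 + d ^ 2)) • ev 4) * rt 0 2 t * siegel (ev 2) W := by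
            rw [h4]; simp only [mul_one, mul_assoc]
      _ = siegel (ev 5) (midVec c d t) * rt 0 2 t * (rt 0 2 t *
          siegel (ev 5) ((t * (c ^ 2 + d ^ 2)) • ev 4)) * rt 0 2 t * siegel (ev 2) W := by
            simp only [mul_assoc]
      _ = siegel (ev 5) (midVec c d t) * rt 0 2 t * siegel (ev 5) (rt 0 2 t
          ((t * (c ^ 2 + d ^ 2)) • ev 4)) * (rt 0 2 t * rt 0 2 t) * siegel (ev 2) W := by
            rw [h1]; simp only [mul_assoc]
      _ = _ := by rw [h4]; simp only [mul_one, mul_assoc]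
  rw [e] at h
  have h := hm.of_mul_left h
  have h := Realizes.cancel_left h (v := (t * (c ^ 2 + d ^ 2)) • ev 4) (by simp [ev_apply])
    (by
      rw [rt_apply_eq]
      refine mem_siegelVectors_of_full (i := 5) (j := 2) (k := 2) (by decide) (by decide)
        (fun t => rootScalars_swap (by decide) (h25 t))
        (fun t => rootScalars_swap (by decide) (h25 t)) (t * (t * (c ^ 2 + d ^ 2))) 0 0 ?_
      funext k
      simp only [Pi.add_apply, Pi.sub_apply, Pi.smul_apply, smul_eq_mul, ev_apply]
      fin_cases k <;> simp <;> grind)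
  change Realizes H (rt 5 4 _ * _) at h
  rw [siegel_mul_rt (by decide) (by decide) (by decide) (by simp [hW, midVec_apply])
    (by simp [hW, midVec_apply])] at h
  rwa [rt_comm]

theorem smul_ev_three_eq (h : c ^ 2 + d ^ 2 ≠ 0) (t : F) : t • ev 3 =
    midVec c d (t * c / (c ^ 2 + d ^ 2)) + midVec d c (t * d / (c ^ 2 + d ^ 2)) := by
  have h2 : (2 : F) = 0 := CharTwo.two_eq_zero
  funext k
  simp only [Pi.add_apply, Pi.smul_apply, smul_eq_mul, ev_apply, midVec_apply]
  fin_cases k <;> simp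
  · field_simp
  · field_simp
    linear_combination (-t * c * d) * h2

theorem smul_ev_seven_eq (h : c ^ 2 + d ^ 2 ≠ 0) (t : F) : t • ev 7 =
    midVec c d (t * d / (c ^ 2 + d ^ 2)) + midVec d c (t * c / (c ^ 2 + d ^ 2)) := by
  have h2 : (2 : F) = 0 := CharTwo.two_eq_zero
  funext k
  simp only [Pi.add_apply, Pi.smul_apply, smul_eq_mul, ev_apply, midVec_apply]
  fin_cases k <;> simp
  · field_simp
    linear_combination (-t * c * d) * h2
  · field_simp
    ring

/-- In even characteristic, full root scalars `(0, 5)` and `(0, 6)` give all the roots. -/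
theorem hasRoots_of_full_scalars_even (hx : Realizes H (xEnd 1 c d z)) (hy : Realizes H (yEnd F))
    (h05 : ∀ t, t ∈ rootScalars H 0 5) (h06 : ∀ t, t ∈ rootScalars H 0 6) (hcd : c * d ≠ 0)
    (hc : c ≠ 1) (hd : d ≠ 1) (hne : c ≠ d) (hs0 : s ≠ 0) (hs1 : s ≠ 1) : HasRoots H := by
  have h2 : (2 : F) = 0 := CharTwo.two_eq_zero
  have hm : ∀ t, Realizes H (mixedPair c d t) := realizes_mixedPair hx hy h05 h06 hcd hs0 hs1
  have hB : ∀ t, RealizesPair H 2 4 5 (midVec c d t) (t * (c * d)) :=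
    realizesPair_two hx hy h05 h06 hcd hs0 hs1
  have hC : ∀ t, RealizesPair H 2 4 5 (midVec d c t) t := fun t =>
    realizesPair_one_bar hx hy h05 h06 (hm t)
  have hD := realizesPair_four_bar hx hy h06 (hB 1)
  have k1 : (1 + c) ^ 2 * (1 + d) ^ 2 ≠ 0 := by
    refine mul_ne_zero (pow_ne_zero _ fun h => hc ?_) (pow_ne_zero _ fun h => hd ?_) <;> grind
  have h45 : ∀ t, t ∈ rootScalars H 4 5 := fun t => by
    have h := ((realizesPair_conjugate h05 h06 hy (hm (t / ((1 + c) ^ 2 * (1 + d) ^ 2))) hD).add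
      (hB (c * d * (t / ((1 + c) ^ 2 * (1 + d) ^ 2)))) (by decide) (by decide) (by decide)).add
      (hC (t / ((1 + c) ^ 2 * (1 + d) ^ 2))) (by decide) (by decide) (by decide)
    have h := h.2.2.2
    set r := t / ((1 + c) ^ 2 * (1 + d) ^ 2) with hr
    have ht : t = r * ((1 + c) ^ 2 * (1 + d) ^ 2) := by rw [hr, div_mul_cancel₀ _ k1]
    have e : midVec c d (c * d * r) + midVec d c r + midVec c d (c * d * r) + midVec d c r = 0 := by
      funext k
      simp only [Pi.add_apply, Pi.zero_apply, midVec_apply]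
      fin_cases k <;> simp <;> grind
    rw [e, siegel_zero, one_mul] at h
    have e' : t = r * (c ^ 2 + d ^ 2) + c * d * r * (c * d) + r := by rw [ht]; grind
    rw [e']
    exact h
  have hv : ∀ t, midVec c d t ∈ siegelVectors H 2 := fun t =>
    ⟨by simp [midVec_apply], Realizes.of_mul_right (h45 _) (hB t).2.2.2⟩
  have hv' : ∀ t, midVec d c t ∈ siegelVectors H 2 := fun t =>
    ⟨by simp [midVec_apply], Realizes.of_mul_right (h45 _) (hC t).2.2.2⟩
  have k2 : c ^ 2 + d ^ 2 ≠ 0 := fun h => hne (by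
    have : (c + d) ^ 2 = 0 := by grind
    have := pow_eq_zero_iff (two_ne_zero) |>.mp this
    grind)
  have h23 : ∀ t, t ∈ rootScalars H 2 3 := fun t => mem_rootScalars (by
    rw [smul_ev_three_eq k2]
    exact add_mem (hv _) (hv' _))
  have h27 : ∀ t, t ∈ rootScalars H 2 7 := fun t => mem_rootScalars (by
    rw [smul_ev_seven_eq k2]
    exact add_mem (hv _) (hv' _))
  exact hasRoots_of_core hy h05 h06 h45
    (fun t => shift_mem_rootScalars (i := 0) (j := 3) hy
      (shift_mem_rootScalars (i := 2) (j := 3) hy (h23 t)))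
    (fun t => shift_mem_rootScalars (i := 0) (j := 7) hy
      (shift_mem_rootScalars (i := 2) (j := 7) hy (h27 t)))

end Even

end

section

open Polynomial

variable {F : Type*} [Field F]

/-- Two additive sets of scalars, each containing the products of the other one, and one of them
the products twisted by a primitive element, are full. -/
theorem full_of_twisted_products [Finite F] {S T : F → Prop} {γ s : F}
    (hγ : ∀ x : F, x ≠ 0 → ∃ n : ℕ, x = γ ^ n) (h0T : T 0)
    (hST : ∀ a b, S a → S b → T (a * b)) (hTS : ∀ a b, T a → T b → S (a * b))
    (hγT : ∀ a b, T a → T b → S (a * b * γ)) (hs : S s) (hs0 : s ≠ 0) :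
    (∀ t, S t) ∧ ∀ t, T t := by
  have : Fintype F := Fintype.ofFinite F
  set τ := s * s with hτ
  have hτT : T τ := hST _ _ hs hs
  have hτ0 : τ ≠ 0 := mul_ne_zero hs0 hs0
  have h1 : ∀ (n : ℕ) t, T t → T ((τ ^ 3) ^ n * t) := by
    intro n
    induction n with
    | zero => simp
    | succ n ih =>
      intro t ht
      rw [pow_succ, show (τ ^ 3) ^ n * τ ^ 3 * t = (τ ^ 3) ^ n * (t * τ * (τ * τ)) by ring]
      exact ih _ (hST _ _ (hTS _ _ ht hτT) (hTS _ _ hτT hτT))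
  have h2 : ∀ t, T t → T (γ * t) := by
    intro t ht
    have h3 := h1 (Fintype.card F - 2) _ (hST _ _ (hγT _ _ ht hτT) (hTS _ _ hτT hτT))
    have hq := Fintype.one_lt_card (α := F)
    have h4 : (τ ^ 3) ^ (Fintype.card F - 2) * τ ^ 3 = 1 := by
      rw [← pow_succ, show Fintype.card F - 2 + 1 = Fintype.card F - 1 by omega]
      exact FiniteField.pow_card_sub_one_eq_one _ (pow_ne_zero 3 hτ0)
    rwa [show (τ ^ 3) ^ (Fintype.card F - 2) * (t * τ * γ * (τ * τ)) =
      (τ ^ 3) ^ (Fintype.card F - 2) * τ ^ 3 * (γ * t) by ring, h4, one_mul] at h3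
  have h3 : ∀ (n : ℕ) t, T t → T (γ ^ n * t) := by
    intro n
    induction n with
    | zero => simp
    | succ n ih =>
      intro t ht
      rw [pow_succ, mul_assoc]
      exact ih _ (h2 _ ht)
  have hT : ∀ t, T t := fun t => by
    by_cases ht : t = 0
    · rwa [ht]
    · obtain ⟨n, hn⟩ := hγ (t / τ) (div_ne_zero ht hτ0)
      have := h3 n τ hτT
      rwa [← hn, div_mul_cancel₀ _ hτ0] at this
  exact ⟨fun t => by simpa using hTS t 1 (hT _) (hT _), hT⟩

section Even

variable [CharP F 2] {H : Subgroup (GL (Fin 8) F)} {c d z s t : F}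

theorem mul_mul_mem_rootScalars_even (hx : Realizes H (xEnd 1 c d z)) (hy : Realizes H (yEnd F))
    (hs : s ∈ rootScalars H 0 6) (ht : t ∈ rootScalars H 0 6) :
    s * t * (c * d) ∈ rootScalars H 0 5 := by
  have h2 : (2 : F) = 0 := CharTwo.two_eq_zero
  have h25 : t ∈ rootScalars H 2 5 := shift_mem_rootScalars (i := 1) (j := 4) hy
    (shift_mem_rootScalars (i := 0) (j := 6) hy ht)
  have h := realizes_image_root hx hy hs
  set W : Fin 8 → F := ![s * z, 0, s, s * c, 0, s, s * (c * d), s * d] with hW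
  have hQ : QPlus F (ev 0 + ev 5 : Fin 8 → F) = 0 := by simp [QPlus, ev_apply]
  have h' := Realizes.siegel_conj_of_eq h25 (rt_isIso (by decide) t) h (u' := ev 0 + ev 5)
    (v' := W + (s * t * (c * d)) • ev 5)
    (by rw [rt_apply_eq]; simp [ev_apply])
    (by
      rw [rt_apply_eq]; funext k
      simp only [Pi.add_apply, Pi.sub_apply, Pi.smul_apply, smul_eq_mul, ev_apply]
      fin_cases k <;> simp [hW] <;> grind)
  have h'' := Realizes.siegel_cancel hQ (by simp [bil_ev_left, hW])
    (by simp [bil_ev_left, ev_apply]) h h'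
  rw [siegel_swap_even hQ (by rw [QPlus_smul, QPlus_ev, mul_zero]), siegel_smul, smul_add,
    siegel_add_smul_self (QPlus_ev 5) _ (by simp [bil_ev_left, ev_apply])] at h''
  exact rootScalars_swap (i := 5) (j := 0) (by decide) h''

theorem separable_even (hcd : c * d ≠ 0) (h : c ^ 2 + d ^ 2 ≠ 0)
    (hG : 1 + c ^ 2 + d ^ 2 + c * d ≠ 0) :
    ((X ^ 2 - C (1 : F) * X + 1) * quartic c d).Separable := by
  have h2 : (2 : F) = 0 := CharTwo.two_eq_zero
  have h2' : (2 : F[X]) = 0 := CharTwo.two_eq_zero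
  refine separable_quadratic_mul_quartic ?_ ?_ (fun e => hG ?_)
  · refine ⟨0, 1, ?_⟩
    simp only [derivative_add, derivative_sub, derivative_X_pow, derivative_C_mul, derivative_X,
      derivative_one]
    simp [CharTwo.two_eq_zero, CharTwo.neg_eq]
  · have hd : derivative (quartic c d) = C (c * d) * (X + C 1) ^ 2 := by
      rw [quartic]
      simp only [derivative_add, derivative_X_pow, derivative_C_mul, derivative_X, derivative_one]
      simp only [Nat.cast_ofNat, map_ofNat, map_mul, map_one]
      simp only [map_sub, map_ofNat, map_add, map_pow]
      norm_num
      linear_combination (2 * X ^ 3 + C c * C d * X ^ 2 - C c * C d * X +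
        (C c ^ 2 + C d ^ 2 - 2) * X) * h2'
    have hX : IsCoprime (quartic c d) (X + C 1) := by
      refine IsCoprime.symm (isCoprime_of_eq_add (r := X ^ 3 + C (c * d + 1) * X ^ 2 +
        C (c ^ 2 + d ^ 2 - 1 - c * d) * X + C (1 - c ^ 2 - d ^ 2))
        (s := C (c ^ 2 + d ^ 2) * 1) ?_ (isCoprime_C_mul h isCoprime_one_right))
      simp only [quartic, map_add, map_sub, map_mul, map_pow, map_ofNat, map_one]
      linear_combination (-X ^ 3 + X * C c * C d - X ^ 2) * h2'
    rw [Polynomial.Separable, hd]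
    exact isCoprime_C_mul hcd hX.pow_right
  · linear_combination e + 2 * h2

theorem generated_of_even [Finite F] (hcd : c * d ≠ 0) (hc : c ≠ 1) (hd : d ≠ 1) (hne : c ≠ d)
    (hG : 1 + c ^ 2 + d ^ 2 + c * d ≠ 0)
    (hK : 1 + c * d + (c * d) ^ 2 + c ^ 2 + d ^ 2 + z ^ 2 + z * (1 + c ^ 2 + d ^ 2) ≠ 0)
    (hfull : ∀ H : Subgroup (GL (Fin 8) F), Realizes H (xEnd 1 c d z) → Realizes H (yEnd F) →
      ∀ s ≠ 0, s ∈ rootScalars H 0 5 →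
        (∀ t, t ∈ rootScalars H 0 5) ∧ ∀ t, t ∈ rootScalars H 0 6) :
    IsTwoThreeGenerated ↥(commutator ↥(orthogonalGroupOf F (QPlus F))) := by
  have h2 : (2 : F) = 0 := CharTwo.two_eq_zero
  have k2 : c ^ 2 + d ^ 2 ≠ 0 := fun h => hne (by
    have : (c + d) ^ 2 = 0 := by grind
    have := pow_eq_zero_iff (two_ne_zero) |>.mp this
    grind)
  obtain ⟨s, hs0, hs⟩ := exists_root_element 1 c d z (quartic c d)
    (quartic_mem_invLine 1 c d z) (separable_even hcd k2 hG)
    (by rw [quartic_coeff_zero]; exact one_ne_zero)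
    (aeval_quadratic_quartic_ne_zero 1 c d z (by rw [h2]; simp)
      (fun h => hK (by grind)))
  refine generated_of_hasRoots 1 c d z fun H hx hy => ?_
  obtain ⟨h5, h6⟩ := hfull H hx hy s hs0 (hs H hx hy)
  exact hasRoots_of_full_scalars_even hx hy h5 h6 hcd hc hd hne (left_ne_zero_of_mul hcd) hc

theorem exists_even_parameters [Fintype F] (hq : 8 ≤ Fintype.card F) (γ : F) :
    ∃ c d : F, c * d = γ ∧ c ≠ 1 ∧ d ≠ 1 ∧ c ≠ d ∧ 1 + c ^ 2 + d ^ 2 + c * d ≠ 0 := by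
  have hm : (X ^ 2 + C (1 + γ) * X + C (γ ^ 2) : F[X]).Monic := by monicity!
  obtain ⟨u, hu⟩ := exists_eval_ne_zero_of_natDegree_lt_card
    (X * (X - C 1) * (X - C γ) * (X - C (γ ^ 2)) * (X ^ 2 + C (1 + γ) * X + C (γ ^ 2)) : F[X])
    (mul_ne_zero (mul_ne_zero (mul_ne_zero (mul_ne_zero X_ne_zero (X_sub_C_ne_zero _))
      (X_sub_C_ne_zero _)) (X_sub_C_ne_zero _)) hm.ne_zero) (by
        rw [Cardinal.mk_fintype]
        exact_mod_cast lt_of_le_of_lt (by compute_degree : _ ≤ 6) (by omega))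
  simp only [eval_mul, eval_X, eval_sub, eval_pow, eval_C, eval_add, mul_ne_zero_iff,
    sub_ne_zero] at hu
  obtain ⟨⟨⟨⟨u0, u1⟩, u2⟩, u3⟩, u4⟩ := hu
  obtain ⟨c, rfl⟩ := FiniteField.isSquare_of_char_two (CharP.ringChar_of_prime_eq_zero
    Nat.prime_two (by exact_mod_cast CharTwo.two_eq_zero) : ringChar F = 2) u
  have hc : c ≠ 0 := left_ne_zero_of_mul u0
  refine ⟨c, γ / c, mul_div_cancel₀ γ hc, ?_, ?_, ?_, ?_⟩
  · rintro rfl; simp at u1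
  · intro h
    rw [div_eq_one_iff_eq hc] at h
    exact u3 (by rw [h]; ring)
  · intro h
    rw [eq_div_iff hc] at h
    exact u2 h
  · intro h
    apply u4
    field_simp at h
    linear_combination h

theorem generated_of_even_of_card [Fintype F] (hq : 8 ≤ Fintype.card F) :
    IsTwoThreeGenerated ↥(commutator ↥(orthogonalGroupOf F (QPlus F))) := by
  have h2 : (2 : F) = 0 := CharTwo.two_eq_zero
  obtain ⟨γ, hγ0, hγ⟩ := exists_primitive (F := F)
  obtain ⟨c, d, rfl, hc, hd, hne, hG⟩ := exists_even_parameters hq γ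
  refine generated_of_even (z := 1) hγ0 hc hd hne hG ?_ fun H hx hy s hs0 hs => ?_
  · intro h
    have h3 : (c * d) ^ 3 = 1 := by
      linear_combination (c * d - 1) * h - (c * d - 1) * (1 + c ^ 2 + d ^ 2) * h2
    classical
    have hsub : (Finset.univ : Finset F) ⊆ {0, 1, c * d, (c * d) ^ 2} := fun x _ => by
      by_cases hx : x = 0
      · simp [hx]
      · obtain ⟨n, rfl⟩ := hγ x hx
        rw [← Nat.div_add_mod n 3, pow_add, pow_mul, h3, one_pow, one_mul]
        have := Nat.mod_lt n (by decide : 3 > 0)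
        interval_cases n % 3 <;> simp
    have := (Finset.card_le_card hsub).trans Finset.card_le_four
    rw [Finset.card_univ] at this
    omega
  · exact full_of_twisted_products (S := (· ∈ rootScalars H 0 5)) (T := (· ∈ rootScalars H 0 6))
      hγ zero_mem_rootScalars
      (fun _ _ => mul_mem_rootScalars_zero_six hy) (fun _ _ => mul_mem_rootScalars_zero_five hy)
      (fun _ _ => mul_mul_mem_rootScalars_even hx hy) hs hs0

end Even

end

section

variable {F : Type*} [Field F]

section FieldFour

variable {H : Subgroup (GL (Fin 8) F)} {ω : F}

/-- The code of the product of the coded element `a.1 + a.2 * ω` with `ω`. -/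
def codeMul (a : ℕ × ℕ) : ℕ × ℕ := (a.2, a.1 + a.2)

/-- The reduction of a coded element. -/
def codeReduce (a : ℕ × ℕ) : ℕ × ℕ := (a.1 % 2, a.2 % 2)

/-- The coordinates of `xEnd 1 ω (ω ^ 2) ω` and of the powers of `yEnd`, on lists of codes. -/
def codeStep (k : ℕ) : List (ℕ × ℕ) → List (ℕ × ℕ)
  | [a, b, c, d, e, f, g, h] =>
    match k with
    | 0 => [g + b + codeMul (codeMul d) + codeMul h + codeMul e + c, f + c, e,
        h + codeMul e + codeMul (codeMul c), c, b + e,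
        a + f + codeMul d + codeMul (codeMul h) + e + codeMul c,
        d + codeMul (codeMul e) + codeMul c].map codeReduce
    | 1 => [c, a, b, d, g, e, f, h]
    | _ => [b, c, a, d, f, g, e, h]
  | _ => []

/-- The element with the given code. -/
def ofCode (ω : F) (a : ℕ × ℕ) : F := a.1 + a.2 * ω

/-- The vector with the given list of codes. -/
def ofCodes (ω : F) (l : List (ℕ × ℕ)) (i : Fin 8) : F := ofCode ω (l.getD i 0)

/-- Letters of a word in the generators. -/
def letterFour (ω : F) (k : ℕ) : Module.End F (Fin 8 → F) :=
  match k with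
  | 0 => xEnd 1 ω (ω ^ 2) ω
  | 1 => yEnd _
  | _ => yEnd _ * yEnd _

theorem ofCode_add (ω : F) (a b : ℕ × ℕ) : ofCode ω (a + b) = ofCode ω a + ofCode ω b := by
  simp only [ofCode, Prod.fst_add, Prod.snd_add, Nat.cast_add]; ring

theorem ofCode_codeMul (hω : ω ^ 2 = ω + 1) (a : ℕ × ℕ) :
    ofCode ω (codeMul a) = ω * ofCode ω a := by
  simp only [ofCode, codeMul, Nat.cast_add]
  linear_combination (-(a.2 : F)) * hω

theorem ofCode_codeReduce [CharP F 2] (ω : F) (a : ℕ × ℕ) :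
    ofCode ω (codeReduce a) = ofCode ω a := by
  simp only [ofCode, codeReduce, ← CharP.cast_eq_mod F 2]

theorem ofCodes_codeStep [CharP F 2] (hω : ω ^ 2 = ω + 1) (k : ℕ) (l : List (ℕ × ℕ))
    (hl : l.length = 8) :
    ofCodes ω (codeStep k l) = letterFour ω k (ofCodes ω l) ∧ (codeStep k l).length = 8 := by
  have h2 : (2 : F) = 0 := CharTwo.two_eq_zero
  obtain ⟨a, b, c, d, e, f, g, h, rfl⟩ : ∃ a b c d e f g h, l = [a, b, c, d, e, f, g, h] := by
    match l, hl with
    | [a, b, c, d, e, f, g, h], _ => exact ⟨a, b, c, d, e, f, g, h, rfl⟩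
  match k with
  | 0 =>
    refine ⟨?_, rfl⟩
    simp only [letterFour, xEnd_apply]
    funext i
    have h3 : ω ^ 3 = 1 := by linear_combination (ω + 1) * hω + ω * h2
    fin_cases i <;>
      simp [ofCodes, codeStep, ofCode_codeReduce, ofCode_add, ofCode_codeMul hω, CharTwo.neg_eq,
        CharTwo.sub_eq_add] <;> grind
  | 1 =>
    refine ⟨?_, rfl⟩
    simp only [letterFour, yEnd_apply]
    funext i
    fin_cases i <;> simp [ofCodes, codeStep]
  | k + 2 =>
    refine ⟨?_, rfl⟩
    simp only [letterFour, yEnd_apply, Module.End.mul_apply]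
    funext i
    fin_cases i <;> simp [ofCodes, codeStep]

theorem ofCodes_foldr [CharP F 2] (hω : ω ^ 2 = ω + 1) (w : List ℕ) (l : List (ℕ × ℕ))
    (hl : l.length = 8) :
    ofCodes ω (w.foldr codeStep l) = (w.map (letterFour ω)).prod (ofCodes ω l) ∧
      (w.foldr codeStep l).length = 8 := by
  induction w with
  | nil => simp [hl]
  | cons k w ih =>
    obtain ⟨h1, h2⟩ := ofCodes_codeStep hω k _ ih.2
    exact ⟨by simp [h1, ih.1], h2⟩

theorem realizes_word_four (hx : Realizes H (xEnd 1 ω (ω ^ 2) ω)) (hy : Realizes H (yEnd F))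
    (w : List ℕ) : Realizes H (w.map (letterFour ω)).prod ∧ IsIso (w.map (letterFour ω)).prod := by
  induction w with
  | nil => exact ⟨by simpa using Realizes.one, fun v => by simp⟩
  | cons k w ih =>
    simp only [List.map_cons, List.prod_cons]
    refine ⟨Realizes.mul ?_ ih.1, IsIso.mul ?_ ih.2⟩
    · match k with
      | 0 => exact hx
      | 1 => exact hy
      | k + 2 => exact hy.mul hy
    · match k with
      | 0 => exact xEnd_isIso _ _ _ _
      | 1 => exact yEnd_isIso
      | k + 2 => exact yEnd_isIso.mul yEnd_isIso

theorem mul_mem_rootScalars_four [CharP F 2] (hω : ω ^ 2 = ω + 1)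
    (hx : Realizes H (xEnd 1 ω (ω ^ 2) ω)) (hy : Realizes H (yEnd F)) {s : F}
    (hs : s ∈ rootScalars H 0 5) : ω * s ∈ rootScalars H 0 5 := by
  obtain ⟨h1, h2⟩ := realizes_word_four hx hy [1, 0, 2, 0, 2, 0, 1, 0, 1, 0, 1, 0, 2, 0, 1, 0, 2,
    0, 2, 0, 1, 0, 1, 0, 1, 0, 2, 0, 1, 0, 2, 0, 2, 0, 2, 0, 1, 0, 1, 0, 2]
  have e0 : (ev 0 : Fin 8 → F) =
      ofCodes ω [(1, 0), (0, 0), (0, 0), (0, 0), (0, 0), (0, 0), (0, 0), (0, 0)] := by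
    funext i; fin_cases i <;> simp [ev_apply, ofCodes, ofCode]
  have e5 : (ev 5 : Fin 8 → F) =
      ofCodes ω [(0, 0), (0, 0), (0, 0), (0, 0), (0, 0), (1, 0), (0, 0), (0, 0)] := by
    funext i; fin_cases i <;> simp [ev_apply, ofCodes, ofCode]
  have e5' : ω • (ev 5 : Fin 8 → F) =
      ofCodes ω [(0, 0), (0, 0), (0, 0), (0, 0), (0, 0), (0, 1), (0, 0), (0, 0)] := by
    funext i; fin_cases i <;> simp [ev_apply, ofCodes, ofCode]
  refine h1.siegel_conj_of_eq h2 hs ?_ ?_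
  · rw [e0, ← (ofCodes_foldr hω _ _ rfl).1]
    exact congrArg (ofCodes ω) (by decide +kernel)
  · rw [mul_comm, map_smul, mul_smul, e5', e5, ← (ofCodes_foldr hω _ _ rfl).1]
    exact congrArg (fun l => s • ofCodes ω l) (by decide +kernel)

theorem exists_omega [CharP F 2] [Fintype F] (hq : Fintype.card F = 4) : ∃ ω : F, ω ^ 2 = ω + 1 ∧
    ∀ x : F, x ≠ 0 → ∃ n : ℕ, x = ω ^ n := by
  obtain ⟨γ, hγ0, hγ⟩ := exists_primitive (F := F)
  refine ⟨γ, ?_, hγ⟩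
  have h2 : (2 : F) = 0 := CharTwo.two_eq_zero
  have h3 : γ ^ 3 = 1 := by
    have := FiniteField.pow_card_sub_one_eq_one γ hγ0
    rwa [hq] at this
  have h1 : γ ≠ 1 := by
    rintro rfl
    have : ∀ x : F, x ≠ 0 → x = 1 := fun x hx => by
      obtain ⟨n, rfl⟩ := hγ x hx; simp
    classical
    have hsub : (Finset.univ : Finset F) ⊆ {0, 1} := fun x _ => by
      by_cases hx : x = 0
      · simp [hx]
      · simp [this x hx]
    have := (Finset.card_le_card hsub).trans Finset.card_le_two
    rw [Finset.card_univ] at this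
    omega
  have h4 : (γ - 1) * (γ ^ 2 - γ - 1) = 0 := by
    linear_combination h3 + (1 - γ ^ 2) * h2
  have := (mul_eq_zero.mp h4).resolve_left (sub_ne_zero.mpr h1)
  linear_combination this

theorem generated_four [CharP F 2] [Fintype F] (hq : Fintype.card F = 4) :
    IsTwoThreeGenerated ↥(commutator ↥(orthogonalGroupOf F (QPlus F))) := by
  have h2 : (2 : F) = 0 := CharTwo.two_eq_zero
  obtain ⟨ω, hω, hp⟩ := exists_omega (F := F) hq
  have h3 : ω * ω ^ 2 = 1 := by linear_combination (ω + 1) * hω + ω * h2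
  have h4 : ω ^ 4 = ω := by linear_combination ω * h3
  have h0 : ω ≠ 0 := by rintro rfl; simp at hω
  have h1 : ω ≠ 1 := by
    rintro rfl
    exact one_ne_zero (α := F) (by linear_combination -hω)
  refine generated_of_even (c := ω) (d := ω ^ 2) (z := ω) ?_ h1 ?_ ?_ ?_ ?_
    fun H hx hy s hs0 hs => ?_
  · rw [h3]; exact one_ne_zero
  · intro h; exact h0 (by linear_combination h - hω)
  · intro h; exact one_ne_zero (α := F) (by linear_combination -h - hω)
  · intro h; exact one_ne_zero (α := F) (by grind)
  · intro h; exact h0 (by grind)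
  · have h5 : ∀ (n : ℕ) t, t ∈ rootScalars H 0 5 → ω ^ n * t ∈ rootScalars H 0 5 := by
      intro n
      induction n with
      | zero => simp
      | succ n ih =>
        intro t ht
        rw [pow_succ, mul_assoc]
        exact ih _ (mul_mem_rootScalars_four hω hx hy ht)
    have h6 : ∀ t, t ∈ rootScalars H 0 5 := fun t => by
      by_cases ht : t = 0
      · rw [ht]; exact zero_mem_rootScalars
      · obtain ⟨n, hn⟩ := hp (t / s) (div_ne_zero ht hs0)
        have := h5 n s hs
        rwa [← hn, div_mul_cancel₀ _ hs0] at this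
    exact ⟨h6, fun t => by simpa using mul_mem_rootScalars_zero_six hy (h6 t) (h6 1)⟩

end FieldFour

/-- The product of the split para-octonion algebra: a composition product for `QPlus`. -/
def zorn (v w : Fin 8 → F) : Fin 8 → F :=
  ![-(v 7 * w 0) - w 3 * v 0 - (v 5 * w 6 - v 6 * w 5),
    -(v 7 * w 1) - w 3 * v 1 - (v 6 * w 4 - v 4 * w 6),
    -(v 7 * w 2) - w 3 * v 2 - (v 4 * w 5 - v 5 * w 4),
    v 7 * w 7 - (v 0 * w 4 + v 1 * w 5 + v 2 * w 6),
    -(w 7 * v 4) - v 3 * w 4 - (v 1 * w 2 - v 2 * w 1),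
    -(w 7 * v 5) - v 3 * w 5 - (v 2 * w 0 - v 0 * w 2),
    -(w 7 * v 6) - v 3 * w 6 - (v 0 * w 1 - v 1 * w 0),
    v 3 * w 3 - (v 4 * w 0 + v 5 * w 1 + v 6 * w 2)]

theorem zorn_add_left (u v w : Fin 8 → F) : zorn (u + v) w = zorn u w + zorn v w := by
  funext k; fin_cases k <;> simp [zorn] <;> ring

theorem zorn_add_right (u v w : Fin 8 → F) : zorn u (v + w) = zorn u v + zorn u w := by
  funext k; fin_cases k <;> simp [zorn] <;> ring

theorem zorn_smul_left (a : F) (u v : Fin 8 → F) : zorn (a • u) v = a • zorn u v := by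
  funext k; fin_cases k <;> simp [zorn] <;> ring

theorem zorn_smul_right (a : F) (u v : Fin 8 → F) : zorn u (a • v) = a • zorn u v := by
  funext k; fin_cases k <;> simp [zorn] <;> ring

theorem bil_zorn (u v w : Fin 8 → F) : bil (zorn u v) w = bil u (zorn v w) := by
  simp [zorn, bil]; ring

theorem zorn_zorn_left (u v : Fin 8 → F) : zorn (zorn u v) u = QPlus F u • v := by
  funext k; fin_cases k <;> simp [zorn, QPlus] <;> ring

theorem zorn_zorn_right (u v : Fin 8 → F) : zorn u (zorn v u) = QPlus F u • v := by
  funext k; fin_cases k <;> simp [zorn, QPlus] <;> ring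

/-- Three maps are related if they satisfy the triality identity for `zorn`. -/
def Related (f g h : Module.End F (Fin 8 → F)) : Prop :=
  ∀ u v, f (zorn u v) = zorn (g u) (h v)

theorem IsIso.surjective {f : Module.End F (Fin 8 → F)} (hf : IsIso f) :
    Function.Surjective f :=
  (LinearMap.injective_iff_surjective).1 hf.injective

theorem Related.cycle {f g h : Module.End F (Fin 8 → F)} (hf : IsIso f) (hg : IsIso g)
    (H : Related f g h) : Related g h f := by
  intro u v
  have key : ∀ w, bil (g (zorn u v) - zorn (h u) (f v)) (g w) = 0 := by
    intro w
    rw [bil_sub_left, hg.bil, bil_comm, bil_comm _ (g w), ← bil_zorn, ← bil_zorn, ← H, hf.bil,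
      sub_self]
  refine sub_eq_zero.1 (bil_nondegenerate fun w => ?_)
  obtain ⟨w, rfl⟩ := hg.surjective w
  exact key w

theorem Related.mul {f g h f' g' h' : Module.End F (Fin 8 → F)} (H : Related f g h)
    (H' : Related f' g' h') : Related (f * f') (g * g') (h * h') := fun u v => by
  simp only [Module.End.mul_apply, H' u v, H _ _]

theorem related_yEnd : Related (yEnd F) (yEnd F) (yEnd F) := by
  intro u v
  funext k
  fin_cases k <;> simp [zorn, yEnd_apply] <;> ring

theorem related_rt_zero_five (t : F) : Related (rt 0 5 t) (rt 0 5 t) (rt 0 5 t) := by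
  intro u v
  funext k
  fin_cases k <;> simp [zorn, rt_apply] <;> ring

theorem related_rt_zero_six (t : F) : Related (rt 0 6 t) (rt 0 6 t) (rt 0 6 t) := by
  intro u v
  funext k
  fin_cases k <;> simp [zorn, rt_apply] <;> ring

theorem related_rt_four_five (t : F) : Related (rt 4 5 t) (rt 2 3 (-t)) (rt 2 7 t) := by
  intro u v
  funext k
  fin_cases k <;> simp [zorn, rt_apply] <;> ring

theorem related_rt_one_three (t : F) : Related (rt 1 3 t) (rt 1 7 (-t)) (rt 4 6 t) := by
  intro u v
  funext k
  fin_cases k <;> simp [zorn, rt_apply] <;> ring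

theorem related_rt_one_seven (t : F) : Related (rt 1 7 t) (rt 4 6 (-t)) (rt 1 3 (-t)) := by
  intro u v
  funext k
  fin_cases k <;> simp [zorn, rt_apply] <;> ring

/-- Triples of elements of the derived group satisfying the triality identity. -/
def trialityGroup (F : Type*) [Field F] : Subgroup (Fin 3 → GL (Fin 8) F) where
  carrier := {t | (∀ i, t i ∈ derivedGroup F) ∧
    ∀ i, Related (act (t i)) (act (t (i + 1))) (act (t (i + 2)))}
  one_mem' := ⟨fun _ => one_mem _, fun _ u v => by simp [act_one]⟩
  mul_mem' {s t} hs ht := ⟨fun i => mul_mem (hs.1 i) (ht.1 i), fun i => by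
    simpa only [Pi.mul_apply, act_mul] using (hs.2 i).mul (ht.2 i)⟩
  inv_mem' {t} ht := ⟨fun i => inv_mem (ht.1 i), fun i u v => by
    have hinv : ∀ (g : GL (Fin 8) F) x, act g (act g⁻¹ x) = x := fun g x => by
      rw [act_apply, act_apply, GL_mulVec_inv]
    have hinv' : ∀ (g : GL (Fin 8) F) x, act g⁻¹ (act g x) = x := fun g x => by
      rw [act_apply, act_apply, GL_inv_mulVec]
    have := ht.2 i (act (t (i + 1))⁻¹ u) (act (t (i + 2))⁻¹ v)
    rw [hinv, hinv] at this
    simp only [Pi.inv_apply]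
    rw [← this, hinv']⟩

theorem act_isIso {g : GL (Fin 8) F} (hg : g ∈ derivedGroup F) : IsIso (act g) :=
  mem_orthogonal_iff.1 (derivedGroup_le_orthogonal hg)

theorem Related.exists_mem {f g h : Module.End F (Fin 8 → F)} (H : Related f g h)
    (hf : Realizes (derivedGroup F) f) (hg : Realizes (derivedGroup F) g)
    (hh : Realizes (derivedGroup F) h) :
    ∃ t ∈ trialityGroup F, act (t 0) = f ∧ act (t 1) = g ∧ act (t 2) = h := by
  obtain ⟨a, ha, rfl⟩ := hf.exists
  obtain ⟨b, hb, rfl⟩ := hg.exists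
  obtain ⟨c, hc, rfl⟩ := hh.exists
  have H1 := H.cycle (act_isIso ha) (act_isIso hb)
  have H2 := H1.cycle (act_isIso hb) (act_isIso hc)
  refine ⟨![a, b, c], ⟨fun i => ?_, fun i => ?_⟩, rfl, rfl, rfl⟩
  · fin_cases i <;> assumption
  · fin_cases i <;> assumption

theorem exists_trialityGroup_zero {g : GL (Fin 8) F} (hg : g ∈ derivedGroup F) :
    ∃ t ∈ trialityGroup F, t 0 = g := by
  have hr : ∀ {i j : Fin 8}, j ≠ i → j ≠ i + 4 → ∀ t : F, Realizes (derivedGroup F) (rt i j t) :=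
    fun hij h t => hasRoots_derivedGroup _ _ hij h t
  let P : Subgroup (GL (Fin 8) F) := (trialityGroup F).map (Pi.evalMonoidHom _ 0)
  have lift : ∀ {f g h : Module.End F (Fin 8 → F)}, Related f g h → Realizes (derivedGroup F) f →
      Realizes (derivedGroup F) g → Realizes (derivedGroup F) h → Realizes P f := by
    intro f g h H hf hg hh
    obtain ⟨t, ht, rfl, -, -⟩ := H.exists_mem hf hg hh
    exact realizes_act ⟨t, ht, rfl⟩
  have hP : HasRoots P := hasRoots_of_core (lift related_yEnd realizes_yEnd realizes_yEnd realizes_yEnd)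
    (fun t => lift (related_rt_zero_five t) (hr (by decide) (by decide) _)
      (hr (by decide) (by decide) _) (hr (by decide) (by decide) _))
    (fun t => lift (related_rt_zero_six t) (hr (by decide) (by decide) _)
      (hr (by decide) (by decide) _) (hr (by decide) (by decide) _))
    (fun t => lift (related_rt_four_five t) (hr (by decide) (by decide) _)
      (hr (by decide) (by decide) _) (hr (by decide) (by decide) _))
    (fun t => lift (related_rt_one_three t) (hr (by decide) (by decide) _)
      (hr (by decide) (by decide) _) (hr (by decide) (by decide) _))
    (fun t => lift (related_rt_one_seven t) (hr (by decide) (by decide) _)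
      (hr (by decide) (by decide) _) (hr (by decide) (by decide) _))
  exact hP.derivedGroup_le hg

/-- Rotating the entries of a triple preserves the triality identity. -/
theorem rotate_mem_trialityGroup {t : Fin 3 → GL (Fin 8) F} (ht : t ∈ trialityGroup F)
    (k : Fin 3) : (fun i => t (i + k)) ∈ trialityGroup F := by
  refine ⟨fun i => ht.1 _, fun i => ?_⟩
  have := ht.2 (i + k)
  rw [add_right_comm, add_right_comm i k 2] at this
  exact this

theorem exists_trialityGroup (i : Fin 3) {g : GL (Fin 8) F} (hg : g ∈ derivedGroup F) :
    ∃ t ∈ trialityGroup F, t i = g := by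
  obtain ⟨t, ht, h⟩ := exists_trialityGroup_zero hg
  exact ⟨_, rotate_mem_trialityGroup ht (-i), by simpa using h⟩

/-- The nilpotent part of a root element. -/
def nil (i j : Fin 8) (x : Fin 8 → F) : Fin 8 → F := x (j + 4) • ev i - x (i + 4) • ev j

theorem nil_apply (i j : Fin 8) (x : Fin 8 → F) (k : Fin 8) :
    nil i j x k = (if k = i then x (j + 4) else 0) - if k = j then x (i + 4) else 0 := by
  simp [nil, ev_apply]

theorem yEnd_nil (i j : Fin 8) (x : Fin 8 → F) :
    yEnd F (nil i j x) = nil (shift i) (shift j) (yEnd F x) := by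
  have h : ∀ k : Fin 8, yEnd F x (shift k + 4) = x (k + 4) := by
    intro k
    fin_cases k <;> rfl
  rw [nil, nil, map_sub, map_smul, map_smul, yEnd_ev, yEnd_ev, h, h]

theorem root_pair_cases : ∀ i j : Fin 8, j ≠ i → j ≠ i + 4 →
    ∃ p ∈ [((0 : Fin 8), (1 : Fin 8)), (0, 3), (0, 5), (0, 6), (0, 7), (3, 4), (4, 5), (4, 7)],
      ∃ q ∈ [p, (p.2, p.1)], (i, j) = q ∨ (i, j) = (shift q.1, shift q.2) ∨
        (i, j) = (shift (shift q.1), shift (shift q.2)) := by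
  decide

theorem exists_zorn_eq_nil {i j : Fin 8} (hij : j ≠ i) (h : j ≠ i + 4) :
    ∃ (a b : Fin 8) (c : F), ∀ x : Fin 8 → F, nil i j x = c • zorn (zorn (ev a) x) (ev b) := by
  let P : Fin 8 → Fin 8 → Prop := fun i j =>
    ∃ (a b : Fin 8) (c : F), ∀ x : Fin 8 → F, nil i j x = c • zorn (zorn (ev a) x) (ev b)
  have sh : ∀ i j, P i j → P (shift i) (shift j) := by
    rintro i j ⟨a, b, c, hx⟩
    refine ⟨shift a, shift b, c, fun x => ?_⟩
    obtain ⟨x, rfl⟩ := yEnd_isIso.surjective x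
    rw [← yEnd_nil, hx, map_smul, related_yEnd, related_yEnd, yEnd_ev, yEnd_ev]
  have sw : ∀ i j, P i j → P j i := by
    rintro i j ⟨a, b, c, hx⟩
    refine ⟨a, b, -c, fun x => ?_⟩
    rw [neg_smul, ← hx, nil, nil, neg_sub]
  have core : ∀ p ∈ [((0 : Fin 8), (1 : Fin 8)), (0, 3), (0, 5), (0, 6), (0, 7), (3, 4), (4, 5),
      (4, 7)], P p.1 p.2 := by
    simp only [List.mem_cons, List.not_mem_nil, or_false]
    rintro p (rfl | rfl | rfl | rfl | rfl | rfl | rfl | rfl)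
    · refine ⟨3, 6, 1, fun x => ?_⟩
      funext k; fin_cases k <;> simp [zorn, ev_apply, nil_apply]
    · refine ⟨5, 6, 1, fun x => ?_⟩
      funext k; fin_cases k <;> simp [zorn, ev_apply, nil_apply]
    · refine ⟨5, 0, 1, fun x => ?_⟩
      funext k; fin_cases k <;> simp [zorn, ev_apply, nil_apply]
    · refine ⟨6, 0, 1, fun x => ?_⟩
      funext k; fin_cases k <;> simp [zorn, ev_apply, nil_apply]
    · refine ⟨0, 3, 1, fun x => ?_⟩
      funext k; fin_cases k <;> simp [zorn, ev_apply, nil_apply]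
    · refine ⟨7, 4, 1, fun x => ?_⟩
      funext k; fin_cases k <;> simp [zorn, ev_apply, nil_apply]
    · refine ⟨7, 2, 1, fun x => ?_⟩
      funext k; fin_cases k <;> simp [zorn, ev_apply, nil_apply]
    · refine ⟨1, 2, 1, fun x => ?_⟩
      funext k; fin_cases k <;> simp [zorn, ev_apply, nil_apply]
  obtain ⟨p, hp, q, hq, hc⟩ := root_pair_cases i j hij h
  have hq' : P q.1 q.2 := by
    simp only [List.mem_cons, List.not_mem_nil, or_false] at hq
    rcases hq with rfl | rfl
    · exact core _ hp
    · exact sw _ _ (core _ hp)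
  rcases hc with hc | hc | hc <;> obtain ⟨rfl, rfl⟩ := Prod.mk.inj hc
  · exact hq'
  · exact sh _ _ hq'
  · exact sh _ _ (sh _ _ hq')

/-- Off-diagonal matrix units are products of two root nilpotents. -/
theorem exists_nil_nil {m k : Fin 8} (h : m ≠ k) : ∃ i j i' j' : Fin 8, j ≠ i ∧ j ≠ i + 4 ∧
    j' ≠ i' ∧ j' ≠ i' + 4 ∧ ∀ x : Fin 8 → F, nil i' j' (nil i j x) = x k • ev m := by
  have key : ∀ m k : Fin 8, m ≠ k → ∃ i : Fin 8, k + 4 ≠ i ∧ k + 4 ≠ i + 4 ∧ i + 4 ≠ m ∧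
      i + 4 ≠ m + 4 ∧ m + 4 ≠ i ∧ m + 4 ≠ k + 4 ∧ k + 4 + 4 = k ∧ i + 4 + 4 = i := by decide
  obtain ⟨i, h1, h2, h3, h4, h5, h6, h7, h8⟩ := key m k h
  refine ⟨i, k + 4, m, i + 4, h1, h2, h3, h4, fun x => ?_⟩
  rw [nil, nil_apply, nil_apply, h7, h8, if_pos rfl, if_neg h1.symm, if_neg h5, if_neg h6, sub_zero,
    sub_zero, zero_smul, sub_zero]

theorem exists_eq_smul_of_commute_nil {g : Module.End F (Fin 8 → F)}
    (hg : ∀ i j : Fin 8, j ≠ i → j ≠ i + 4 → ∀ x, g (nil i j x) = nil i j (g x)) :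
    ∃ c : F, ∀ x, g x = c • x := by
  have h1 : ∀ m k : Fin 8, m ≠ k → g (ev m) = (g (ev k) k) • ev m := by
    intro m k hmk
    obtain ⟨i, j, i', j', h1, h2, h3, h4, hx⟩ := exists_nil_nil (F := F) hmk
    have := hx (ev k)
    rw [ev_apply, if_pos rfl, one_smul] at this
    rw [← hx, ← hg _ _ h1 h2, ← hg _ _ h3 h4, this]
  have h2 : ∀ m k : Fin 8, m ≠ k → g (ev m) m = g (ev k) k := by
    intro m k hmk
    rw [h1 m k hmk]
    simp [ev_apply]
  have h3 : ∀ m, g (ev m) = g (ev 0) 0 • ev m := by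
    intro m
    by_cases hm : m = 0
    · subst hm
      rw [h1 0 1 (by decide), h2 1 0 (by decide)]
      simp [ev_apply]
    · exact h1 m 0 hm
  refine ⟨g (ev 0) 0, fun x => ?_⟩
  conv_lhs => rw [eq_sum_ev x]
  conv_rhs => rw [eq_sum_ev x]
  rw [map_sum, Finset.smul_sum]
  exact Finset.sum_congr rfl fun i _ => by rw [map_smul, h3, smul_comm]

theorem Related.exists_smul {g h : Module.End F (Fin 8 → F)} (H : Related 1 g h) (hg : IsIso g)
    (hh : IsIso h) : ∃ c : F, c ^ 2 = 1 ∧ (∀ x, g x = c • x) ∧ ∀ x, h x = c • x := by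
  have h1 : IsIso (1 : Module.End F (Fin 8 → F)) := fun _ => rfl
  have H1 := H.cycle h1 hg
  have H2 := H1.cycle hg hh
  simp only [Related, Module.End.one_apply] at H H1 H2
  obtain ⟨c, hc⟩ := exists_eq_smul_of_commute_nil (g := g) fun i j hij h x => by
    obtain ⟨a, b, c, hn⟩ := exists_zorn_eq_nil (F := F) hij h
    rw [hn, hn, map_smul, H1, H2]
  have hQ : QPlus F (ev 0 + ev 4 : Fin 8 → F) = 1 := by simp [QPlus, ev_apply]
  refine ⟨c, ?_, hc, fun u => ?_⟩
  · have := hg (ev 0 + ev 4)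
    rwa [hc, QPlus_smul, hQ, mul_one] at this
  · set v : Fin 8 → F := ev 0 + ev 4
    have h3 : zorn (h u) v = zorn (c • u) v := by rw [← H1, hc, zorn_smul_left]
    have h4 := congrArg (zorn v) h3
    rwa [zorn_zorn_right, zorn_zorn_right, hQ, one_smul, one_smul] at h4

theorem exists_sign_of_mem {r : Fin 3 → GL (Fin 8) F} (hr : r ∈ trialityGroup F)
    (h : r 0 = 1) : ∃ c : F, c ^ 2 = 1 ∧ (∀ x, act (r 1) x = c • x) ∧ ∀ x, act (r 2) x = c • x := by
  have H := hr.2 0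
  rw [h, act_one] at H
  exact H.exists_smul (act_isIso (hr.1 1)) (act_isIso (hr.1 2))

theorem exists_smul_of_mem {r : Fin 3 → GL (Fin 8) F} (hr : r ∈ trialityGroup F)
    (h : r 0 = 1) (i : Fin 3) : ∃ c : F, ∀ x, act (r i) x = c • x := by
  obtain ⟨c, -, h1, h2⟩ := exists_sign_of_mem hr h
  fin_cases i
  · exact ⟨1, fun x => by simp [h, act_one]⟩
  · exact ⟨c, h1⟩
  · exact ⟨c, h2⟩

/-- The derived group acts irreducibly. -/
theorem eq_top_of_derivedGroup_invariant {W : Submodule F (Fin 8 → F)}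
    (hW : ∀ g ∈ derivedGroup F, ∀ w ∈ W, act g w ∈ W) (hne : W ≠ ⊥) : W = ⊤ := by
  have hn : ∀ i j : Fin 8, j ≠ i → j ≠ i + 4 → ∀ w ∈ W, nil i j w ∈ W := by
    intro i j hij h w hw
    obtain ⟨g, hg, hg'⟩ := (hasRoots_derivedGroup (F := F) i j hij h 1).exists
    have h1 := W.sub_mem (hW g hg w hw) hw
    have h2 : act g w = rt i j 1 w := by rw [hg']; rfl
    rw [h2, rt_apply_eq] at h1
    convert h1 using 1
    rw [nil]
    simp only [one_mul]
    abel
  have step : ∀ k, (∃ w ∈ W, w k ≠ 0) → ∀ m, m ≠ k → ev m ∈ W := by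
    rintro k ⟨w, hw, hk⟩ m hmk
    obtain ⟨i, j, i', j', h1, h2, h3, h4, hx⟩ := exists_nil_nil (F := F) hmk
    have := hn _ _ h3 h4 _ (hn _ _ h1 h2 w hw)
    rw [hx] at this
    exact (W.smul_mem_iff hk).1 this
  have one : ∀ k, (ev k : Fin 8 → F) k ≠ 0 := fun k => by simp [ev_apply]
  obtain ⟨w, hw, hw0⟩ := W.ne_bot_iff.1 hne
  obtain ⟨k, hk⟩ := Function.ne_iff.1 hw0
  have h1 := step k ⟨w, hw, hk⟩
  have hall : ∀ m, ev m ∈ W := by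
    intro m
    by_cases hm : m = k
    · have hk1 : k + 1 ≠ k := (by decide : ∀ k : Fin 8, k + 1 ≠ k) k
      exact step (k + 1) ⟨_, h1 _ hk1, one _⟩ m (by rw [hm]; exact hk1.symm)
    · exact h1 m hm
  rw [eq_top_iff]
  intro v _
  rw [eq_sum_ev v]
  exact W.sum_mem fun i _ => W.smul_mem _ (hall i)

/-- The stabilizer of a subspace. -/
def subspaceStabilizer (W : Submodule F (Fin 8 → F)) : Subgroup (GL (Fin 8) F) where
  carrier := {g | ∀ w, act g w ∈ W ↔ w ∈ W}
  one_mem' w := by simp [act_one]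
  mul_mem' {a b} ha hb w := by rw [act_mul, Module.End.mul_apply, ha, hb]
  inv_mem' {a} ha w := by rw [← ha, act_apply, act_apply, GL_mulVec_inv]

theorem mem_subspaceStabilizer {W : Submodule F (Fin 8 → F)} {g : GL (Fin 8) F}
    (h : ∀ w ∈ W, act g w ∈ W) : g ∈ subspaceStabilizer W := by
  have hinj : Function.Injective (act g) := fun x y hxy => by
    simpa [act_apply, GL_inv_mulVec] using congrArg (act g⁻¹) hxy
  have hmap : W.map (act g) = W := by
    apply Submodule.eq_of_le_of_finrank_eq
    · rintro _ ⟨w, hw, rfl⟩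
      exact h w hw
    · exact (Submodule.equivMapOfInjective _ hinj W).finrank_eq.symm
  refine fun w => ⟨fun hw => ?_, h w⟩
  rw [← hmap] at hw
  obtain ⟨w', hw', he⟩ := hw
  exact hinj he ▸ hw'

/-- If the first components of two triples generate the derived group, then all components
generate irreducible groups. -/
theorem irreducible_of_generate {X Y : Fin 3 → GL (Fin 8) F} (hX : X ∈ trialityGroup F)
    (hY : Y ∈ trialityGroup F) (hgen : Subgroup.closure {X 0, Y 0} = derivedGroup F) (i : Fin 3)
    {W : Submodule F (Fin 8 → F)} (hWX : ∀ w ∈ W, act (X i) w ∈ W)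
    (hWY : ∀ w ∈ W, act (Y i) w ∈ W) (hne : W ≠ ⊥) : W = ⊤ := by
  refine eq_top_of_derivedGroup_invariant (fun g hg w hw => ?_) hne
  obtain ⟨t, ht, rfl⟩ := exists_trialityGroup i hg
  have h0 : t 0 ∈ (Subgroup.closure {X, Y}).map (Pi.evalMonoidHom _ 0) := by
    rw [MonoidHom.map_closure, Set.image_pair]
    exact hgen ▸ ht.1 0
  obtain ⟨s, hs, hs0⟩ := h0
  have hsΓ : s ∈ trialityGroup F := by
    refine (Subgroup.closure_le _).2 ?_ hs
    rintro _ (rfl | rfl) <;> assumption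
  have hsW : s ∈ (subspaceStabilizer W).comap (Pi.evalMonoidHom _ i) := by
    refine (Subgroup.closure_le _).2 ?_ hs
    rintro _ (rfl | rfl)
    · exact mem_subspaceStabilizer hWX
    · exact mem_subspaceStabilizer hWY
  obtain ⟨c, hc⟩ := exists_smul_of_mem (mul_mem ht (inv_mem hsΓ))
    (by change t 0 * (s 0)⁻¹ = 1; rw [← show s 0 = t 0 from hs0, mul_inv_cancel]) i
  have : act (t i) w = c • act (s i) w := by
    rw [← hc, ← Module.End.mul_apply, ← act_mul]
    simp
  rw [this]
  exact W.smul_mem _ ((hsW w).2 hw)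

section Supertrace

variable {V M : Type*} [AddCommGroup V] [Module F V] [AddCommGroup M] [Module F M]

/-- The product of the images of a list of vectors. -/
def word (c : V →ₗ[F] Module.End F M) (L : List V) : Module.End F M := (L.map c).prod

theorem word_append (c : V →ₗ[F] Module.End F M) (L L' : List V) :
    word c (L ++ L') = word c L * word c L' := by
  simp [word]

theorem word_cons (c : V →ₗ[F] Module.End F M) (v : V) (L : List V) :
    word c (v :: L) = c v * word c L := by
  simp [word]

theorem word_move {c : V →ₗ[F] Module.End F M} {B : V → V → F}
    (hc : ∀ u v, c u * c v = B u v • 1 - c v * c u) (T : Module.End F M →ₗ[F] F) (a : V)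
    (N : List V) : ∀ P : List V, (∀ L : List V, L.length + 1 = P.length + N.length →
      T (word c L) = 0) → T (word c (P ++ a :: N)) = (-1) ^ N.length * T (word c (P ++ N ++ [a])) := by
  induction N with
  | nil => intro P _; simp
  | cons b N ih =>
    intro P h
    have h1 : word c (P ++ a :: b :: N) = B a b • word c (P ++ N) - word c (P ++ b :: a :: N) := by
      simp only [word_append, word_cons]
      rw [← mul_assoc (c a), hc, sub_mul, mul_sub, smul_mul_assoc, one_mul, mul_smul_comm,
        mul_assoc (c b)]
    have h2 := ih (P ++ [b]) fun L hL => h L (by simp at hL ⊢; omega)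
    simp only [List.append_assoc, List.singleton_append] at h2
    rw [h1, map_sub, map_smul, h (P ++ N) (by simp; omega), smul_zero, zero_sub, h2]
    simp [pow_succ]

/-- A twisted supertrace vanishes on all even words if the twisting isometry has no fixed
vector and the supertrace of the identity vanishes. -/
theorem supertrace_word_eq_zero {c : V →ₗ[F] Module.End F M} {B : V → V → F}
    (hc : ∀ u v, c u * c v = B u v • 1 - c v * c u) (T : Module.End F M →ₗ[F] F)
    {w : Module.End F V} (hT : ∀ v N, T (c v * N) = -T (N * c (w v)))
    (hw : Function.Surjective (w - 1 : Module.End F V)) (h1 : T 1 = 0) :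
    ∀ n (L : List V), L.length = 2 * n → T (word c L) = 0 := by
  intro n
  induction n with
  | zero =>
    intro L hL
    rw [List.length_eq_zero_iff.1 hL]
    simpa [word] using h1
  | succ n ih =>
    intro L hL
    obtain ⟨v, N, rfl⟩ := List.exists_cons_of_ne_nil (List.ne_nil_of_length_pos (by omega) : L ≠ [])
    have hN : N.length = 2 * n + 1 := by rw [List.length_cons] at hL; omega
    obtain ⟨u, hu⟩ := hw v
    have h2 := word_move hc T (w u) N [] fun L hL => ih L (by simp at hL; omega)
    have h3 : (-1 : F) ^ N.length = -1 := Odd.neg_one_pow ⟨n, hN⟩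
    have h4 := hT u (word c N)
    simp only [List.nil_append, h3, word_append, word_cons] at h2
    rw [word_cons, ← hu, LinearMap.sub_apply, map_sub, sub_mul, map_sub, h2, Module.End.one_apply,
      h4]
    simp [word]

end Supertrace

/-- The Clifford action on the sum of the two half-spin modules. -/
def spin : (Fin 8 → F) →ₗ[F] Module.End F ((Fin 8 → F) × (Fin 8 → F)) where
  toFun v :=
    { toFun := fun x => (zorn x.2 v, zorn v x.1)
      map_add' := fun x y => by simp [zorn_add_left, zorn_add_right]
      map_smul' := fun a x => by simp [zorn_smul_left, zorn_smul_right] }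
  map_add' u v := LinearMap.ext fun x => by simp [zorn_add_left, zorn_add_right]
  map_smul' a v := LinearMap.ext fun x => by simp [zorn_smul_left, zorn_smul_right]

theorem spin_apply (v : Fin 8 → F) (x : (Fin 8 → F) × (Fin 8 → F)) :
    spin v x = (zorn x.2 v, zorn v x.1) := rfl

theorem spin_mul_self (v : Fin 8 → F) : spin v * spin v = QPlus F v • 1 := by
  refine LinearMap.ext fun x => ?_
  simp [spin_apply, zorn_zorn_left, zorn_zorn_right, Prod.smul_def]

theorem spin_mul (u v : Fin 8 → F) : spin u * spin v = bil u v • 1 - spin v * spin u := by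
  have h := spin_mul_self (u + v)
  rw [map_add, add_mul, mul_add, mul_add, spin_mul_self, spin_mul_self, QPlus_add, add_smul,
    add_smul] at h
  rw [eq_sub_iff_add_eq]
  have h2 : QPlus F u • (1 : Module.End F ((Fin 8 → F) × (Fin 8 → F))) + spin u * spin v +
      (spin v * spin u + QPlus F v • 1) = QPlus F u • 1 + QPlus F v • 1 +
      (spin u * spin v + spin v * spin u) := by abel
  rw [h2] at h
  exact add_left_cancel h

theorem Related.spin {f g h : Module.End F (Fin 8 → F)} (hf : IsIso f) (hg : IsIso g)
    (hh : IsIso h) (H : Related f g h) (v : Fin 8 → F) :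
    (g.prodMap h) * OmegaEight.spin v = OmegaEight.spin (f v) * (g.prodMap h) := by
  have H1 := H.cycle hf hg
  have H2 := H1.cycle hg hh
  refine LinearMap.ext fun x => ?_
  simp [spin_apply, H1 _ _, H2 _ _]

/-- Scalar multiples of even words in the Clifford action. -/
def IsEvenWord (N : Module.End F ((Fin 8 → F) × (Fin 8 → F))) : Prop :=
  ∃ (a : F) (n : ℕ) (L : List (Fin 8 → F)), L.length = 2 * n ∧ N = a • word spin L

theorem IsEvenWord.mul {N N' : Module.End F ((Fin 8 → F) × (Fin 8 → F))} (h : IsEvenWord N)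
    (h' : IsEvenWord N') : IsEvenWord (N * N') := by
  obtain ⟨a, n, L, hL, rfl⟩ := h
  obtain ⟨a', n', L', hL', rfl⟩ := h'
  exact ⟨a * a', n + n', L ++ L', by rw [List.length_append, hL, hL']; ring,
    by rw [word_append, smul_mul_smul_comm]⟩

theorem exists_evenWord_nil {i j : Fin 8} (hij : j ≠ i) (h : j ≠ i + 4) :
    ∃ N : Module.End F ((Fin 8 → F) × (Fin 8 → F)), IsEvenWord N ∧
      (∀ x, (N x).1 = nil i j x.1) ∧ ∀ x, x.2 = 0 → (N x).2 = 0 := by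
  obtain ⟨a, b, c, hx⟩ := exists_zorn_eq_nil (F := F) hij h
  refine ⟨_, ⟨c, 1, [ev b, ev a], rfl, rfl⟩, fun x => ?_, fun x h0 => ?_⟩
  · simp [word, spin_apply, hx]
  · have hz : zorn (0 : Fin 8 → F) (ev a) = 0 := by
      simpa using zorn_smul_left (0 : F) 0 (ev a)
    have hz' : zorn (ev b) (0 : Fin 8 → F) = 0 := by
      simpa using zorn_smul_right (0 : F) (ev b) 0
    simp [word, spin_apply, h0, hz, hz']

theorem exists_evenWord_unit (m k : Fin 8) :
    ∃ N : Module.End F ((Fin 8 → F) × (Fin 8 → F)), IsEvenWord N ∧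
      (∀ x, (N x).1 = x.1 k • ev m) ∧ ∀ x, x.2 = 0 → (N x).2 = 0 := by
  have key : ∀ m k : Fin 8, m ≠ k → ∃ N : Module.End F ((Fin 8 → F) × (Fin 8 → F)), IsEvenWord N ∧
      (∀ x, (N x).1 = x.1 k • ev m) ∧ ∀ x, x.2 = 0 → (N x).2 = 0 := by
    intro m k hmk
    obtain ⟨i, j, i', j', h1, h2, h3, h4, hx⟩ := exists_nil_nil (F := F) hmk
    obtain ⟨N, hN, hN1, hN2⟩ := exists_evenWord_nil (F := F) h1 h2
    obtain ⟨N', hN', hN1', hN2'⟩ := exists_evenWord_nil (F := F) h3 h4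
    exact ⟨N' * N, hN'.mul hN, fun x => by rw [Module.End.mul_apply, hN1', hN1, hx],
      fun x h0 => hN2' _ (hN2 x h0)⟩
  by_cases hmk : m = k
  · subst hmk
    have hm : m + 1 ≠ m := (by decide : ∀ m : Fin 8, m + 1 ≠ m) m
    obtain ⟨N, hN, hN1, hN2⟩ := key (m + 1) m hm
    obtain ⟨N', hN', hN1', hN2'⟩ := key m (m + 1) hm.symm
    refine ⟨N' * N, hN'.mul hN, fun x => ?_, fun x h0 => hN2' _ (hN2 x h0)⟩
    rw [Module.End.mul_apply, hN1', hN1, Pi.smul_apply, ev_apply, if_pos rfl, smul_eq_mul, mul_one]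
  · exact key m k hmk

/-- Every matrix unit on the first half-spin module is an even word. -/
theorem exists_evenWord_unit_zero (m k : Fin 8) :
    ∃ N : Module.End F ((Fin 8 → F) × (Fin 8 → F)), IsEvenWord N ∧
      ∀ x, N x = (x.1 k • ev m, 0) := by
  obtain ⟨N, hN, hN1, hN2⟩ := exists_evenWord_unit (F := F) m 7
  obtain ⟨N', hN', hN1', -⟩ := exists_evenWord_unit (F := F) 3 k
  have hP : ∀ x, word spin [ev 0, ev 1, ev 2, ev 3] x = (-(x.1 3) • ev (7 : Fin 8), (0 : Fin 8 → F)) := by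
    intro x
    refine Prod.ext (funext fun k => ?_) (funext fun k => ?_) <;> fin_cases k <;>
      simp [word, spin_apply, zorn, ev_apply]
  refine ⟨N * ((-1 : F) • word spin [ev 0, ev 1, ev 2, ev 3] * N'), hN.mul
    (.mul ⟨-1, 2, _, rfl, rfl⟩ hN'), fun x => Prod.ext ?_ (hN2 _ ?_)⟩
  · rw [Module.End.mul_apply, hN1, Module.End.mul_apply, LinearMap.smul_apply, hP, hN1']
    simp [ev_apply]
  · rw [Module.End.mul_apply, LinearMap.smul_apply, hP]
    simp

/-- The supertrace criterion for a fixed vector. -/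
theorem Related.exists_fixed {f g h : Module.End F (Fin 8 → F)} (hf : IsIso f) (hg : IsIso g)
    (hh : IsIso h) (H : Related f g h)
    (htr : LinearMap.trace F (Fin 8 → F) g = LinearMap.trace F (Fin 8 → F) h) :
    ∃ v, v ≠ 0 ∧ f v = v := by
  by_contra! hno
  have hsurj : Function.Surjective (f - 1 : Module.End F (Fin 8 → F)) := by
    rw [← LinearMap.injective_iff_surjective, ← LinearMap.ker_eq_bot, LinearMap.ker_eq_bot']
    intro v hv
    by_contra h0
    exact hno v h0 (sub_eq_zero.1 hv)
  let e : Module.End F ((Fin 8 → F) × (Fin 8 → F)) := LinearMap.prodMap 1 (-1)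
  let T : Module.End F ((Fin 8 → F) × (Fin 8 → F)) →ₗ[F] F :=
    (LinearMap.trace F _).comp
      ((LinearMap.mulRight F (g.prodMap h)).comp (LinearMap.mulLeft F e))
  have hT : ∀ N, T N = LinearMap.trace F _ (e * N * g.prodMap h) := fun N => rfl
  have he : ∀ v, e * OmegaEight.spin v = (-1 : F) • (OmegaEight.spin v * e) := fun v => by
    refine LinearMap.ext fun x => ?_
    have h1 : ∀ a b : Fin 8 → F, zorn (-a) b = -zorn a b := fun a b => by
      simpa using zorn_smul_left (-1 : F) a b
    simp [e, spin_apply, h1]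
  have htw : ∀ v N, T (OmegaEight.spin v * N) = -T (N * OmegaEight.spin (f v)) := by
    intro v N
    rw [hT, hT, ← mul_assoc, he, smul_mul_assoc, smul_mul_assoc, map_smul, neg_one_smul, mul_assoc,
      mul_assoc, LinearMap.trace_mul_comm]
    simp only [mul_assoc, H.spin hf hg hh]
  have h1 : T 1 = 0 := by
    have : e * 1 * g.prodMap h = LinearMap.prodMap g (-h) := by
      refine LinearMap.ext fun x => ?_
      simp [e]
    rw [hT, this, LinearMap.trace_prodMap', map_neg, htr, add_neg_cancel]
  have hall : ∀ N, IsEvenWord N → T N = 0 := by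
    rintro _ ⟨a, n, L, hL, rfl⟩
    rw [map_smul, supertrace_word_eq_zero spin_mul T htw hsurj h1 n L hL, smul_zero]
  have hzero : ∀ m k, g (ev m) k = 0 := by
    intro m k
    obtain ⟨N, hN, hx⟩ := exists_evenWord_unit_zero (F := F) m k
    have h2 := hall N hN
    have h3 : e * N * g.prodMap h =
        LinearMap.prodMap (((LinearMap.proj k : (Fin 8 → F) →ₗ[F] F).comp g).smulRight (ev m)) 0 := by
      refine LinearMap.ext fun x => ?_
      simp [e, hx]
    rw [hT, h3, LinearMap.trace_prodMap', map_zero, add_zero] at h2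
    simpa using h2
  exact ev_ne_zero (F := F) 0 (hg.injective (by rw [map_zero]; exact funext (hzero 0)))

/-- The polar form as a bilinear form. -/
def bilForm (F : Type*) [Field F] : LinearMap.BilinForm F (Fin 8 → F) :=
  LinearMap.mk₂ F bil bil_add_left bil_smul_left bil_add_right bil_smul_right

theorem bilForm_nondegenerate : (bilForm F).Nondegenerate :=
  ⟨fun _ h => bil_nondegenerate h, fun _ h => bil_nondegenerate fun u => by
    rw [bil_comm]; exact h u⟩

theorem finrank_orthogonal (W : Submodule F (Fin 8 → F)) :
    Module.finrank F ((bilForm F).orthogonal W) = 8 - Module.finrank F W := by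
  rw [LinearMap.BilinForm.finrank_orthogonal bilForm_nondegenerate]
  simp

theorem mem_orthogonal {W : Submodule F (Fin 8 → F)} {v : Fin 8 → F} :
    v ∈ (bilForm F).orthogonal W ↔ ∀ w ∈ W, bil w v = 0 := Iff.rfl

/-- The space of fixed vectors. -/
def fixedSpace (f : Module.End F (Fin 8 → F)) : Submodule F (Fin 8 → F) := LinearMap.ker (f - 1)

theorem mem_fixedSpace {f : Module.End F (Fin 8 → F)} {v : Fin 8 → F} :
    v ∈ fixedSpace f ↔ f v = v := by
  rw [fixedSpace, LinearMap.mem_ker, LinearMap.sub_apply, sub_eq_zero, Module.End.one_apply]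

theorem IsIso.bil_sub_of_fixed {f : Module.End F (Fin 8 → F)} (hf : IsIso f) {v : Fin 8 → F}
    (hv : f v = v) (u : Fin 8 → F) : OmegaEight.bil v (f u - u) = 0 := by
  rw [bil_sub_right]
  nth_rw 1 [← hv]
  rw [hf.bil, sub_self]

theorem IsIso.range_sub_one {f : Module.End F (Fin 8 → F)} (hf : IsIso f) :
    LinearMap.range (f - 1) = (bilForm F).orthogonal (fixedSpace f) := by
  apply Submodule.eq_of_le_of_finrank_eq
  · rintro _ ⟨u, rfl⟩
    exact mem_orthogonal.2 fun w hw => hf.bil_sub_of_fixed (mem_fixedSpace.1 hw) u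
  · have := LinearMap.finrank_range_add_finrank_ker (f - 1)
    rw [Module.finrank_fin_fun] at this
    rw [finrank_orthogonal, fixedSpace]
    omega

/-- The inequality of Scott for a pair of isometries without common fixed vector. -/
theorem scott {a b : Module.End F (Fin 8 → F)} (ha : IsIso a) (hb : IsIso b)
    (h : ∀ v, a v = v → b v = v → v = 0) :
    Module.finrank F (fixedSpace a) + Module.finrank F (fixedSpace b) +
      Module.finrank F (fixedSpace (a * b)) ≤ 8 := by
  have hdisj : fixedSpace a ⊓ fixedSpace b = ⊥ := by
    rw [eq_bot_iff]
    rintro v ⟨h1, h2⟩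
    exact h v (mem_fixedSpace.1 h1) (mem_fixedSpace.1 h2)
  have hsum := Submodule.finrank_sup_add_finrank_inf_eq (fixedSpace a) (fixedSpace b)
  rw [hdisj, finrank_bot, add_zero] at hsum
  have hinj : Module.finrank F (fixedSpace (a * b)) ≤
      Module.finrank F ((bilForm F).orthogonal (fixedSpace a ⊔ fixedSpace b)) := by
    have hmaps : ∀ v ∈ fixedSpace (a * b),
        (b - 1 : Module.End F (Fin 8 → F)) v ∈ (bilForm F).orthogonal (fixedSpace a ⊔ fixedSpace b) := by
      intro v hv
      rw [mem_fixedSpace, Module.End.mul_apply] at hv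
      rw [mem_orthogonal]
      intro w hw
      obtain ⟨w1, h1, w2, h2, rfl⟩ := Submodule.mem_sup.1 hw
      have e1 := hb.bil_sub_of_fixed (mem_fixedSpace.1 h2) v
      have e2 := ha.bil_sub_of_fixed (mem_fixedSpace.1 h1) (b v)
      rw [hv] at e2
      simp only [LinearMap.sub_apply, Module.End.one_apply, bil_add_left]
      rw [e1, add_zero, ← neg_sub, ← neg_one_smul F, bil_smul_right, e2, mul_zero]
    refine LinearMap.finrank_le_finrank_of_injective (f := (b - 1 : Module.End F _).restrict hmaps) ?_
    rw [← LinearMap.ker_eq_bot, LinearMap.ker_eq_bot']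
    rintro ⟨v, hv⟩ h0
    have h1 : b v = v := sub_eq_zero.1 (congrArg Subtype.val h0)
    rw [mem_fixedSpace, Module.End.mul_apply, h1] at hv
    exact Subtype.ext (h v hv h1)
  rw [finrank_orthogonal] at hinj
  have := Submodule.finrank_le (fixedSpace a ⊔ fixedSpace b)
  rw [Module.finrank_fin_fun] at this
  omega

/-- The reflection in a nonsingular vector. -/
def reflection (a : Fin 8 → F) : Module.End F (Fin 8 → F) where
  toFun x := x - (bil x a / QPlus F a) • a
  map_add' x y := by rw [bil_add_left, add_div, add_smul]; abel
  map_smul' c x := by rw [bil_smul_left, mul_div_assoc, mul_smul, RingHom.id_apply, smul_sub]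

theorem reflection_apply (a x : Fin 8 → F) :
    reflection a x = x - (bil x a / QPlus F a) • a := rfl

theorem reflection_isIso {a : Fin 8 → F} (ha : QPlus F a ≠ 0) : IsIso (reflection a) := fun x => by
  rw [reflection_apply, QPlus_sub, QPlus_smul, bil_smul_right]
  field_simp
  ring

theorem siegel_eq_reflection_mul {u v : Fin 8 → F} (hu : QPlus F u = 0) (huv : bil u v = 0)
    (hv : QPlus F v ≠ 0) : siegel u v = reflection v * reflection (v - QPlus F v • u) := by
  have hQ : QPlus F (v - QPlus F v • u) = QPlus F v := by
    rw [QPlus_sub, QPlus_smul, hu, bil_smul_right, bil_comm, huv]; ring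
  refine LinearMap.ext fun x => ?_
  rw [Module.End.mul_apply, reflection_apply, reflection_apply, hQ, siegel_apply]
  simp only [bil_sub_left, bil_sub_right, bil_smul_left, bil_smul_right, bil_self, huv]
  funext k
  simp only [Pi.add_apply, Pi.sub_apply, Pi.smul_apply, smul_eq_mul]
  field_simp
  ring

theorem finrank_of_hyperplane {W : Submodule F (Fin 8 → F)} {a w : Fin 8 → F} (hw : w ∈ W)
    (hwa : bil w a ≠ 0) : Module.finrank F W =
      Module.finrank F (W ⊓ LinearMap.ker ((bilForm F).flip a) : Submodule F (Fin 8 → F)) + 1 := by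
  have h1 := LinearMap.finrank_range_add_finrank_ker (((bilForm F).flip a).domRestrict W)
  have h2 : LinearMap.range (((bilForm F).flip a).domRestrict W) = ⊤ := by
    refine LinearMap.range_eq_top.2 (LinearMap.surjective ?_)
    intro h0
    exact hwa (LinearMap.congr_fun h0 ⟨w, hw⟩)
  rw [h2, finrank_top, Module.finrank_self] at h1
  rw [← h1, add_comm, LinearMap.ker_domRestrict, ← Submodule.finrank_map_subtype_eq]
  rw [Submodule.map_comap_subtype]

theorem parity_reflection {h : Module.End F (Fin 8 → F)} (hh : IsIso h) {a : Fin 8 → F}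
    (ha : QPlus F a ≠ 0) : Module.finrank F (fixedSpace (h * reflection a)) ≡
      Module.finrank F (fixedSpace h) + 1 [MOD 2] := by
  let K := LinearMap.ker ((bilForm F).flip a)
  have hK : ∀ {v}, v ∈ K ↔ bil v a = 0 := Iff.rfl
  have hinf : fixedSpace (h * reflection a) ⊓ K = fixedSpace h ⊓ K := by
    ext v
    simp only [Submodule.mem_inf, mem_fixedSpace, hK, Module.End.mul_apply]
    refine and_congr_left fun h0 => ?_
    rw [reflection_apply, h0, zero_div, zero_smul, sub_zero]
  by_cases hc : fixedSpace h ≤ K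
  · obtain ⟨u, hu⟩ : a ∈ LinearMap.range (h - 1) := by
      rw [hh.range_sub_one, mem_orthogonal]
      exact fun w hw => hK.1 (hc hw)
    have hu : h u = u + a := by
      rw [← hu]; simp
    have hQ : bil u a = -QPlus F a := by
      have := hh u
      rw [hu, QPlus_add] at this
      linear_combination this
    have hr : reflection a u = u + a := by
      rw [reflection_apply, hQ, neg_div, div_self ha, neg_one_smul, sub_neg_eq_add]
    have hr' : reflection a (u + a) = u := by
      rw [reflection_apply, bil_add_left, hQ, bil_self]
      have : (-QPlus F a + 2 * QPlus F a) / QPlus F a = 1 := by field_simp; ring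
      rw [this, one_smul, add_sub_cancel_right]
    have hw : u + a ∈ fixedSpace (h * reflection a) := by
      rw [mem_fixedSpace, Module.End.mul_apply, hr', hu]
    have hwa : bil (u + a) a ≠ 0 := by
      rw [bil_add_left, hQ, bil_self]
      intro h0
      apply ha
      linear_combination h0
    rw [finrank_of_hyperplane hw hwa, hinf, inf_eq_left.2 hc]
  · obtain ⟨u, hu, hua⟩ := Set.not_subset.1 hc
    have hle : fixedSpace (h * reflection a) ≤ K := by
      intro v hv
      rw [mem_fixedSpace, Module.End.mul_apply] at hv
      have h1 : bil (h (reflection a v)) (h u) = bil (reflection a v) u := hh.bil _ _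
      rw [hv, mem_fixedSpace.1 hu, reflection_apply, bil_sub_left, bil_smul_left] at h1
      have h2 : bil v a / QPlus F a * bil a u = 0 := by linear_combination h1
      rcases mul_eq_zero.1 h2 with h3 | h3
      · exact hK.2 ((div_eq_zero_iff.1 h3).resolve_right ha)
      · exact absurd (hK.2 (by rw [bil_comm]; exact h3)) hua
    rw [finrank_of_hyperplane hu (fun h0 => hua (hK.2 h0)), ← hinf, inf_eq_left.2 hle, add_assoc]
    exact (Nat.add_mod_right _ 2).symm

/-- The isometries whose multiplication does not change the parity of the dimension of the
fixed space. -/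
def parityGroup (F : Type*) [Field F] : Subgroup (GL (Fin 8) F) where
  carrier := {g | IsIso (act g) ∧ ∀ h : Module.End F (Fin 8 → F), IsIso h →
    Module.finrank F (fixedSpace (h * act g)) ≡ Module.finrank F (fixedSpace h) [MOD 2]}
  one_mem' := ⟨fun v => by simp [act_one], fun h _ => by rw [act_one, mul_one]⟩
  mul_mem' {a b} ha hb := ⟨by rw [act_mul]; exact ha.1.mul hb.1, fun h hh => by
    rw [act_mul, ← mul_assoc]
    exact (hb.2 _ (hh.mul ha.1)).trans (ha.2 h hh)⟩
  inv_mem' {a} ha := by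
    have hi : IsIso (act a⁻¹) := fun v => by
      rw [← ha.1, act_apply, act_apply, GL_mulVec_inv]
    refine ⟨hi, fun h hh => ?_⟩
    have := ha.2 _ (hh.mul hi)
    rw [mul_assoc, act_inv_mul, mul_one] at this
    exact this.symm

theorem realizes_parityGroup_siegel {u v : Fin 8 → F} (hu : QPlus F u = 0) (huv : bil u v = 0)
    (hv : QPlus F v ≠ 0) : Realizes (parityGroup F) (siegel u v) := by
  obtain ⟨g, -, hg⟩ := (realizes_siegelGroup hu huv).exists
  rw [← hg]
  refine realizes_act ⟨hg ▸ siegel_isIso hu huv, fun h hh => ?_⟩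
  have hQ : QPlus F (v - QPlus F v • u) ≠ 0 := by
    rw [QPlus_sub, QPlus_smul, hu, bil_smul_right, bil_comm, huv]
    simpa using hv
  rw [hg, siegel_eq_reflection_mul hu huv hv, ← mul_assoc]
  refine (parity_reflection (hh.mul (reflection_isIso hv)) hQ).trans ?_
  refine ((parity_reflection hh hv).add_right 1).trans ?_
  exact Nat.add_mod_right _ 2

theorem derivedGroup_le_parityGroup : derivedGroup F ≤ parityGroup F := by
  refine HasRoots.derivedGroup_le fun i j hij h t => ?_
  have key : ∀ i j : Fin 8, ∃ k, k ≠ i + 4 ∧ k + 4 ≠ i + 4 ∧ k ≠ j + 4 ∧ k + 4 ≠ j + 4 := by decide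
  obtain ⟨k, h1, h2, h3, h4⟩ := key i j
  let w : Fin 8 → F := ev k + ev (k + 4)
  have hw : QPlus F w = 1 := by rw [QPlus_add, QPlus_ev, QPlus_ev, bil_ev_ev_add_four]; ring
  have hi : bil (ev i) w = 0 := by rw [bil_add_right, bil_ev_ev h1, bil_ev_ev h2, add_zero]
  have hj : bil (ev j) w = 0 := by rw [bil_add_right, bil_ev_ev h3, bil_ev_ev h4, add_zero]
  have hit : bil (ev i) (t • ev j : Fin 8 → F) = 0 := by rw [bil_smul_right, bil_ev_ev h, mul_zero]
  have hiw : bil (ev i) (t • ev j + w) = 0 := by rw [bil_add_right, hit, hi, add_zero]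
  have hiw' : bil (ev i) (-w) = 0 := by
    rw [← neg_one_smul F, bil_smul_right, hi, mul_zero]
  have hs : (t • ev j : Fin 8 → F) = t • ev j + w + -w := by abel
  rw [hs, ← siegel_mul (QPlus_ev i) hiw hiw']
  refine (realizes_parityGroup_siegel (QPlus_ev i) hiw ?_).mul
    (realizes_parityGroup_siegel (QPlus_ev i) hiw' ?_)
  · rw [QPlus_add, QPlus_smul, QPlus_ev, hw, bil_smul_left, hj]
    simp
  · rw [QPlus_neg, hw]
    exact one_ne_zero

theorem even_finrank_fixedSpace {g : GL (Fin 8) F} (hg : g ∈ derivedGroup F) :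
    Even (Module.finrank F (fixedSpace (act g))) := by
  have := (derivedGroup_le_parityGroup hg).2 1 fun _ => rfl
  rw [one_mul] at this
  have h1 : fixedSpace (1 : Module.End F (Fin 8 → F)) = ⊤ := by simp [fixedSpace]
  rw [h1, finrank_top, Module.finrank_fin_fun] at this
  exact Nat.even_iff.2 this

theorem finrank_ker_mul_le {V : Type*} [AddCommGroup V] [Module F V] [FiniteDimensional F V]
    (f g : Module.End F V) : Module.finrank F (LinearMap.ker (f * g)) ≤
      Module.finrank F (LinearMap.ker f) + Module.finrank F (LinearMap.ker g) := by
  have hmaps : ∀ v ∈ LinearMap.ker (f * g), g v ∈ LinearMap.ker f := fun v hv => hv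
  have h := LinearMap.finrank_range_add_finrank_ker (g.restrict hmaps)
  have h1 := Submodule.finrank_le (LinearMap.range (g.restrict hmaps))
  have h2 : Module.finrank F (LinearMap.ker (g.restrict hmaps)) ≤
      Module.finrank F (LinearMap.ker g) := by
    rw [← Submodule.finrank_map_subtype_eq]
    refine Submodule.finrank_mono ?_
    rintro _ ⟨v, hv, rfl⟩
    exact congrArg Subtype.val hv
  omega

theorem map_sup_invariant {b : Module.End F (Fin 8 → F)} (hb : b ^ 3 = 1)
    (D : Submodule F (Fin 8 → F)) {w : Fin 8 → F} (hw : w ∈ D ⊔ D.map b ⊔ D.map (b ^ 2)) :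
    b w ∈ D ⊔ D.map b ⊔ D.map (b ^ 2) := by
  have h : (D ⊔ D.map b ⊔ D.map (b ^ 2)).map b ≤ D ⊔ D.map b ⊔ D.map (b ^ 2) := by
    have h3 : (D.map (b ^ 2)).map b = D := by
      rw [← Submodule.map_comp, ← Module.End.mul_eq_comp, ← pow_succ', hb]
      exact Submodule.map_id D
    have h2 : (D.map b).map b = D.map (b ^ 2) := by
      rw [← Submodule.map_comp, ← Module.End.mul_eq_comp, ← sq]
    rw [Submodule.map_sup, Submodule.map_sup, h2, h3]
    exact sup_le (sup_le (le_sup_of_le_left le_sup_right) le_sup_right)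
      (le_sup_of_le_left le_sup_left)
  exact h ⟨w, hw, rfl⟩

/-- The common data of a hypothetical generating pair in one of the three eight-dimensional
modules: a pair of isometries acting irreducibly. -/
structure IrreduciblePair (a b : Module.End F (Fin 8 → F)) : Prop where
  isIso_left : IsIso a
  isIso_right : IsIso b
  sq_left : a ^ 2 = 1
  cube_right : b ^ 3 = 1
  irreducible : ∀ W : Submodule F (Fin 8 → F), (∀ w ∈ W, a w ∈ W) → (∀ w ∈ W, b w ∈ W) →
    W ≠ ⊥ → W = ⊤

namespace IrreduciblePair

variable {a b : Module.End F (Fin 8 → F)}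

theorem eight_le_finrank (h : IrreduciblePair a b) {W : Submodule F (Fin 8 → F)}
    (ha : ∀ w ∈ W, a w ∈ W) (hb : ∀ w ∈ W, b w ∈ W) (hW : W ≠ ⊥) :
    8 ≤ Module.finrank F W := by
  rw [h.irreducible W ha hb hW, finrank_top, Module.finrank_fin_fun]

theorem three_le_finrank_range (h : IrreduciblePair a b) (s : F) :
    3 ≤ Module.finrank F (LinearMap.range (a - s • 1)) := by
  by_contra! hlt
  obtain ⟨D, hD, hD0, hDr⟩ : ∃ D : Submodule F (Fin 8 → F),
      LinearMap.range (a - s • 1) ≤ D ∧ D ≠ ⊥ ∧ Module.finrank F D ≤ 2 := by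
    by_cases h0 : LinearMap.range (a - s • 1) = ⊥
    · refine ⟨F ∙ (ev 0), h0 ▸ bot_le, ?_, ?_⟩
      · rw [Ne, Submodule.span_singleton_eq_bot]
        exact ev_ne_zero 0
      · exact (finrank_span_singleton (ev_ne_zero 0)).le.trans (by norm_num)
    · exact ⟨_, le_rfl, h0, by omega⟩
  have hle : D ≤ D ⊔ D.map b ⊔ D.map (b ^ 2) := le_sup_of_le_left le_sup_left
  have h8 := h.eight_le_finrank (W := D ⊔ D.map b ⊔ D.map (b ^ 2)) (fun w hw => by
    have h1 : a w = (a - s • 1) w + s • w := by simp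
    rw [h1]
    exact add_mem (hle (hD ⟨w, rfl⟩)) (Submodule.smul_mem _ _ hw))
    (fun w hw => map_sup_invariant h.cube_right D hw) (fun h0 => hD0 (eq_bot_iff.2 (h0 ▸ hle)))
  have e1 := Submodule.finrank_add_le_finrank_add_finrank (D ⊔ D.map b) (D.map (b ^ 2))
  have e2 := Submodule.finrank_add_le_finrank_add_finrank D (D.map b)
  have e3 := Submodule.finrank_map_le b D
  have e4 := Submodule.finrank_map_le (b ^ 2) D
  omega

theorem no_common_fixed (h : IrreduciblePair a b) (v : Fin 8 → F) (ha : a v = v) (hb : b v = v) :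
    v = 0 := by
  by_contra hv
  have h8 := h.eight_le_finrank (W := F ∙ v) (fun w hw => by
    obtain ⟨c, rfl⟩ := Submodule.mem_span_singleton.1 hw
    rwa [map_smul, ha]) (fun w hw => by
    obtain ⟨c, rfl⟩ := Submodule.mem_span_singleton.1 hw
    rwa [map_smul, hb]) (by rwa [Ne, Submodule.span_singleton_eq_bot])
  rw [finrank_span_singleton hv] at h8
  omega

end IrreduciblePair

theorem trace_eq_sum_bil (f : Module.End F (Fin 8 → F)) :
    LinearMap.trace F (Fin 8 → F) f = ∑ i, bil (ev (i + 4)) (f (ev i)) := by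
  rw [LinearMap.trace_eq_matrix_trace F (Pi.basisFun F (Fin 8)), Matrix.trace]
  refine Finset.sum_congr rfl fun i _ => ?_
  rw [bil_ev_left, Matrix.diag_apply, LinearMap.toMatrix_apply, Pi.basisFun_repr,
    Pi.basisFun_apply]
  have h : i + 4 + 4 = i := by
    rw [add_assoc]
    exact add_zero i
  have h1 : (ev i : Fin 8 → F) = Pi.single i 1 := by
    ext j
    rw [ev_apply, Pi.single_apply]
  rw [h, h1]

theorem IsIso.trace_eq_zero_of_sq {f : Module.End F (Fin 8 → F)} (hf : IsIso f)
    (h2 : (2 : F) ≠ 0) (hsq : ∀ v, f (f v) = -v) : LinearMap.trace F (Fin 8 → F) f = 0 := by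
  have h : LinearMap.trace F (Fin 8 → F) f = -LinearMap.trace F (Fin 8 → F) f := by
    conv_lhs => rw [trace_eq_sum_bil, ← Equiv.sum_comp (Equiv.addRight (4 : Fin 8))]
    rw [trace_eq_sum_bil, ← Finset.sum_neg_distrib]
    refine Finset.sum_congr rfl fun i _ => ?_
    have h : i + 4 + 4 = i := by
      rw [add_assoc]
      exact add_zero i
    rw [Equiv.coe_addRight, h, ← hf.bil (ev i), hsq, bil_comm, ← neg_one_smul F, bil_smul_left,
      neg_one_mul]
  have h' : (2 : F) * LinearMap.trace F (Fin 8 → F) f = 0 := by linear_combination h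
  exact (mul_eq_zero.1 h').resolve_left h2

namespace IrreduciblePair

variable {a b : Module.End F (Fin 8 → F)}

theorem finrank_fixedSpace_le (h : IrreduciblePair a b) {s : F} (hs : s ^ 2 = 1) :
    Module.finrank F (fixedSpace (s • a)) ≤ 5 := by
  have h1 := h.three_le_finrank_range s
  have h2 := LinearMap.finrank_range_add_finrank_ker (a - s • 1)
  rw [Module.finrank_fin_fun] at h2
  have h3 : LinearMap.ker (a - s • 1) = fixedSpace (s • a) := by
    ext v
    rw [mem_fixedSpace, LinearMap.mem_ker, LinearMap.sub_apply, sub_eq_zero, LinearMap.smul_apply,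
      LinearMap.smul_apply, Module.End.one_apply]
    constructor
    · intro hv
      rw [hv, smul_smul, ← sq, hs, one_smul]
    · intro hv
      conv_rhs => rw [← hv]
      rw [smul_smul, ← sq, hs, one_smul]
  rw [h3] at h2
  omega

theorem eight_le_add_finrank_fixedSpace (h : IrreduciblePair a b) :
    8 ≤ Module.finrank F (fixedSpace a) + Module.finrank F (fixedSpace ((-1 : F) • a)) := by
  have h1 := finrank_ker_mul_le (a - 1) ((-1 : F) • a - 1)
  have h0 : (a - 1) * ((-1 : F) • a - 1) = 0 := by
    refine LinearMap.ext fun v => ?_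
    have hv : a (a v) = v := by
      rw [← Module.End.mul_apply, ← sq, h.sq_left, Module.End.one_apply]
    simp only [Module.End.mul_apply, LinearMap.sub_apply, LinearMap.smul_apply,
      Module.End.one_apply, map_sub, map_smul, hv, LinearMap.zero_apply]
    module
  rw [h0, LinearMap.ker_zero, finrank_top, Module.finrank_fin_fun] at h1
  exact h1

theorem finrank_fixedSpace (h : IrreduciblePair a b) (he : Even (Module.finrank F (fixedSpace a))) :
    Module.finrank F (fixedSpace a) = 4 := by
  have h1 := h.eight_le_add_finrank_fixedSpace
  have h2 := h.finrank_fixedSpace_le (s := 1) (by norm_num)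
  have h3 := h.finrank_fixedSpace_le (s := -1) (by norm_num)
  rw [one_smul] at h2
  obtain ⟨k, hk⟩ := he
  omega

theorem trace_left (h : IrreduciblePair a b) (h2 : (2 : F) ≠ 0)
    (he : Even (Module.finrank F (fixedSpace a))) : LinearMap.trace F (Fin 8 → F) a = 0 := by
  have hp : LinearMap.IsProj (fixedSpace a) ((2⁻¹ : F) • (1 + a)) := by
    refine ⟨fun v => ?_, fun v hv => ?_⟩
    · have hv : a (a v) = v := by
        rw [← Module.End.mul_apply, ← sq, h.sq_left, Module.End.one_apply]
      rw [mem_fixedSpace, LinearMap.smul_apply, LinearMap.add_apply, map_smul, map_add, hv,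
        Module.End.one_apply, add_comm]
    · rw [LinearMap.smul_apply, LinearMap.add_apply, mem_fixedSpace.1 hv, Module.End.one_apply,
        ← two_smul F v, smul_smul, inv_mul_cancel₀ h2, one_smul]
  have ht := hp.trace
  rw [h.finrank_fixedSpace he, map_smul, map_add, LinearMap.trace_one, Module.finrank_fin_fun,
    smul_eq_mul, inv_mul_eq_iff_eq_mul₀ h2] at ht
  push_cast at ht
  linear_combination ht

end IrreduciblePair

theorem sq_eq_one_of_generate {X : Fin 3 → GL (Fin 8) F} (h2 : (2 : F) ≠ 0)
    (hX : X ∈ trialityGroup F) (hsq : X 0 ^ 2 = 1)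
    (htr : LinearMap.trace F (Fin 8 → F) (act (X 0)) = 0) : X ^ 2 = 1 := by
  obtain ⟨c, hc, h1, h2'⟩ := exists_sign_of_mem (pow_mem hX 2) (by simpa using hsq)
  have hact : ∀ i v, act ((X ^ 2) i) v = act (X i) (act (X i) v) := fun i v => by
    rw [Pi.pow_apply, sq, act_mul, Module.End.mul_apply]
  rcases sq_eq_one_iff.1 hc with rfl | rfl
  · funext i
    apply act_injective
    refine LinearMap.ext fun v => ?_
    rw [Pi.one_apply, act_one, Module.End.one_apply]
    fin_cases i
    · simp [hsq, act_one]
    · simpa using h1 v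
    · simpa using h2' v
  · exfalso
    have ht2 : LinearMap.trace F (Fin 8 → F) (act (X 2)) = 0 :=
      (act_isIso (hX.1 2)).trace_eq_zero_of_sq h2 fun v => by rw [← hact, h2', neg_one_smul]
    obtain ⟨v, hv, hfix⟩ := (hX.2 1).exists_fixed (act_isIso (hX.1 1)) (act_isIso (hX.1 2))
      (act_isIso (hX.1 0)) (ht2.trans htr.symm)
    have h3 := h1 v
    rw [hact, hfix, hfix, neg_one_smul, eq_neg_iff_add_eq_zero, ← two_smul F v] at h3
    exact hv ((smul_eq_zero.1 h3).resolve_left h2)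

theorem Related.neg {f g h : Module.End F (Fin 8 → F)} (H : Related f g h) :
    Related ((-1 : F) • f) ((-1 : F) • g) h := fun u v => by
  rw [LinearMap.smul_apply, LinearMap.smul_apply, H, zorn_smul_left]

theorem IsIso.neg {f : Module.End F (Fin 8 → F)} (hf : IsIso f) : IsIso ((-1 : F) • f) := fun v => by
  rw [LinearMap.smul_apply, QPlus_smul, hf]
  ring

theorem exists_sq_eq_sq (t : Fin 3 → ZMod 3) : ∃ k, t (k + 1) = t (k + 2) ∨
    -t (k + 1) = t (k + 2) := by
  revert t
  decide +kernel

/-- Lifts of a generating pair over the field with three elements cannot exist: the three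
traces of the product cannot have pairwise different squares, so that the product or its negative
has a fixed vector in one of the three modules, against the inequality of Scott. -/
theorem not_generate_three {x y : GL (Fin 8) (ZMod 3)} (hx : x ^ 2 = 1) (hy : y ^ 3 = 1)
    (hgen : Subgroup.closure {x, y} = derivedGroup (ZMod 3)) : False := by
  have h2 : (2 : ZMod 3) ≠ 0 := by decide
  obtain ⟨X, hX, rfl⟩ := exists_trialityGroup 0
    (hgen ▸ Subgroup.subset_closure (Set.mem_insert _ _) : x ∈ derivedGroup (ZMod 3))
  obtain ⟨Y', hY', rfl⟩ := exists_trialityGroup 0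
    (hgen ▸ Subgroup.subset_closure (Set.mem_insert_of_mem _ rfl) : y ∈ derivedGroup (ZMod 3))
  obtain ⟨Y, hY, hY0, hY3⟩ : ∃ Y ∈ trialityGroup (ZMod 3), Y 0 = Y' 0 ∧ Y ^ 3 = 1 := by
    refine ⟨Y' ^ 4, pow_mem hY' 4, ?_, ?_⟩
    · rw [Pi.pow_apply, pow_succ, hy, one_mul]
    · obtain ⟨c, hc, h1, h2⟩ := exists_sign_of_mem (pow_mem hY' 3) (by simpa using hy)
      have hc4 : ∀ v : Fin 8 → ZMod 3, c • c • c • c • v = v := fun v => by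
        rw [smul_smul, smul_smul, smul_smul, ← sq, hc, one_mul, ← sq, hc, one_smul]
      have h4 : ∀ i v, act (((Y' ^ 4) ^ 3) i) v = act ((Y' ^ 3) i) (act ((Y' ^ 3) i)
          (act ((Y' ^ 3) i) (act ((Y' ^ 3) i) v))) := fun i v => by
        rw [← pow_mul, mul_comm, pow_mul, Pi.pow_apply]
        simp only [pow_succ, pow_zero, one_mul, act_mul, Module.End.mul_apply]
      funext i
      apply act_injective
      refine LinearMap.ext fun v => ?_
      rw [h4, Pi.one_apply, act_one, Module.End.one_apply]
      fin_cases i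
      · simp [hy, act_one]
      · simp only [Fin.mk_one, h1, hc4]
      · simp only [Fin.reduceFinMk, h2, hc4]
  rw [← hY0] at hgen
  have hpair : ∀ i, X i ^ 2 = 1 → IrreduciblePair (act (X i)) (act (Y i)) := fun i hi =>
    ⟨act_isIso (hX.1 i), act_isIso (hY.1 i), by rw [sq, ← act_mul, ← sq, hi, act_one], by
      have h3 := congrFun hY3 i
      rw [Pi.pow_apply, Pi.one_apply] at h3
      rw [pow_succ, sq, ← act_mul, ← act_mul, ← sq, ← pow_succ, h3, act_one],
      fun W h1 h2 h0 => irreducible_of_generate hX hY hgen i h1 h2 h0⟩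
  have heven : ∀ i, Even (Module.finrank (ZMod 3) (fixedSpace (act (X i)))) := fun i =>
    even_finrank_fixedSpace (hX.1 i)
  have hX2 : X ^ 2 = 1 := sq_eq_one_of_generate h2 hX hx ((hpair 0 hx).trace_left h2 (heven 0))
  have hZ := mul_mem hX hY
  obtain ⟨k, hk⟩ := exists_sq_eq_sq fun i => LinearMap.trace (ZMod 3) _ (act ((X * Y) i))
  have hP := hpair k (congrFun hX2 k)
  obtain ⟨s, hs, v, hv, hfix⟩ : ∃ s : ZMod 3, (s = 1 ∨ s = -1) ∧ ∃ v, v ≠ 0 ∧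
      (s • act (X k) * act (Y k)) v = v := by
    rcases hk with hk | hk
    · obtain ⟨v, hv, h⟩ := (hZ.2 k).exists_fixed (act_isIso (hZ.1 _)) (act_isIso (hZ.1 _))
        (act_isIso (hZ.1 _)) hk
      refine ⟨1, Or.inl rfl, v, hv, ?_⟩
      rwa [Pi.mul_apply, act_mul, ← one_smul (ZMod 3) (act (X k))] at h
    · obtain ⟨v, hv, h⟩ := (hZ.2 k).neg.exists_fixed (act_isIso (hZ.1 _)).neg
        (act_isIso (hZ.1 _)).neg (act_isIso (hZ.1 _)) (by rw [map_smul, neg_one_smul]; exact hk)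
      refine ⟨-1, Or.inr rfl, v, hv, ?_⟩
      rwa [Pi.mul_apply, act_mul, ← smul_mul_assoc] at h
  have hXs : 4 ≤ Module.finrank (ZMod 3) (fixedSpace (s • act (X k))) ∧ IsIso (s • act (X k)) := by
    have h4 := hP.finrank_fixedSpace (heven k)
    rcases hs with rfl | rfl
    · rw [one_smul]
      exact ⟨h4.ge, hP.isIso_left⟩
    · have := hP.eight_le_add_finrank_fixedSpace
      exact ⟨by omega, hP.isIso_left.neg⟩
  have hs2 : s * s = 1 := by rcases hs with rfl | rfl <;> decide
  have hsc := scott hXs.2 hP.isIso_right fun v h1 h2 => by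
    by_contra hv
    have h8 := hP.eight_le_finrank (W := ZMod 3 ∙ v) (fun w hw => by
      obtain ⟨c, rfl⟩ := Submodule.mem_span_singleton.1 hw
      have h3 : act (X k) v = s • v := by
        conv_rhs => rw [← h1]
        rw [LinearMap.smul_apply, smul_smul, hs2, one_smul]
      rw [map_smul, h3]
      exact Submodule.smul_mem _ _ (Submodule.smul_mem _ _ (Submodule.mem_span_singleton_self v)))
      (fun w hw => by
        obtain ⟨c, rfl⟩ := Submodule.mem_span_singleton.1 hw
        rwa [map_smul, h2]) (by rwa [Ne, Submodule.span_singleton_eq_bot])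
    rw [finrank_span_singleton hv] at h8
    omega
  have hw : 1 ≤ Module.finrank (ZMod 3) (fixedSpace (s • act (X k) * act (Y k))) := by
    rw [Nat.one_le_iff_ne_zero, Ne, Submodule.finrank_eq_zero]
    intro h0
    have : v ∈ fixedSpace (s • act (X k) * act (Y k)) := mem_fixedSpace.2 hfix
    rw [h0] at this
    exact hv this
  have hy3 : 3 ≤ Module.finrank (ZMod 3) (fixedSpace (act (Y k))) := by
    have h0 : (act (Y k) - 1) * ((act (Y k) - 1) * (act (Y k) - 1)) = 0 := by
      refine LinearMap.ext fun v => ?_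
      have h3 : act (Y k) (act (Y k) (act (Y k) v)) = v := by
        have := LinearMap.congr_fun hP.cube_right v
        simpa only [pow_succ, pow_zero, one_mul, Module.End.mul_apply,
          Module.End.one_apply] using this
      simp only [Module.End.mul_apply, LinearMap.sub_apply, Module.End.one_apply, map_sub, h3,
        LinearMap.zero_apply]
      have h3' : (3 : ZMod 3) = 0 := rfl
      ext j
      simp only [Pi.sub_apply, Pi.zero_apply]
      linear_combination h3' * (act (Y k) v j - act (Y k) (act (Y k) v) j)
    have h1 := finrank_ker_mul_le (act (Y k) - 1) ((act (Y k) - 1) * (act (Y k) - 1))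
    have h2 := finrank_ker_mul_le (act (Y k) - 1) (act (Y k) - 1)
    rw [h0, LinearMap.ker_zero, finrank_top, Module.finrank_fin_fun] at h1
    rw [fixedSpace]
    omega
  obtain ⟨m, hm⟩ := even_finrank_fixedSpace (hY.1 k)
  omega

end

theorem eq_of_trialityGroup_two {s t : Fin 3 → GL (Fin 8) (ZMod 2)}
    (hs : s ∈ trialityGroup (ZMod 2)) (ht : t ∈ trialityGroup (ZMod 2)) (h : s 0 = t 0) :
    s = t := by
  have h1 : ∀ c : ZMod 2, c ^ 2 = 1 → c = 1 := by decide
  obtain ⟨c, hc, e1, e2⟩ := exists_sign_of_mem (mul_mem (inv_mem hs) ht) (by simp [h])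
  obtain rfl := h1 c hc
  rw [← inv_mul_eq_one]
  funext i
  apply act_injective
  refine LinearMap.ext fun v => ?_
  rw [Pi.one_apply, act_one, Module.End.one_apply]
  fin_cases i
  · simp [h, act_one]
  · simpa using e1 v
  · simpa using e2 v

theorem closure_trialityGroup_two {X Y : Fin 3 → GL (Fin 8) (ZMod 2)}
    (hX : X ∈ trialityGroup (ZMod 2)) (hY : Y ∈ trialityGroup (ZMod 2))
    (hgen : Subgroup.closure {X 0, Y 0} = derivedGroup (ZMod 2)) (i : Fin 3) :
    Subgroup.closure {X i, Y i} = derivedGroup (ZMod 2) := by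
  have hle : Subgroup.closure {X, Y} ≤ trialityGroup (ZMod 2) := by
    rw [Subgroup.closure_le]
    rintro t (rfl | rfl)
    exacts [hX, hY]
  have himage : ∀ j, (Subgroup.closure {X, Y}).map (Pi.evalMonoidHom (fun _ => GL (Fin 8) (ZMod 2)) j)
      = Subgroup.closure {X j, Y j} := fun j => by
    rw [MonoidHom.map_closure, Set.image_pair]
    rfl
  rw [← himage]
  apply le_antisymm
  · rintro _ ⟨t, ht, rfl⟩
    exact (hle ht).1 i
  · intro g hg
    obtain ⟨t, ht, rfl⟩ := exists_trialityGroup i hg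
    have h0 := ht.1 0
    rw [← hgen, ← himage] at h0
    obtain ⟨s, hs, h⟩ := h0
    obtain rfl := eq_of_trialityGroup_two (hle hs) ht h
    exact ⟨s, hs, rfl⟩

theorem exists_pair_with_fixed_vector {x y : GL (Fin 8) (ZMod 2)} (hx : x ^ 2 = 1) (hy : y ^ 3 = 1)
    (hgen : Subgroup.closure {x, y} = derivedGroup (ZMod 2)) :
    ∃ x y : GL (Fin 8) (ZMod 2), x ^ 2 = 1 ∧ y ^ 3 = 1 ∧
      Subgroup.closure {x, y} = derivedGroup (ZMod 2) ∧ ∃ v, v ≠ 0 ∧ act (x * y) v = v := by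
  obtain ⟨X, hX, rfl⟩ := exists_trialityGroup 0
    (hgen ▸ Subgroup.subset_closure (Set.mem_insert _ _) : x ∈ derivedGroup (ZMod 2))
  obtain ⟨Y, hY, rfl⟩ := exists_trialityGroup 0
    (hgen ▸ Subgroup.subset_closure (Set.mem_insert_of_mem _ rfl) : y ∈ derivedGroup (ZMod 2))
  have hZ := mul_mem hX hY
  obtain ⟨k, hk⟩ : ∃ k : Fin 3, LinearMap.trace (ZMod 2) _ (act ((X * Y) (k + 1))) =
      LinearMap.trace (ZMod 2) _ (act ((X * Y) (k + 2))) := by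
    have h : ∀ t : Fin 3 → ZMod 2, ∃ k, t (k + 1) = t (k + 2) := by decide +kernel
    exact h fun i => LinearMap.trace (ZMod 2) _ (act ((X * Y) i))
  have hX2 : X ^ 2 = 1 := eq_of_trialityGroup_two (pow_mem hX 2) (one_mem _) (by simpa using hx)
  have hY3 : Y ^ 3 = 1 := eq_of_trialityGroup_two (pow_mem hY 3) (one_mem _) (by simpa using hy)
  exact ⟨X k, Y k, congrFun hX2 k, congrFun hY3 k, closure_trialityGroup_two hX hY hgen k,
    (hZ.2 k).exists_fixed (act_isIso (hZ.1 _)) (act_isIso (hZ.1 _)) (act_isIso (hZ.1 _)) hk⟩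

/-- A set of vectors invariant under a generating pair contains all nonzero singular vectors as soon
as it contains one of them. -/
theorem mem_of_invariant {x y : GL (Fin 8) (ZMod 2)} (hx : x ^ 2 = 1) (hy : y ^ 3 = 1)
    (hgen : Subgroup.closure {x, y} = derivedGroup (ZMod 2)) {S : Set (Fin 8 → ZMod 2)}
    (hSx : ∀ v ∈ S, act x v ∈ S) (hSy : ∀ v ∈ S, act y v ∈ S) {u v : Fin 8 → ZMod 2} (hu : u ∈ S)
    (hu0 : u ≠ 0) (huQ : QPlus (ZMod 2) u = 0) (hv0 : v ≠ 0) (hvQ : QPlus (ZMod 2) v = 0) :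
    v ∈ S := by
  obtain ⟨g, hg, rfl⟩ := (hasRoots_derivedGroup.moves huQ hu0).trans
    (hasRoots_derivedGroup.moves hvQ hv0).symm
  rw [← hgen] at hg
  have key : ∀ v, v ∈ S ↔ act g v ∈ S := by
    clear hv0 hvQ
    induction hg using Subgroup.closure_induction with
    | mem g hg =>
      intro v
      rcases hg with rfl | rfl
      · refine ⟨hSx v, fun h => ?_⟩
        have := hSx _ h
        rwa [← Module.End.mul_apply, ← act_mul, ← sq, hx, act_one] at this
      · refine ⟨hSy v, fun h => ?_⟩
        have := hSy _ (hSy _ h)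
        rwa [← Module.End.mul_apply, ← Module.End.mul_apply, ← act_mul, ← act_mul, ← sq, ← pow_succ,
          hy, act_one] at this
    | one => simp [act_one]
    | mul a b _ _ ha hb =>
      intro v
      rw [act_mul, Module.End.mul_apply, ← ha, ← hb]
    | inv a _ ha =>
      intro v
      rw [ha (act a⁻¹ v), ← Module.End.mul_apply, ← act_mul, mul_inv_cancel, act_one,
        Module.End.one_apply]
  exact (key u).1 hu

namespace IrreduciblePair

variable {a b : Module.End (ZMod 2) (Fin 8 → ZMod 2)}

theorem left_left (h : IrreduciblePair a b) (v : Fin 8 → ZMod 2) : a (a v) = v := by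
  rw [← Module.End.mul_apply, ← sq, h.sq_left, Module.End.one_apply]

theorem right_right_right (h : IrreduciblePair a b) (v : Fin 8 → ZMod 2) : b (b (b v)) = v := by
  have := LinearMap.congr_fun h.cube_right v
  simpa only [pow_succ, pow_zero, one_mul, Module.End.mul_apply, Module.End.one_apply] using this

theorem eq_zero_of_mem (h : IrreduciblePair a b) {W : Submodule (ZMod 2) (Fin 8 → ZMod 2)}
    (ha : ∀ w ∈ W, a w ∈ W) (hb : ∀ w ∈ W, b w ∈ W)
    (hW : Module.finrank (ZMod 2) W < 8) : ∀ w ∈ W, w = 0 := by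
  intro w hw
  by_contra hw0
  have := h.eight_le_finrank ha hb ((Submodule.ne_bot_iff W).2 ⟨w, hw, hw0⟩)
  omega

theorem sup_map_eq_bot (h : IrreduciblePair a b) {N : Submodule (ZMod 2) (Fin 8 → ZMod 2)}
    (hN : ∀ n ∈ N, a n = b n) (hNb : ∀ n ∈ N, b (b n) ∈ N ⊔ N.map b)
    (hd : Module.finrank (ZMod 2) N ≤ 2) : ∀ n ∈ N, n = 0 := by
  have h1 := Submodule.finrank_add_le_finrank_add_finrank N (N.map b)
  have h2 := Submodule.finrank_map_le b N
  have h3 := h.eq_zero_of_mem (W := N ⊔ N.map b) (fun w hw => by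
    obtain ⟨n, hn, _, ⟨m, hm, rfl⟩, rfl⟩ := Submodule.mem_sup.1 hw
    rw [map_add, hN n hn, ← hN m hm, h.left_left]
    exact add_mem (Submodule.mem_sup_right ⟨n, hn, rfl⟩) (Submodule.mem_sup_left hm))
    (fun w hw => by
      obtain ⟨n, hn, _, ⟨m, hm, rfl⟩, rfl⟩ := Submodule.mem_sup.1 hw
      rw [map_add]
      exact add_mem (Submodule.mem_sup_right ⟨n, hn, rfl⟩) (hNb m hm)) (by omega)
  exact fun n hn => h3 n (Submodule.mem_sup_left hn)

/-- The vectors on which the two generators agree. -/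
def coincide (a b : Module.End (ZMod 2) (Fin 8 → ZMod 2)) :
    Submodule (ZMod 2) (Fin 8 → ZMod 2) := LinearMap.eqLocus a b

theorem mem_coincide {v : Fin 8 → ZMod 2} : v ∈ coincide a b ↔ a v = b v := Iff.rfl

theorem fixedSpace_mul (h : IrreduciblePair a b) : fixedSpace (a * b) = coincide a b := by
  ext v
  rw [mem_fixedSpace, mem_coincide, Module.End.mul_apply]
  constructor
  · intro hv
    conv_lhs => rw [← hv]
    rw [h.left_left]
  · intro hv
    rw [← hv, h.left_left]

theorem add_add_eq_zero_iff {u v w : Fin 8 → ZMod 2} : u + v + w = 0 ↔ w = u + v := by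
  rw [add_eq_zero_iff_eq_neg, ZModModule.neg_eq_self, eq_comm]

theorem norm_injective (h : IrreduciblePair a b) {k : Fin 8 → ZMod 2} (hk : k ∈ coincide a b)
    (h0 : k + b k + b (b k) = 0) : k = 0 := by
  refine h.sup_map_eq_bot (N := ZMod 2 ∙ k) ?_ ?_ ?_ k (Submodule.mem_span_singleton_self k)
  · intro n hn
    obtain ⟨c, rfl⟩ := Submodule.mem_span_singleton.1 hn
    exact (coincide a b).smul_mem c hk
  · intro n hn
    obtain ⟨c, rfl⟩ := Submodule.mem_span_singleton.1 hn
    rw [map_smul, map_smul, add_add_eq_zero_iff.1 h0, smul_add]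
    exact add_mem (Submodule.mem_sup_left hn) (Submodule.mem_sup_right ⟨c • k, hn, map_smul _ _ _⟩)
  · exact (finrank_span_le_card {k}).trans (by simp)

theorem finrank_coincide (h : IrreduciblePair a b)
    (ha : Even (Module.finrank (ZMod 2) (fixedSpace a)))
    (hb : Even (Module.finrank (ZMod 2) (fixedSpace b)))
    (hab : Even (Module.finrank (ZMod 2) (fixedSpace (a * b))))
    {v : Fin 8 → ZMod 2} (hv : v ≠ 0) (hfix : (a * b) v = v) :
    Module.finrank (ZMod 2) (coincide a b) = 2 ∧ Module.finrank (ZMod 2) (fixedSpace b) = 2 := by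
  have h4 := h.finrank_fixedSpace ha
  have hsc := scott h.isIso_left h.isIso_right h.no_common_fixed
  have pos : ∀ {f : Module.End (ZMod 2) (Fin 8 → ZMod 2)} {u}, u ≠ 0 → f u = u →
      1 ≤ Module.finrank (ZMod 2) (fixedSpace f) := by
    intro f u hu hf
    rw [Nat.one_le_iff_ne_zero, Ne, Submodule.finrank_eq_zero]
    intro h0
    have : u ∈ fixedSpace f := mem_fixedSpace.2 hf
    rw [h0] at this
    exact hu this
  have h1 := pos hv hfix
  have hvK : v ∈ coincide a b := h.fixedSpace_mul ▸ mem_fixedSpace.2 hfix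
  have h2 := pos (f := b) (fun h0 => hv (h.norm_injective hvK h0)) (by
    rw [map_add, map_add, h.right_right_right]; abel)
  rw [← h.fixedSpace_mul]
  obtain ⟨k, hk⟩ := hb
  obtain ⟨m, hm⟩ := hab
  omega

theorem exists_norm (h : IrreduciblePair a b)
    (hK : Module.finrank (ZMod 2) (coincide a b) = 2)
    (hb : Module.finrank (ZMod 2) (fixedSpace b) = 2) {v : Fin 8 → ZMod 2} (hv : b v = v) :
    ∃ k ∈ coincide a b, k + b k + b (b k) = v := by
  let τ : Module.End (ZMod 2) (Fin 8 → ZMod 2) := 1 + b + b * b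
  have hle : (coincide a b).map τ ≤ fixedSpace b := by
    rintro _ ⟨k, -, rfl⟩
    rw [mem_fixedSpace]
    change b (k + b k + b (b k)) = k + b k + b (b k)
    rw [map_add, map_add, h.right_right_right]
    abel
  have hinj : Function.Injective (τ.domRestrict (coincide a b)) := by
    rw [← LinearMap.ker_eq_bot, LinearMap.ker_eq_bot']
    exact fun k hk => Subtype.ext (h.norm_injective k.2 hk)
  have hr := LinearMap.finrank_range_of_inj hinj
  rw [LinearMap.range_domRestrict] at hr
  have heq := Submodule.eq_of_le_of_finrank_eq hle (by rw [hr, hK, hb])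
  have : v ∈ (coincide a b).map τ := by rwa [heq, mem_fixedSpace]
  obtain ⟨k, hk, rfl⟩ := this
  exact ⟨k, hk, rfl⟩

theorem independent (h : IrreduciblePair a b)
    (hK : Module.finrank (ZMod 2) (coincide a b) = 2) {α β γ : Fin 8 → ZMod 2}
    (hα : α ∈ coincide a b) (hβ : β ∈ coincide a b) (hγ : γ ∈ coincide a b)
    (h0 : α + b β + b (b γ) = 0) : α = 0 ∧ β = 0 ∧ γ = 0 := by
  let P := coincide a b ⊔ (coincide a b).map b
  let N : Submodule (ZMod 2) (Fin 8 → ZMod 2) := coincide a b ⊓ P.comap (b * b)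
  have hN : ∀ n ∈ N, n = 0 := by
    refine h.sup_map_eq_bot (fun n hn => hn.1) ?_
      ((Submodule.finrank_mono inf_le_left).trans hK.le)
    rintro n ⟨hnK, hnP⟩
    obtain ⟨u, hu, _, ⟨w, hw, rfl⟩, huw⟩ := Submodule.mem_sup.1 hnP
    change u + b w = b (b n) at huw
    have e1 : b u + b (b w) = n := by rw [← map_add, huw, h.right_right_right]
    have e2 : b (b u) + w = b n := by rw [← e1, map_add, h.right_right_right]
    rw [← huw]
    refine add_mem (Submodule.mem_sup_left ⟨hu, ?_⟩) (Submodule.mem_sup_right ⟨w, ⟨hw, ?_⟩, rfl⟩)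
    · change b (b u) ∈ P
      rw [eq_sub_of_add_eq e2]
      exact sub_mem (Submodule.mem_sup_right ⟨n, hnK, rfl⟩) (Submodule.mem_sup_left hw)
    · change b (b w) ∈ P
      rw [eq_sub_of_add_eq' e1]
      exact sub_mem (Submodule.mem_sup_left hnK) (Submodule.mem_sup_right ⟨u, hu, rfl⟩)
  have hγ0 : γ = 0 := by
    refine hN γ ⟨hγ, ?_⟩
    change b (b γ) ∈ P
    rw [add_add_eq_zero_iff.1 h0]
    exact add_mem (Submodule.mem_sup_left hα) (Submodule.mem_sup_right ⟨β, hβ, rfl⟩)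
  rw [hγ0, map_zero, map_zero, add_zero, add_eq_zero_iff_eq_neg, ZModModule.neg_eq_self] at h0
  have hα' : b α = β := by rw [← mem_coincide.1 hα, h0, ← mem_coincide.1 hβ, h.left_left]
  have hβ' : b β = β := by
    have h3 := h.right_right_right β
    rw [← h0, hα'] at h3
    exact h3
  have hβ0 : β = 0 := h.no_common_fixed β ((mem_coincide.1 hβ).trans hβ') hβ'
  exact ⟨by rw [h0, hβ0, map_zero], hβ0, hγ0⟩

end IrreduciblePair

namespace IrreduciblePair

variable {a b : Module.End (ZMod 2) (Fin 8 → ZMod 2)}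

/-- The eight vectors obtained from `u`, `v` and `l` by applying an endomorphism. -/
def adapted (b : Module.End (ZMod 2) (Fin 8 → ZMod 2)) (u v l : Fin 8 → ZMod 2) :
    Fin 8 → Fin 8 → ZMod 2 := ![u, v, b u, b v, b (b u), b (b v), l, b l]

theorem exists_adapted (h : IrreduciblePair a b)
    (hK : Module.finrank (ZMod 2) (coincide a b) = 2)
    (hb : Module.finrank (ZMod 2) (fixedSpace b) = 2) :
    ∃ u v, a u = b u ∧ a v = b v ∧
      LinearIndependent (ZMod 2) (adapted b u v (a (b (b u)))) ∧
      ∃ c d : ZMod 2, b (b (a (b (b u)))) = a (b (b u)) + b (a (b (b u))) +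
        (c • (u + b u + b (b u)) + d • (v + b v + b (b v))) := by
  let M := coincide a b ⊔ (coincide a b).map b ⊔ (coincide a b).map (b ^ 2)
  have hM : ∀ {α β γ}, α ∈ coincide a b → β ∈ coincide a b → γ ∈ coincide a b →
      α + b β + b (b γ) ∈ M := fun hα hβ hγ => Submodule.add_mem_sup
    (Submodule.add_mem_sup hα ⟨_, hβ, rfl⟩) ⟨_, hγ, by rw [sq]; rfl⟩
  have hMb : ∀ w ∈ M, b w ∈ M := fun w hw => map_sup_invariant h.cube_right _ hw
  obtain ⟨u, hu, huM⟩ : ∃ u ∈ coincide a b, a (b (b u)) ∉ M := by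
    by_contra! hall
    have e1 := Submodule.finrank_add_le_finrank_add_finrank (coincide a b ⊔ (coincide a b).map b)
      ((coincide a b).map (b ^ 2))
    have e2 := Submodule.finrank_add_le_finrank_add_finrank (coincide a b) ((coincide a b).map b)
    have e3 := Submodule.finrank_map_le b (coincide a b)
    have e4 := Submodule.finrank_map_le (b ^ 2) (coincide a b)
    have hzero := h.eq_zero_of_mem (W := M) (fun w hw => by
      obtain ⟨_, hw1, _, ⟨γ, hγ, rfl⟩, rfl⟩ := Submodule.mem_sup.1 hw
      obtain ⟨α, hα, _, ⟨β, hβ, rfl⟩, rfl⟩ := Submodule.mem_sup.1 hw1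
      rw [map_add, map_add, mem_coincide.1 hα, ← mem_coincide.1 hβ, h.left_left, sq]
      refine add_mem ?_ (hall γ hγ)
      simpa [add_comm] using hM hβ hα (zero_mem _)) hMb (by
        change Module.finrank (ZMod 2) ↥(_ ⊔ _ : Submodule (ZMod 2) (Fin 8 → ZMod 2)) < 8
        omega)
    have hbot : coincide a b = ⊥ := (Submodule.eq_bot_iff _).2 fun k hk =>
      hzero k (Submodule.mem_sup_left (Submodule.mem_sup_left hk))
    rw [hbot, finrank_bot] at hK
    omega
  have hu0 : u ≠ 0 := by
    rintro rfl
    simp at huM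
  obtain ⟨v, hv, hvu⟩ : ∃ v ∈ coincide a b, v ∉ ZMod 2 ∙ u := by
    by_contra! hall
    have := Submodule.finrank_mono (show coincide a b ≤ ZMod 2 ∙ u from hall)
    rw [finrank_span_singleton hu0, hK] at this
    omega
  have huv : ∀ c d : ZMod 2, c • u + d • v = 0 → c = 0 ∧ d = 0 := by
    intro c d hcd
    have hd : d = 0 := by
      by_contra hd
      obtain rfl := (show ∀ d : ZMod 2, d ≠ 0 → d = 1 by decide) d hd
      refine hvu (Submodule.mem_span_singleton.2 ⟨-c, ?_⟩)
      rw [one_smul] at hcd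
      rw [neg_smul]
      exact (eq_neg_of_add_eq_zero_right hcd).symm
    rw [hd, zero_smul, add_zero] at hcd
    exact ⟨(smul_eq_zero.1 hcd).resolve_right hu0, hd⟩
  set l := a (b (b u)) with hl
  have hτl : ∃ k ∈ coincide a b, k + b k + b (b k) = l + b l + b (b l) :=
    h.exists_norm hK hb (by rw [map_add, map_add, h.right_right_right]; abel)
  obtain ⟨k, hk, hkl⟩ := hτl
  have hτM : l + b l + b (b l) ∈ M := hkl ▸ hM hk hk hk
  have hlM : ∀ c d : ZMod 2, c • l + d • b l ∈ M → c = 0 ∧ d = 0 := by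
    intro c d hcd
    have hcases : ∀ c d : ZMod 2, (c = 0 ∧ d = 0) ∨ (c = 1 ∧ d = 0) ∨ (c = 0 ∧ d = 1) ∨
        (c = 1 ∧ d = 1) := by decide
    rcases hcases c d with h1 | ⟨rfl, rfl⟩ | ⟨rfl, rfl⟩ | ⟨rfl, rfl⟩
    · exact h1
    · exact absurd (by simpa using hcd) huM
    · have h1 := hMb _ (hMb _ hcd)
      rw [zero_smul, zero_add, one_smul, h.right_right_right] at h1
      exact absurd h1 huM
    · rw [one_smul, one_smul] at hcd
      have h1 := sub_mem hτM (hMb _ hcd)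
      rw [map_add] at h1
      exact absurd (by convert h1 using 1; abel) huM
  have hmem : ∀ c d : ZMod 2, c • u + d • v ∈ coincide a b := fun c d =>
    add_mem (Submodule.smul_mem _ _ hu) (Submodule.smul_mem _ _ hv)
  refine ⟨u, v, hu, hv, ?_, ?_⟩
  · rw [Fintype.linearIndependent_iff]
    intro g hg
    simp only [Fin.sum_univ_eight, adapted] at hg
    change g 0 • u + g 1 • v + g 2 • b u + g 3 • b v + g 4 • b (b u) + g 5 • b (b v) + g 6 • l +
      g 7 • b l = 0 at hg
    have hsum : (g 0 • u + g 1 • v) + b (g 2 • u + g 3 • v) + b (b (g 4 • u + g 5 • v)) +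
        (g 6 • l + g 7 • b l) = 0 := by
      rw [← hg]
      simp only [map_add, map_smul]
      abel
    obtain ⟨h6, h7⟩ := hlM (g 6) (g 7) (by
      rw [eq_neg_of_add_eq_zero_right hsum]
      exact neg_mem (hM (hmem _ _) (hmem _ _) (hmem _ _)))
    rw [h6, h7, zero_smul, zero_smul, add_zero, add_zero] at hsum
    obtain ⟨e0, e1, e2⟩ := h.independent hK (hmem _ _) (hmem _ _) (hmem _ _) hsum
    have r0 := huv _ _ e0
    have r1 := huv _ _ e1
    have r2 := huv _ _ e2
    intro i
    fin_cases i
    exacts [r0.1, r0.2, r1.1, r1.2, r2.1, r2.2, h6, h7]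
  · obtain ⟨c, d, hcd⟩ : ∃ c d : ZMod 2, k = c • u + d • v := by
      have hf := finrank_span_eq_card (LinearIndependent.pair_iff.2 huv)
      rw [Matrix.range_cons, Matrix.range_cons, Matrix.range_empty, Set.union_empty,
        Set.singleton_union, Fintype.card_fin] at hf
      have heq : Submodule.span (ZMod 2) {u, v} = coincide a b := by
        refine Submodule.eq_of_le_of_finrank_eq (Submodule.span_le.2 ?_) (hf.trans hK.symm)
        rintro _ (rfl | rfl) <;> assumption
      rw [← heq, Submodule.mem_span_pair] at hk
      obtain ⟨c, d, h⟩ := hk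
      exact ⟨c, d, h.symm⟩
    refine ⟨c, d, ?_⟩
    have : b (b l) = l + b l + (k + b k + b (b k)) := by
      rw [hkl, ← add_assoc, ZModModule.add_self, zero_add]
    rw [this, hcd]
    simp only [map_add, map_smul, smul_add]
    abel

end IrreduciblePair

/-- The lowest binary digit. -/
def lowBit (n : ℕ) : Bool := Nat.beq (n % 2) 1

/-- The linear map on binary vectors (written as numbers) with the given list of columns. -/
def linBits : List ℕ → ℕ → ℕ
  | [], _ => 0
  | c :: cs, n => (bif lowBit n then c else 0) ^^^ linBits cs (n / 2)

/-- The linear functional on binary vectors with the given list of values. -/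
def funBits : List Bool → ℕ → Bool
  | [], _ => false
  | c :: cs, n => (lowBit n && c) ^^ funBits cs (n / 2)

/-- The quadratic form on binary vectors whose values on basis vectors are given together with
the values of the polar form on later basis vectors. -/
def quadBits : List (Bool × List Bool) → ℕ → Bool
  | [], _ => false
  | d :: D, n => (lowBit n && (d.1 ^^ funBits d.2 (n / 2))) ^^ quadBits D (n / 2)

/-- The number of zeros of a Boolean function below a bound. -/
def countZeros (f : ℕ → Bool) : ℕ → ℕ
  | 0 => 0
  | n + 1 => bif f n then countZeros f n else countZeros f n + 1

/-- The quadratic form in an adapted basis. -/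
def formData (q₁ q₂ s s₁₁ s₁₂ s₂₂ t₁ t₂ u : Bool) : List (Bool × List Bool) :=
  [(q₁, [s, s₁₁, s₁₂, s₁₁, s₁₂, s₁₁, t₁]), (q₂, [s₁₂, s₂₂, s₁₂, s₂₂, s₁₂, t₂]),
    (q₁, [s, s₁₁, s₁₂, s₁₁, s₁₁]), (q₂, [s₁₂, s₂₂, s₁₂, s₁₂]), (q₁, [s, t₁, s₁₁]),
    (q₂, [t₂, s₁₂]), (q₁, [u]), (q₁, [])]

/-- The columns of the involution in an adapted basis. -/
def leftColumns (p r : ℕ) : List ℕ := [4, 8, 1, 2, 64, p, 16, r]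

/-- The columns of the element of order three in an adapted basis. -/
def rightColumns (c d : Bool) : List ℕ :=
  [4, 8, 16, 32, 1, 2, 128, 192 ^^^ ((bif c then 21 else 0) ^^^ (bif d then 42 else 0))]

/-- Sets of singular vectors that occur as invariant sets. -/
def singularSets : List (List ℕ) :=
  [[3, 12, 48], [2, 8, 32], [2, 3, 8, 12, 32, 48, 85, 149, 213],
    [1, 3, 4, 12, 16, 48, 64, 128, 234], [1, 2, 4, 8, 16, 32, 64, 128, 255],
    [5, 6, 7, 9, 10, 11, 13, 14, 15, 17, 18, 19, 20, 24, 28, 33, 34, 35, 36, 40, 44, 49, 50, 51, 52,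
      56, 60, 65, 66, 67, 68, 72, 76, 80, 96, 112, 129, 130, 131, 132, 136, 140, 144, 160, 176, 193,
      194, 195, 196, 200, 204, 208, 224, 240],
    [2, 8, 32, 90, 117, 151, 169, 204, 247], [3, 12, 48, 95, 101, 150, 189, 200, 230],
    [1, 4, 16, 64, 95, 128, 189, 221, 234], [1, 4, 16, 64, 90, 128, 169, 217, 255]]

/-- The given endomorphism preserves the quadratic form on the listed vectors. -/
def preserves (D : List (Bool × List Bool)) (C : List ℕ) (l : List ℕ) : Bool :=
  l.all fun n => quadBits D (linBits C n) == quadBits D n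

/-- The given nonempty set of singular vectors is invariant and proper. -/
def isObstruction (D : List (Bool × List Bool)) (A B S : List ℕ) : Bool :=
  !S.isEmpty && (S.all fun n => S.elem (linBits A n) && S.elem (linBits B n) && !quadBits D n &&
    Nat.ble 1 n && Nat.blt n 256) &&
    (List.range 256).any fun n => Nat.ble 1 n && !quadBits D n && !S.elem n

/-- The possible images of the last basis vector under an involution that maps the sixth basis
vector to `p`. -/
def lastColumns (p : ℕ) : List ℕ :=
  bif Nat.ble 128 p then [linBits (leftColumns p 0) p ^^^ 32]
  else bif Nat.beq (linBits (leftColumns p 0) p) 32 then List.range 256 else []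

/-- A quadratic form of plus type that is preserved by a pair of candidates has an invariant proper
set of singular vectors. -/
def HasObstruction (D : List (Bool × List Bool)) (B : List ℕ) : Prop :=
  preserves D B [128, 129, 130, 132, 136, 144, 160, 192] → countZeros (quadBits D) 256 = 136 →
  ∀ p < 256, preserves D (leftColumns p 0) [32, 33, 34, 36, 40, 48, 96] →
  ∀ r ∈ lastColumns p, linBits (leftColumns p r) r = 128 →
  preserves D (leftColumns p r) [128, 129, 130, 132, 136, 144, 160, 192] →
  singularSets.any fun S => isObstruction D (leftColumns p r) B S

instance (D : List (Bool × List Bool)) (B : List ℕ) : Decidable (HasObstruction D B) := by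
  unfold HasObstruction
  infer_instance

set_option maxRecDepth 100000 in
theorem hasObstruction : ∀ c d q₁ q₂ s s₁₁ s₁₂ s₂₂ t₁ t₂ u : Bool,
    HasObstruction (formData q₁ q₂ s s₁₁ s₁₂ s₂₂ t₁ t₂ u) (rightColumns c d) := by
  decide +kernel

theorem lowBit_eq (n : ℕ) : lowBit n = decide (n % 2 = 1) := by
  rw [lowBit, Bool.eq_iff_iff, Nat.beq_eq, decide_eq_true_iff]

theorem lowBit_xor (m n : ℕ) : lowBit (m ^^^ n) = (lowBit m ^^ lowBit n) := by
  simp only [lowBit_eq, ← Nat.testBit_zero, Nat.testBit_xor]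

/-- The sum of the members of a list of binary vectors selected by the digits of a number. -/
def combBits : List (Fin 8 → ZMod 2) → ℕ → Fin 8 → ZMod 2
  | [], _ => 0
  | e :: es, n => (bif lowBit n then e else 0) + combBits es (n / 2)

theorem combBits_zero (es : List (Fin 8 → ZMod 2)) : combBits es 0 = 0 := by
  induction es with
  | nil => rfl
  | cons e es ih => simp [combBits, ih, lowBit_eq]

theorem combBits_xor (es : List (Fin 8 → ZMod 2)) (m n : ℕ) :
    combBits es (m ^^^ n) = combBits es m + combBits es n := by
  induction es generalizing m n with
  | nil => simp [combBits]
  | cons e es ih =>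
    rw [combBits, combBits, combBits, Nat.xor_div_two, ih, lowBit_xor]
    cases lowBit m <;> cases lowBit n <;> simp [add_assoc, add_left_comm]
    rw [← add_assoc, ZModModule.add_self, zero_add]

theorem map_combBits {L : Module.End (ZMod 2) (Fin 8 → ZMod 2)} {E es : List (Fin 8 → ZMod 2)}
    {cs : List ℕ} (h : List.Forall₂ (fun e c => L e = combBits E c) es cs) (n : ℕ) :
    L (combBits es n) = combBits E (linBits cs n) := by
  induction h generalizing n with
  | nil => simp [combBits, linBits, combBits_zero]
  | cons h _ ih =>
    rw [combBits, linBits, map_add, combBits_xor, ih]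
    cases lowBit n <;> simp [h, combBits_zero]

/-- A binary digit as a scalar. -/
def digit (b : Bool) : ZMod 2 := bif b then 1 else 0

theorem digit_xor (b c : Bool) : digit (b ^^ c) = digit b + digit c := by
  revert b c
  decide

theorem digit_injective : Function.Injective digit := by decide

theorem digit_surjective : Function.Surjective digit := by decide

theorem bil_combBits {w : Fin 8 → ZMod 2} {es : List (Fin 8 → ZMod 2)} {cs : List Bool}
    (h : List.Forall₂ (fun e c => bil w e = digit c) es cs) (n : ℕ) :
    bil w (combBits es n) = digit (funBits cs n) := by
  induction h generalizing n with
  | nil => simp [combBits, funBits, digit, bil]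
  | cons h _ ih =>
    rw [combBits, funBits, bil_add_right, ih, digit_xor]
    cases lowBit n
    · simp [digit, bil]
    · simp [h]

/-- The list of binary vectors has the prescribed values of the quadratic form and of its polar
form. -/
def HasGram : List (Fin 8 → ZMod 2) → List (Bool × List Bool) → Prop
  | e :: es, d :: D => QPlus (ZMod 2) e = digit d.1 ∧
      List.Forall₂ (fun f c => bil e f = digit c) es d.2 ∧ HasGram es D
  | [], [] => True
  | _, _ => False

theorem HasGram.quad {es : List (Fin 8 → ZMod 2)} {D : List (Bool × List Bool)} (h : HasGram es D)
    (n : ℕ) : QPlus (ZMod 2) (combBits es n) = digit (quadBits D n) := by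
  induction es generalizing D n with
  | nil =>
    cases D with
    | nil => simp [combBits, quadBits, digit, QPlus]
    | cons d D => exact h.elim
  | cons e es ih =>
    cases D with
    | nil => exact h.elim
    | cons d D =>
      obtain ⟨h1, h2, h3⟩ := h
      rw [combBits, quadBits, QPlus_add, digit_xor, ih h3]
      cases lowBit n
      · simp [digit, bil, QPlus]
      · simp [h1, bil_combBits h2, digit_xor]
        ring

theorem linBits_lt {cs : List ℕ} (h : ∀ c ∈ cs, c < 256) (n : ℕ) : linBits cs n < 256 := by
  induction cs generalizing n with
  | nil => simp [linBits]
  | cons c cs ih =>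
    rw [linBits]
    refine Nat.xor_lt_two_pow (n := 8) ?_ (ih (fun c hc => h c (List.mem_cons_of_mem _ hc)) _)
    cases lowBit n
    · simp
    · simpa using h c List.mem_cons_self

theorem countZeros_eq (f : ℕ → Bool) (n : ℕ) :
    countZeros f n = ((Finset.range n).filter fun m => f m = false).card := by
  induction n with
  | zero => rfl
  | succ n ih =>
    rw [countZeros, Finset.range_add_one, Finset.filter_insert, ih]
    cases h : f n <;> simp

set_option maxRecDepth 100000 in
theorem card_zeros :
    (Finset.univ.filter fun v : Fin 8 → ZMod 2 => QPlus (ZMod 2) v = 0).card = 136 := by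
  decide +kernel

theorem combBits_surjective {E : Fin 8 → Fin 8 → ZMod 2} (h : LinearIndependent (ZMod 2) E)
    (v : Fin 8 → ZMod 2) : ∃ n < 256, combBits (List.ofFn E) n = v := by
  have htop := h.span_eq_top_of_card_eq_finrank (by simp)
  have hv : v ∈ Submodule.span (ZMod 2) (Set.range E) := htop ▸ Submodule.mem_top
  induction hv using Submodule.span_induction with
  | mem v hv =>
    obtain ⟨i, rfl⟩ := hv
    refine ⟨2 ^ (i : ℕ), ?_, ?_⟩
    · fin_cases i <;> norm_num
    · fin_cases i <;> simp [List.ofFn_succ, combBits, lowBit_eq]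
  | zero => exact ⟨0, by norm_num, combBits_zero _⟩
  | add v w _ _ hv hw =>
    obtain ⟨m, hm, rfl⟩ := hv
    obtain ⟨n, hn, rfl⟩ := hw
    exact ⟨m ^^^ n, Nat.xor_lt_two_pow (n := 8) hm hn, combBits_xor _ _ _⟩
  | smul c v _ hv =>
    obtain ⟨b, rfl⟩ := digit_surjective c
    cases b
    · exact ⟨0, by norm_num, by simp [combBits_zero, digit]⟩
    · simpa [digit] using hv

theorem combBits_injective {E : Fin 8 → Fin 8 → ZMod 2} (h : LinearIndependent (ZMod 2) E)
    {m n : ℕ} (hm : m < 256) (hn : n < 256)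
    (e : combBits (List.ofFn E) m = combBits (List.ofFn E) n) : m = n := by
  have hsurj : Function.Surjective fun n : Fin 256 => combBits (List.ofFn E) n := fun v => by
    obtain ⟨n, hn, rfl⟩ := combBits_surjective h v
    exact ⟨⟨n, hn⟩, rfl⟩
  have := ((Fintype.bijective_iff_surjective_and_card _).2 ⟨hsurj, by simp [ZMod.card]⟩).1
    (show (fun n : Fin 256 => combBits (List.ofFn E) n) ⟨m, hm⟩ =
      (fun n : Fin 256 => combBits (List.ofFn E) n) ⟨n, hn⟩ from e)
  simpa using this

theorem countZeros_quadBits {E : Fin 8 → Fin 8 → ZMod 2} (h : LinearIndependent (ZMod 2) E)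
    {D : List (Bool × List Bool)} (hD : HasGram (List.ofFn E) D) :
    countZeros (quadBits D) 256 = 136 := by
  rw [countZeros_eq, ← card_zeros]
  refine Finset.card_bij (fun n _ => combBits (List.ofFn E) n) (fun n hn => ?_)
    (fun m hm n hn e => ?_) fun v hv => ?_
  · simp only [Finset.mem_filter] at hn
    rw [Finset.mem_filter, hD.quad, hn.2]
    exact ⟨Finset.mem_univ _, rfl⟩
  · exact combBits_injective h (by simpa using (Finset.mem_filter.1 hm).1)
      (by simpa using (Finset.mem_filter.1 hn).1) e
  · obtain ⟨n, hn, rfl⟩ := combBits_surjective h v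
    refine ⟨n, ?_, rfl⟩
    simp only [Finset.mem_filter, Finset.mem_univ, true_and, hD.quad] at hv
    simp only [Finset.mem_filter, Finset.mem_range, hn, true_and]
    exact digit_injective hv

theorem preserves_of_isIso {L : Module.End (ZMod 2) (Fin 8 → ZMod 2)} (hL : IsIso L)
    {es : List (Fin 8 → ZMod 2)} {D : List (Bool × List Bool)} (hD : HasGram es D) {C : List ℕ}
    (hC : List.Forall₂ (fun e c => L e = combBits es c) es C) (l : List ℕ) :
    preserves D C l = true := by
  simp only [preserves, List.all_eq_true, beq_iff_eq]
  intro n _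
  apply digit_injective
  rw [← hD.quad, ← hD.quad, ← map_combBits hC, hL]

theorem mem_lastColumns {p r : ℕ} (hp : p < 256) (hr : r < 256)
    (h : linBits (leftColumns p r) p = 32) : r ∈ lastColumns p := by
  have key : linBits (leftColumns p r) p =
      linBits (leftColumns p 0) p ^^^ bif Nat.ble 128 p then r else 0 := by
    have hb : lowBit (p / 2 / 2 / 2 / 2 / 2 / 2 / 2) = Nat.ble 128 p := by
      rw [lowBit, Bool.eq_iff_iff, Nat.beq_eq, Nat.ble_eq]
      omega
    simp only [linBits, leftColumns, hb, Nat.xor_assoc, Nat.xor_zero, Bool.cond_self]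
  rw [key] at h
  cases hb : Nat.ble 128 p
  · simp only [hb, cond_false, Nat.xor_zero] at h
    simp [lastColumns, hb, h, hr]
  · simp only [hb, cond_true] at h
    simp [lastColumns, hb, ← h]

namespace IrreduciblePair

variable {a b : Module.End (ZMod 2) (Fin 8 → ZMod 2)}

theorem ofFn_adapted (b : Module.End (ZMod 2) (Fin 8 → ZMod 2)) (u v l : Fin 8 → ZMod 2) :
    List.ofFn (adapted b u v l) = [u, v, b u, b v, b (b u), b (b v), l, b l] := by
  simp [List.ofFn_succ, adapted]

theorem exists_hasGram (h : IrreduciblePair a b) {u v : Fin 8 → ZMod 2} (hu : a u = b u)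
    (hv : a v = b v) : ∃ q₁ q₂ s s₁₁ s₁₂ s₂₂ t₁ t₂ w : Bool,
      HasGram (List.ofFn (adapted b u v (a (b (b u)))))
        (formData q₁ q₂ s s₁₁ s₁₂ s₂₂ t₁ t₂ w) := by
  have ha := h.isIso_left.bil
  have hb := h.isIso_right.bil
  have hau : a (b u) = u := by rw [← hu, h.left_left]
  have hav : a (b v) = v := by rw [← hv, h.left_left]
  obtain ⟨q₁, hq₁⟩ := digit_surjective (QPlus (ZMod 2) u)
  obtain ⟨q₂, hq₂⟩ := digit_surjective (QPlus (ZMod 2) v)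
  obtain ⟨s, hs⟩ := digit_surjective (bil u v)
  obtain ⟨s₁₁, hs₁₁⟩ := digit_surjective (bil u (b u))
  obtain ⟨s₁₂, hs₁₂⟩ := digit_surjective (bil u (b v))
  obtain ⟨s₂₂, hs₂₂⟩ := digit_surjective (bil v (b v))
  obtain ⟨t₁, ht₁⟩ := digit_surjective (bil (b (b u)) (a (b (b u))))
  obtain ⟨t₂, ht₂⟩ := digit_surjective (bil (b (b v)) (a (b (b u))))
  obtain ⟨w, hw⟩ := digit_surjective (bil (a (b (b u))) (b (a (b (b u)))))
  have hvbu : bil v (b u) = digit s₁₂ := by rw [← ha, hau, hv, bil_comm, hs₁₂]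
  have hrot : ∀ m n, bil m (b (b n)) = bil n (b m) := fun m n => by
    rw [← hb, h.right_right_right, bil_comm]
  have hul : bil u (a (b (b u))) = digit s₁₁ := by rw [← ha, h.left_left, hu, hb, hs₁₁]
  have hvl : bil v (a (b (b u))) = digit s₁₂ := by rw [← ha, h.left_left, hv, hb, hvbu]
  have hbul : bil (b u) (a (b (b u))) = digit s₁₁ := by rw [← ha, h.left_left, hau, hrot, hs₁₁]
  have hbvl : bil (b v) (a (b (b u))) = digit s₁₂ := by rw [← ha, h.left_left, hav, hrot, hs₁₂]
  have hbl : ∀ m n, bil m (b n) = bil (b (b m)) n := fun m n => by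
    rw [← hb (b (b m)), h.right_right_right]
  refine ⟨q₁, q₂, s, s₁₁, s₁₂, s₂₂, t₁, t₂, w, ?_⟩
  rw [ofFn_adapted]
  simp only [HasGram, formData, List.forall₂_cons, List.forall₂_nil_left_iff, h.isIso_left _,
    h.isIso_right _, hb, hrot, hq₁, hq₂, hs, hs₁₁, hs₁₂, hs₂₂, ht₁, ht₂, hw, hvbu, hul, hvl, hbul,
    hbvl, hbl _ (a _), and_true]

theorem exists_rightColumns (h : IrreduciblePair a b) {u v l : Fin 8 → ZMod 2} {c d : ZMod 2}
    (hl : b (b l) = l + b l + (c • (u + b u + b (b u)) + d • (v + b v + b (b v)))) :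
    ∃ c d, List.Forall₂ (fun e n => b e = combBits (List.ofFn (adapted b u v l)) n)
      (List.ofFn (adapted b u v l)) (rightColumns c d) := by
  obtain ⟨c, rfl⟩ := digit_surjective c
  obtain ⟨d, rfl⟩ := digit_surjective d
  refine ⟨c, d, ?_⟩
  simp only [ofFn_adapted, rightColumns, List.forall₂_cons, combBits_xor, h.right_right_right, hl]
  cases c <;> cases d <;> simp [combBits, lowBit_eq, digit, add_assoc]

theorem exists_leftColumns (h : IrreduciblePair a b) {u v : Fin 8 → ZMod 2} (hu : a u = b u)
    (hv : a v = b v) (hli : LinearIndependent (ZMod 2) (adapted b u v (a (b (b u))))) :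
    ∃ p < 256, ∃ r < 256,
      List.Forall₂ (fun e n => a e = combBits (List.ofFn (adapted b u v (a (b (b u))))) n)
        (List.ofFn (adapted b u v (a (b (b u))))) (leftColumns p r) := by
  have hau : a (b u) = u := by rw [← hu, h.left_left]
  have hav : a (b v) = v := by rw [← hv, h.left_left]
  obtain ⟨p, hp, ep⟩ := combBits_surjective hli (a (b (b v)))
  obtain ⟨r, hr, er⟩ := combBits_surjective hli (a (b (a (b (b u)))))
  refine ⟨p, hp, r, hr, ?_⟩
  rw [ofFn_adapted] at ep er ⊢
  simp only [leftColumns, List.forall₂_cons, ep, er, h.left_left, hu, hv, hau, hav]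
  simp [combBits, lowBit_eq]

theorem false_of_adapted (h : IrreduciblePair a b)
    (hinv : ∀ S : Set (Fin 8 → ZMod 2), (∀ v ∈ S, a v ∈ S) → (∀ v ∈ S, b v ∈ S) →
      ∀ u ∈ S, u ≠ 0 → QPlus (ZMod 2) u = 0 → ∀ v, v ≠ 0 → QPlus (ZMod 2) v = 0 → v ∈ S)
    {u v : Fin 8 → ZMod 2} (hu : a u = b u) (hv : a v = b v)
    (hli : LinearIndependent (ZMod 2) (adapted b u v (a (b (b u))))) {c d : ZMod 2}
    (hl : b (b (a (b (b u)))) = a (b (b u)) + b (a (b (b u))) +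
        (c • (u + b u + b (b u)) + d • (v + b v + b (b v)))) : False := by
  obtain ⟨q₁, q₂, s, s₁₁, s₁₂, s₂₂, t₁, t₂, w, hD⟩ := h.exists_hasGram hu hv
  obtain ⟨c, d, hB⟩ := h.exists_rightColumns hl
  obtain ⟨p, hp, r, hr, hA⟩ := h.exists_leftColumns hu hv hli
  have hobs := hasObstruction c d q₁ q₂ s s₁₁ s₁₂ s₂₂ t₁ t₂ w
  have h5 := ofFn_adapted b u v (a (b (b u)))
  have inj := fun {m n} => combBits_injective hli (m := m) (n := n)
  generalize formData q₁ q₂ s s₁₁ s₁₂ s₂₂ t₁ t₂ w = D at *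
  generalize rightColumns c d = B at *
  have hlt : ∀ n, linBits (leftColumns p r) n < 256 := linBits_lt (by simp [leftColumns, hp, hr])
  have hsq : ∀ m n : ℕ, m < 256 → n < 256 →
      a (combBits (List.ofFn (adapted b u v (a (b (b u))))) m) =
        combBits (List.ofFn (adapted b u v (a (b (b u))))) n →
      linBits (leftColumns p r) n = m := fun m n hm _ e => by
    refine inj (hlt _) hm ?_
    rw [← map_combBits hA, ← e, h.left_left]
  have e32 := (map_combBits hA 32).trans (congrArg _ (show linBits (leftColumns p r) 32 = p by
    simp [linBits, leftColumns, lowBit_eq]))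
  have e128 := (map_combBits hA 128).trans (congrArg _ (show linBits (leftColumns p r) 128 = r by
    simp [linBits, leftColumns, lowBit_eq]))
  have hpre := preserves_of_isIso h.isIso_left hD hA
  have := hobs (preserves_of_isIso h.isIso_right hD hB _) (countZeros_quadBits hli hD) p hp
    (by
      rw [← hpre [32, 33, 34, 36, 40, 48, 96]]
      simp [preserves, linBits, leftColumns, lowBit_eq])
    r (mem_lastColumns hp hr (hsq _ _ (by norm_num) hp e32)) (hsq _ _ (by norm_num) hr e128)
    (hpre _)
  obtain ⟨S, -, hS⟩ := List.any_eq_true.1 this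
  simp only [isObstruction, Bool.and_eq_true, List.all_eq_true, List.any_eq_true, Bool.not_eq_true',
    List.elem_eq_mem, decide_eq_true_eq, decide_eq_false_iff_not, Nat.ble_eq, Nat.blt_eq,
    List.mem_range, List.isEmpty_eq_false_iff] at hS
  obtain ⟨⟨hne, hmem⟩, n, hn, ⟨hn0, hnQ⟩, hnS⟩ := hS
  obtain ⟨m, hm⟩ := List.exists_mem_of_ne_nil _ hne
  have hnonzero : ∀ {k}, k < 256 → 1 ≤ k →
      combBits (List.ofFn (adapted b u v (a (b (b u))))) k ≠ 0 := fun hk hk1 e => by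
    rw [← combBits_zero (List.ofFn (adapted b u v (a (b (b u)))))] at e
    have := inj hk (by norm_num) e
    omega
  have hquad : ∀ {k}, quadBits D k = false →
      QPlus (ZMod 2) (combBits (List.ofFn (adapted b u v (a (b (b u))))) k) = 0 := fun hk => by
    rw [hD.quad, hk]
    rfl
  obtain ⟨k, hk, e⟩ := hinv
    (combBits (List.ofFn (adapted b u v (a (b (b u))))) '' {k | k ∈ S})
    (by
      rintro _ ⟨k, hk, rfl⟩
      exact ⟨_, (hmem k hk).1.1.1.1, (map_combBits hA k).symm⟩)
    (by
      rintro _ ⟨k, hk, rfl⟩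
      exact ⟨_, (hmem k hk).1.1.1.2, (map_combBits hB k).symm⟩)
    _ ⟨m, hm, rfl⟩ (hnonzero (hmem m hm).2 (hmem m hm).1.2) (hquad (hmem m hm).1.1.2)
    _ (hnonzero hn hn0) (hquad hnQ)
  exact hnS (inj (hmem k hk).2 hn e ▸ hk)

end IrreduciblePair

theorem irreduciblePair_of_generate {F : Type*} [Field F] {x y : GL (Fin 8) F} (hx : x ^ 2 = 1)
    (hy : y ^ 3 = 1) (hgen : Subgroup.closure {x, y} = derivedGroup F) :
    IrreduciblePair (act x) (act y) where
  isIso_left := act_isIso (hgen ▸ Subgroup.subset_closure (Set.mem_insert _ _))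
  isIso_right := act_isIso (hgen ▸ Subgroup.subset_closure (Set.mem_insert_of_mem _ rfl))
  sq_left := by rw [sq, ← act_mul, ← sq, hx, act_one]
  cube_right := by rw [pow_succ, sq, ← act_mul, ← act_mul, ← sq, ← pow_succ, hy, act_one]
  irreducible W hWx hWy hne := by
    refine eq_top_of_derivedGroup_invariant (fun g hg w hw => ?_) hne
    have hle : Subgroup.closure {x, y} ≤ subspaceStabilizer W := by
      rw [Subgroup.closure_le]
      rintro _ (rfl | rfl)
      · exact mem_subspaceStabilizer hWx
      · exact mem_subspaceStabilizer hWy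
    exact (hle (hgen ▸ hg) w).2 hw

theorem not_generate_two {x y : GL (Fin 8) (ZMod 2)} (hx : x ^ 2 = 1) (hy : y ^ 3 = 1)
    (hgen : Subgroup.closure {x, y} = derivedGroup (ZMod 2)) : False := by
  obtain ⟨x, y, hx, hy, hgen, w, hw0, hw⟩ := exists_pair_with_fixed_vector hx hy hgen
  have h := irreduciblePair_of_generate hx hy hgen
  have hxm : x ∈ derivedGroup (ZMod 2) := hgen ▸ Subgroup.subset_closure (Set.mem_insert _ _)
  have hym : y ∈ derivedGroup (ZMod 2) :=
    hgen ▸ Subgroup.subset_closure (Set.mem_insert_of_mem _ rfl)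
  obtain ⟨hK, hb⟩ := h.finrank_coincide (even_finrank_fixedSpace hxm) (even_finrank_fixedSpace hym)
    (act_mul x y ▸ even_finrank_fixedSpace (mul_mem hxm hym)) hw0 (act_mul x y ▸ hw)
  obtain ⟨u, v, hu, hv, hli, c, d, hl⟩ := h.exists_adapted hK hb
  exact h.false_of_adapted (fun S hSx hSy u hu hu0 huQ v hv0 hvQ =>
    mem_of_invariant hx hy hgen hSx hSy hu hu0 huQ hv0 hvQ) hu hv hli hl

theorem not_generated_of_card {F : Type*} [Field F] [Fintype F] (hq : Fintype.card F < 4) :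
    ¬ IsTwoThreeGenerated ↥(commutator ↥(orthogonalGroupOf F (QPlus F))) := by
  intro h
  have h1 := Fintype.one_lt_card (α := F)
  rcases (by omega : Fintype.card F = 2 ∨ Fintype.card F = 3) with h2 | h3
  · obtain ⟨x, y, hx, hy, hgen⟩ := isTwoThreeGenerated_iff.1
      (isTwoThreeGenerated_of_ringEquiv (ZMod.ringEquivOfPrime F Nat.prime_two h2).symm h)
    exact not_generate_two (orderOf_dvd_iff_pow_eq_one.1 hx.dvd)
      (orderOf_dvd_iff_pow_eq_one.1 hy.dvd) hgen
  · obtain ⟨x, y, hx, hy, hgen⟩ := isTwoThreeGenerated_iff.1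
      (isTwoThreeGenerated_of_ringEquiv (ZMod.ringEquivOfPrime F Nat.prime_three h3).symm h)
    exact not_generate_three (orderOf_dvd_iff_pow_eq_one.1 hx.dvd)
      (orderOf_dvd_iff_pow_eq_one.1 hy.dvd) hgen

theorem generated_of_card {F : Type*} [Field F] [Fintype F] (hq : 4 ≤ Fintype.card F) :
    IsTwoThreeGenerated ↥(commutator ↥(orthogonalGroupOf F (QPlus F))) := by
  obtain ⟨p, hchar⟩ := CharP.exists F
  obtain ⟨n, hp, hn⟩ := FiniteField.card F p
  by_cases h2 : (2 : F) = 0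
  · have hp2 : p = 2 := (Nat.prime_dvd_prime_iff_eq hp Nat.prime_two).1
      ((CharP.cast_eq_zero_iff F p 2).1 (by exact_mod_cast h2))
    subst hp2
    rcases lt_or_ge (n : ℕ) 3 with h | h
    · have := n.pos
      rcases (by omega : (n : ℕ) = 1 ∨ (n : ℕ) = 2) with h1 | h1
      · rw [hn, h1] at hq
        omega
      · exact generated_four (by rw [hn, h1]; norm_num)
    · exact generated_of_even_of_card (by
        rw [hn]
        exact (by norm_num : 8 = 2 ^ 3) ▸ Nat.pow_le_pow_right (by norm_num) h)
  · rcases lt_or_ge (Fintype.card F) 7 with h | h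
    · have hodd : ¬ 2 ∣ Fintype.card F := fun hdvd => by
        rw [hn] at hdvd
        have := (Nat.prime_dvd_prime_iff_eq Nat.prime_two hp).1 (Nat.prime_two.dvd_of_dvd_pow hdvd)
        subst this
        exact h2 CharTwo.two_eq_zero
      exact isTwoThreeGenerated_of_ringEquiv
        (ZMod.ringEquivOfPrime F Nat.prime_five (by omega)) generated_five
    · exact generated_of_odd h2 h

end OmegaEight

/-- The finite simple orthogonal groups `Ω₈⁺(q)` (the derived subgroup of the
orthogonal group of the plus-type form) are `(2,3)`-generated iff `q ≥ 4`. -/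
theorem omega8plus_two_three_generated_iff
    (F : Type*) [Field F] [Fintype F] (q : ℕ) (hq : Fintype.card F = q) :
    IsTwoThreeGenerated ↥(commutator ↥(orthogonalGroupOf F (QPlus F))) ↔ 4 ≤ q := by
  subst hq
  exact ⟨fun h => not_lt.1 fun hlt => OmegaEight.not_generated_of_card hlt h,
    OmegaEight.generated_of_card⟩
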